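/- Let r ≥ 1 and let f(x,y) ∈ ℚ[x,y] be an irreducible homogeneous polynomial (binary form) of degree d with d > r and d ≥ 3, and let b be a nonzero integer. Then the equation b·n₁‼ ⋯ n_r‼ = f(x,y) has only finitely many solutions (n₁, …, n_r, x, y) with each n_i a natural number and x, y integers. -/

import Mathlib

section PartA1

set_option linter.all false

open Polynomial in
theorem thue_powers (θ : ℂ) (g : ℤ[X]) (hg : g.Monic) (hθ : aeval θ g = 0) (hd : 1 ≤ g.natDegree) :
    ∃ H : ℕ, 1 ≤ H ∧ ∀ j : ℕ, ∃ c : ℕ → ℤ, θ ^ j = ∑ i ∈ Finset.range g.natDegree, (c i : ℂ) * θ ^ i ∧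
      ∀ i, |c i| ≤ (H : ℤ) ^ j := by
  set d := g.natDegree with hd'
  have hrel : θ ^ d = - ∑ i ∈ Finset.range d, (g.coeff i : ℂ) * θ ^ i := by
    have h1 := hθ
    rw [aeval_eq_sum_range, Finset.sum_range_succ, ← hd'] at h1
    have h2 : g.coeff d = 1 := hg.coeff_natDegree
    rw [h2] at h1
    simp only [zsmul_eq_mul, Int.cast_one, one_mul] at h1
    linear_combination h1
  refine ⟨1 + ∑ i ∈ Finset.range (d+1), (g.coeff i).natAbs, by omega, ?_⟩
  set H : ℕ := 1 + ∑ i ∈ Finset.range (d+1), (g.coeff i).natAbs with hH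
  have hcoef : ∀ i, 1 + |g.coeff i| ≤ (H : ℤ) := by
    intro i
    rw [Int.abs_eq_natAbs]
    by_cases hi : i ∈ Finset.range (d+1)
    · have := Finset.single_le_sum (f := fun i => (g.coeff i).natAbs) (fun _ _ => Nat.zero_le _) hi
      beta_reduce at this
      omega
    · have : g.coeff i = 0 := by
        apply coeff_eq_zero_of_natDegree_lt
        simp at hi; omega
      rw [this]; simp; omega
  intro j
  induction j with
  | zero =>
    refine ⟨fun i => if i = 0 then 1 else 0, ?_, ?_⟩
    · simp only [pow_zero]
      rw [Finset.sum_eq_single 0]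
      · simp
      · intro b _ hb; simp [hb]
      · intro h; simp at h; omega
    · intro i; beta_reduce; split_ifs <;> simp
  | succ j ih =>
    obtain ⟨c, hc, hb⟩ := ih
    refine ⟨fun i => (if i = 0 then 0 else c (i-1)) - c (d-1) * g.coeff i, ?_, ?_⟩
    · obtain ⟨e, he⟩ : ∃ e, d = e + 1 := ⟨d - 1, by omega⟩
      rw [pow_succ, hc]
      have h1 : ∑ i ∈ Finset.range d, (((if i = 0 then 0 else c (i-1)) - c (d-1) * g.coeff i : ℤ) : ℂ) * θ ^ i
          = ∑ i ∈ Finset.range d, (((if i = 0 then 0 else c (i-1)) : ℤ) : ℂ) * θ ^ i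
            + c (d-1) * (- ∑ i ∈ Finset.range d, (g.coeff i : ℂ) * θ ^ i) := by
        rw [mul_neg, Finset.mul_sum, ← sub_eq_add_neg, ← Finset.sum_sub_distrib]
        refine Finset.sum_congr rfl fun i _ => ?_
        push_cast; ring
      rw [h1, ← hrel, he, Finset.sum_range_succ' (fun i => (((if i = 0 then 0 else c (i-1)) : ℤ) : ℂ) * θ ^ i),
        Finset.sum_range_succ, add_mul, Finset.sum_mul]
      simp
      congr 1
      · refine Finset.sum_congr rfl fun i _ => ?_
        ring
      · ring
    · intro i
      have e1 : |(if i = 0 then 0 else c (i-1))| ≤ (H:ℤ)^j := by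
        split_ifs
        · simp
        · exact hb _
      calc _ ≤ |(if i = 0 then 0 else c (i-1))| + |c (d-1) * g.coeff i| := abs_sub _ _
        _ ≤ (H:ℤ)^j + (H:ℤ)^j * |g.coeff i| := by
            rw [abs_mul]; gcongr; exact hb _
        _ = (H:ℤ)^j * (1 + |g.coeff i|) := by ring
        _ ≤ (H:ℤ)^j * H := by gcongr; exact hcoef i
        _ = _ := by ring

open Polynomial in
theorem X_sub_C_pow_dvd_iff_hasse {R : Type*} [CommRing R] (r : R) (G : R[X]) (n : ℕ) :
    (X - C r) ^ n ∣ G ↔ ∀ j < n, eval r (hasseDeriv j G) = 0 := by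
  have h1 : (∀ j < n, eval r (hasseDeriv j G) = 0) ↔ X ^ n ∣ taylor r G := by
    rw [X_pow_dvd_iff]
    simp only [taylor_coeff]
  rw [h1]
  constructor
  · rintro ⟨q, hq⟩
    refine ⟨taylor r q, ?_⟩
    rw [hq, taylor_mul]
    congr 1
    rw [taylor_apply]; simp
  · rintro ⟨q, hq⟩
    refine ⟨taylor (-r) q, ?_⟩
    have : G = taylor (-r) (taylor r G) := by rw [taylor_taylor]; simp
    rw [this, hq, taylor_mul]
    congr 1
    rw [taylor_apply]; simp [sub_eq_add_neg]

open Polynomial in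
open scoped Matrix.Norms.Elementwise in
theorem thue_aux (θ : ℂ) (g : ℤ[X]) (hg : g.Monic) (hθ : aeval θ g = 0) (d : ℕ) (hdg : g.natDegree = d)
    (hd : 1 ≤ d) :
    ∃ c : ℕ, 1 ≤ c ∧ ∀ k : ℕ, 1 ≤ k → ∃ P Q : ℤ[X], (P ≠ 0 ∨ Q ≠ 0) ∧
      P.degree < (7 * d * k : ℕ) ∧ Q.degree < (7 * d * k : ℕ) ∧ (∀ i, |P.coeff i| ≤ (c:ℤ)^k) ∧
      (∀ i, |Q.coeff i| ≤ (c:ℤ)^k) ∧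
      (X - C θ) ^ (12 * k) ∣ P.map (Int.castRingHom ℂ) + C θ * Q.map (Int.castRingHom ℂ) := by
  obtain ⟨H, hH1, hH⟩ := thue_powers θ g hg hθ (by omega)
  rw [hdg] at hH
  choose c hc hcb using hH
  refine ⟨(2^(14*d) * (2*H)^(8*d))^6, Nat.one_le_pow _ _ (by positivity), ?_⟩
  intro k hk
  set M := 7 * d * k with hM
  have hdk : 1 ≤ d * k := Nat.one_le_iff_ne_zero.mpr (by positivity)
  let A : Matrix (Fin (12*k) × Fin d) (Fin 2 × Fin M) ℤ :=
    Matrix.of fun a b => (Nat.choose b.2 a.1 : ℤ) * c (b.2 - a.1 + b.1) a.2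
  have hcard1 : Fintype.card (Fin (12*k) × Fin d) = 12*(d*k) := by simp; ring
  have hcard2 : Fintype.card (Fin 2 × Fin M) = 14*(d*k) := by simp [hM]; ring
  obtain ⟨t, ht0, hAt, htn⟩ := Int.Matrix.exists_ne_zero_int_vec_norm_le A (by rw [hcard1, hcard2]; omega)
    (by rw [hcard1]; omega)
  have hAn : max 1 ‖A‖ ≤ ((2 * H : ℕ) : ℝ) ^ (8 * d * k) := by
    have hH2 : (1:ℝ) ≤ ((2 * H : ℕ) : ℝ) := by exact_mod_cast (by omega : 1 ≤ 2 * H)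
    apply max_le (one_le_pow₀ hH2)
    rw [Matrix.norm_le_iff (by positivity)]
    rintro ⟨a, i⟩ ⟨e, j⟩
    simp only [A, Matrix.of_apply]
    rw [Int.norm_eq_abs, ← Int.cast_abs, abs_mul]
    have hj := j.2
    have he := e.2
    have h1 : |((Nat.choose j a : ℕ) : ℤ)| ≤ 2 ^ (8*d*k) := by
      rw [Nat.abs_cast]
      have : Nat.choose j a ≤ 2 ^ (j:ℕ) := Nat.choose_le_two_pow _ _
      have h2 : 2 ^ (j:ℕ) ≤ 2 ^ (8*d*k) := Nat.pow_le_pow_right (by norm_num) (by nlinarith)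
      exact_mod_cast this.trans h2
    have h2 : |c (j - a + e) i| ≤ (H:ℤ) ^ (8*d*k) := by
      refine (hcb _ _).trans ?_
      have : (1:ℤ) ≤ H := by exact_mod_cast hH1
      apply pow_le_pow_right₀ this
      have : (j:ℕ) - a + e ≤ M := by omega
      nlinarith
    have h3 : |((Nat.choose j a : ℕ) : ℤ)| * |c (j - a + e) i| ≤ ((2 * H : ℕ) : ℤ) ^ (8*d*k) := by
      push_cast; rw [mul_pow]; gcongr
    exact_mod_cast h3
  have hbound : ‖t‖ ≤ (((2^(14*d) * (2*H)^(8*d))^6 : ℕ) : ℝ)^k := by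
    refine htn.trans ?_
    rw [hcard1, hcard2]
    have e1 : ((12 * (d*k) : ℕ) : ℝ) / (((14 * (d*k) : ℕ):ℝ) - ((12 * (d*k) : ℕ) : ℝ)) = (6:ℕ) := by
      have : (d*k : ℝ) ≠ 0 := by exact_mod_cast (by omega : d * k ≠ 0)
      push_cast
      rw [← sub_mul]
      field_simp
      norm_num
    rw [e1, Real.rpow_natCast]
    have e2 : (((14 * (d*k) : ℕ):ℝ)) ≤ 2 ^ (14 * d * k) := by
      have : 14 * (d*k) ≤ 2 ^ (14 * (d * k)) := Nat.lt_two_pow_self.le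
      rw [← mul_assoc] at this ⊢
      exact_mod_cast this
    calc _ ≤ ((2:ℝ) ^ (14 * d * k) * ((2 * H : ℕ) : ℝ) ^ (8 * d * k)) ^ 6 := by gcongr
      _ = _ := by push_cast; ring
  have hbz : ∀ b, |t b| ≤ (((2^(14*d) * (2*H)^(8*d))^6 : ℕ) : ℤ)^k := by
    intro b
    have := (norm_le_pi_norm t b).trans hbound
    rw [Int.norm_eq_abs, ← Int.cast_abs] at this
    exact_mod_cast this
  let R : Fin 2 → ℤ[X] := fun e => ∑ j : Fin M, C (t (e, j)) * X ^ (j:ℕ)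
  have hRc : ∀ e i, (R e).coeff i = if h : i < M then t (e, ⟨i, h⟩) else 0 := by
    intro e i
    simp only [R, finsetSum_coeff, coeff_C_mul, coeff_X_pow]
    split_ifs with h
    · rw [Finset.sum_eq_single ⟨i, h⟩]
      · simp
      · intro b _ hb
        have : i ≠ b := fun h' => hb (by ext; exact h'.symm)
        simp [this]
      · simp
    · apply Finset.sum_eq_zero
      intro b _
      have : i ≠ b := by have := b.2; omega
      simp [this]
  have hRdeg : ∀ e, (R e).degree < (M:ℕ) := by
    intro e
    rw [degree_lt_iff_coeff_zero]
    intro m hm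
    rw [hRc, dif_neg (by omega)]
  have hRb : ∀ e i, |(R e).coeff i| ≤ (((2^(14*d) * (2*H)^(8*d))^6 : ℕ) : ℤ)^k := by
    intro e i
    rw [hRc]
    split_ifs
    · exact hbz _
    · rw [abs_zero]; positivity
  refine ⟨R 0, R 1, ?_, hRdeg 0, hRdeg 1, hRb 0, hRb 1, ?_⟩
  · by_contra hcon
    push Not at hcon
    apply ht0
    funext ⟨e, j⟩
    have : R e = 0 := by fin_cases e; exacts [hcon.1, hcon.2]
    have h2 := hRc e j
    rw [this, dif_pos j.2] at h2
    simpa using h2.symm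
  · set G := (R 0).map (Int.castRingHom ℂ) + C θ * (R 1).map (Int.castRingHom ℂ) with hG
    rw [X_sub_C_pow_dvd_iff_hasse]
    intro a ha
    have hterm : ∀ e : Fin 2, eval θ (hasseDeriv a ((R e).map (Int.castRingHom ℂ))) =
        ∑ j : Fin M, (t (e, j) : ℂ) * ((Nat.choose j a : ℂ) * θ ^ ((j:ℕ) - a)) := by
      intro e
      simp only [R, Polynomial.map_sum, Polynomial.map_mul, Polynomial.map_pow, map_X, map_C, map_sum,
        eval_finsetSum, C_mul_X_pow_eq_monomial, hasseDeriv_monomial, eval_monomial]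
      refine Finset.sum_congr rfl fun j _ => ?_
      simp; ring
    have hpow : ∀ e : Fin 2, θ ^ (e:ℕ) * eval θ (hasseDeriv a ((R e).map (Int.castRingHom ℂ))) =
        ∑ i ∈ Finset.range d, (∑ j : Fin M, ((Nat.choose j a : ℂ) * c (j - a + e) i) * t (e, j)) * θ ^ i := by
      intro e
      rw [hterm]
      simp_rw [Finset.sum_mul]
      rw [Finset.sum_comm, Finset.mul_sum]
      refine Finset.sum_congr rfl fun j _ => ?_
      have := hc (j - a + e)
      rw [show θ ^ (e:ℕ) * ((t (e, j) : ℂ) * ((Nat.choose j a : ℂ) * θ ^ ((j:ℕ) - a))) =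
        (t (e, j) : ℂ) * (Nat.choose j a : ℂ) * θ ^ ((j:ℕ) - a + e) by rw [pow_add]; ring, this,
        Finset.mul_sum]
      refine Finset.sum_congr rfl fun i _ => ?_
      ring
    have hGe : eval θ (hasseDeriv a G) = θ ^ ((0 : Fin 2):ℕ) * eval θ (hasseDeriv a ((R 0).map (Int.castRingHom ℂ)))
        + θ ^ ((1 : Fin 2):ℕ) * eval θ (hasseDeriv a ((R 1).map (Int.castRingHom ℂ))) := by
      rw [hG, map_add, eval_add, ← smul_eq_C_mul, map_smul, eval_smul]
      simp
    rw [hGe, hpow, hpow, ← Finset.sum_add_distrib]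
    apply Finset.sum_eq_zero
    intro i hi
    rw [← add_mul]
    have h0 := congrFun hAt (⟨a, ha⟩, ⟨i, by simpa using hi⟩)
    simp only [Matrix.mulVec, dotProduct, A, Matrix.of_apply, Fintype.sum_prod_type, Fin.sum_univ_two,
      Pi.zero_apply] at h0
    have h0' := congrArg (Int.cast : ℤ → ℂ) h0
    push_cast at h0'
    rw [h0', zero_mul]

end PartA1

section PartA2
set_option linter.all false

open Polynomial in
theorem thue_mult (θ : ℂ) (hθ : IsIntegral ℚ θ) (n : ℕ) : ∀ R : ℚ[X], R ≠ 0 →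
    (X - C θ) ^ n ∣ R.map (algebraMap ℚ ℂ) → n * (minpoly ℚ θ).natDegree ≤ R.natDegree := by
  induction n with
  | zero => intro R _ _; simp
  | succ n ih =>
    intro R hR hdvd
    have hroot : aeval θ R = 0 := by
      rw [aeval_def, ← eval_map]
      exact (dvd_iff_isRoot.mp ((dvd_pow_self _ (Nat.succ_ne_zero n)).trans hdvd))
    obtain ⟨R', hR'⟩ := minpoly.dvd ℚ θ hroot
    have hR'0 : R' ≠ 0 := by rintro rfl; simp at hR'; exact hR hR'
    have hm0 : minpoly ℚ θ ≠ 0 := minpoly.ne_zero hθ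
    have hsep : (minpoly ℚ θ).Separable := (minpoly.irreducible hθ).separable
    obtain ⟨q, hq⟩ : (X - C θ) ∣ (minpoly ℚ θ).map (algebraMap ℚ ℂ) := by
      rw [dvd_iff_isRoot, IsRoot, eval_map, ← aeval_def, minpoly.aeval]
    have hqne : ¬ (X - C θ) ∣ q := by
      rintro ⟨q', hq'⟩
      have hs2 := (hsep.map (f := algebraMap ℚ ℂ)).squarefree
      have := hs2 (X - C θ) ⟨q', by rw [hq, hq']; ring⟩
      exact not_isUnit_X_sub_C θ this
    have hdvd2 : (X - C θ) ^ n ∣ R'.map (algebraMap ℚ ℂ) := by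
      rw [hR', Polynomial.map_mul, hq, pow_succ', mul_assoc] at hdvd
      have h1 := (mul_dvd_mul_iff_left (X_sub_C_ne_zero θ)).mp hdvd
      exact (prime_X_sub_C θ).pow_dvd_of_dvd_mul_left _ hqne h1
    have := ih R' hR'0 hdvd2
    rw [hR', natDegree_mul hm0 hR'0]
    nlinarith

open Polynomial in
theorem thue_wronskian (θ : ℂ) (hθ : IsIntegral ℚ θ) (hirr : ∀ q : ℚ, θ ≠ q) (n M : ℕ)
    (hM : M ≤ n * (minpoly ℚ θ).natDegree) (P Q : ℚ[X]) (hPQ : P ≠ 0 ∨ Q ≠ 0)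
    (hP : P.degree < M) (hQ : Q.degree < M)
    (hdvd : (X - C θ) ^ n ∣ P.map (algebraMap ℚ ℂ) + C θ * Q.map (algebraMap ℚ ℂ)) :
    P * derivative Q - derivative P * Q ≠ 0 := by
  intro hW
  classical
  set D := gcd P Q with hD
  have hD0 : D ≠ 0 := by
    intro h
    rw [hD, gcd_eq_zero_iff] at h
    tauto
  obtain ⟨p, hp⟩ := gcd_dvd_left P Q
  obtain ⟨q, hq⟩ := gcd_dvd_right P Q
  rw [← hD] at hp hq
  have hcop : IsCoprime p q := by
    rw [← gcd_isUnit_iff]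
    have h1 : D * gcd p q ∣ D := by
      conv_rhs => rw [hD]
      apply dvd_gcd
      · rw [hp]; exact mul_dvd_mul_left _ (gcd_dvd_left _ _)
      · rw [hq]; exact mul_dvd_mul_left _ (gcd_dvd_right _ _)
    have h2 : D * gcd p q ∣ D * 1 := by simpa using h1
    exact isUnit_of_dvd_one ((mul_dvd_mul_iff_left hD0).mp h2)
  have hw : p * derivative q = derivative p * q := by
    have : D ^ 2 * (p * derivative q - derivative p * q) = 0 := by
      rw [← hW]
      conv_rhs => rw [hp, hq]
      simp only [derivative_mul]
      ring
    rcases mul_eq_zero.mp this with h | h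
    · exact absurd (pow_eq_zero_iff (two_ne_zero) |>.mp h) hD0
    · exact sub_eq_zero.mp h
  have hp' : derivative p = 0 := by
    rw [← dvd_derivative_iff]
    exact hcop.dvd_of_dvd_mul_right (Dvd.intro _ hw)
  have hq' : derivative q = 0 := by
    rw [← dvd_derivative_iff]
    exact hcop.symm.dvd_of_dvd_mul_left (Dvd.intro_left _ hw.symm)
  obtain ⟨a, ha⟩ : ∃ a, p = C a := ⟨_, eq_C_of_derivative_eq_zero hp'⟩
  obtain ⟨b, hb⟩ : ∃ a, q = C a := ⟨_, eq_C_of_derivative_eq_zero hq'⟩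
  have hab : (a : ℂ) + θ * b ≠ 0 := by
    intro h
    by_cases hb0 : b = 0
    · rw [hb0] at h
      have ha0 : a = 0 := by simpa using h
      rw [hp, hq, ha, hb, ha0, hb0] at hPQ
      simp at hPQ
    · apply hirr (-a / b)
      have : (b:ℂ) ≠ 0 := by exact_mod_cast hb0
      push_cast
      field_simp
      linear_combination h
  have hDdvd : (X - C θ) ^ n ∣ D.map (algebraMap ℚ ℂ) := by
    have e : P.map (algebraMap ℚ ℂ) + C θ * Q.map (algebraMap ℚ ℂ) =
        D.map (algebraMap ℚ ℂ) * C ((a : ℂ) + θ * b) := by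
      conv_lhs => rw [hp, hq, ha, hb]
      simp
      ring
    rw [e] at hdvd
    have hu : IsUnit (C ((a : ℂ) + θ * b)) := isUnit_C.mpr (isUnit_iff_ne_zero.mpr hab)
    exact (hu.dvd_mul_right).mp hdvd
  have h1 := thue_mult θ hθ n D hD0 hDdvd
  have h2 : D.degree < M := by
    rcases hPQ with h | h
    · exact (degree_le_of_dvd (Dvd.intro _ hp.symm) h).trans_lt hP
    · exact (degree_le_of_dvd (Dvd.intro _ hq.symm) h).trans_lt hQ
  have h3 := (natDegree_lt_iff_degree_lt hD0).mpr h2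
  omega

open Polynomial in
theorem thue_gauss (β : ℚ) (s : ℕ) (W : ℤ[X]) (h : (X - C β) ^ s ∣ W.map (Int.castRingHom ℚ)) :
    (β.den : ℤ) ^ s ∣ W.leadingCoeff := by
  set L : ℤ[X] := C (β.den : ℤ) * X - C β.num with hL
  have hden : (β.den : ℤ) ≠ 0 := by exact_mod_cast β.den_ne_zero
  have hLlc : L.leadingCoeff = β.den := by
    rw [hL, sub_eq_add_neg, ← C_neg]
    exact leadingCoeff_linear hden
  have hprim : L.IsPrimitive := by
    intro r hr
    rw [C_dvd_iff_dvd_coeff] at hr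
    have h0 := hr 0
    have h1 := hr 1
    simp only [hL, coeff_sub, coeff_C_mul, coeff_X_zero, coeff_X_one, coeff_C_zero, coeff_C_succ, mul_zero, mul_one,
      zero_sub, sub_zero, dvd_neg] at h0 h1
    have hc : IsCoprime β.num (β.den:ℤ) := by
      rw [Int.isCoprime_iff_gcd_eq_one]
      exact β.reduced
    exact hc.isUnit_of_dvd' h0 h1
  have hprims : (L ^ s).IsPrimitive := by
    induction s with
    | zero => simpa using isPrimitive_one
    | succ s ih =>
      rw [pow_succ]
      exact (ih ((pow_dvd_pow _ (Nat.le_succ s)).trans h)).mul hprim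
  have hd : L ^ s ∣ W := by
    rw [IsPrimitive.Int.dvd_iff_map_cast_dvd_map_cast _ _ hprims]
    have e : (L ^ s).map (Int.castRingHom ℚ) = (X - C β) ^ s * C ((β.den : ℚ) ^ s) := by
      rw [Polynomial.map_pow, C_pow, ← mul_pow]
      congr 1
      rw [hL, Polynomial.map_sub, Polynomial.map_mul, map_C, map_C, map_X, sub_mul, mul_comm X]
      congr 1
      have : (β.num : ℚ) = β * β.den := (Rat.mul_den_eq_num β).symm
      rw [← C_mul, ← this]
      simp
    rw [e]
    have hu : IsUnit (C ((β.den : ℚ) ^ s)) := by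
      rw [isUnit_C, isUnit_iff_ne_zero]
      exact pow_ne_zero _ (by exact_mod_cast β.den_ne_zero)
    exact (hu.mul_right_dvd).mpr h
  have := leadingCoeff_dvd_leadingCoeff hd
  rwa [leadingCoeff_pow, hLlc] at this

open Polynomial in
theorem thue_nonvanish (P Q : ℤ[X]) (M A : ℕ) (hP : P.degree < M) (hQ : Q.degree < M)
    (hPA : ∀ i, |P.coeff i| ≤ A) (hQA : ∀ i, |Q.coeff i| ≤ A)
    (hW : P * derivative Q - derivative P * Q ≠ 0) (β γ : ℚ) (t : ℕ)
    (ht : ∀ j < t, eval β (hasseDeriv j (P.map (Int.castRingHom ℚ) + C γ * Q.map (Int.castRingHom ℚ))) = 0) :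
    β.den ^ (t - 1) ≤ 8 * M ^ 2 * A ^ 2 := by
  set W := P * derivative Q - derivative P * Q with hWdef
  have hM : 1 ≤ M := by
    rcases Nat.eq_zero_or_pos M with h | h
    · subst h
      simp at hP hQ
      simp [hP, hWdef] at hW
    · exact h
  have hdiv : (X - C β) ^ (t - 1) ∣ W.map (Int.castRingHom ℚ) := by
    set F := P.map (Int.castRingHom ℚ) + C γ * Q.map (Int.castRingHom ℚ) with hF
    have h1 : (X - C β) ^ t ∣ F := (X_sub_C_pow_dvd_iff_hasse β F t).mpr ht
    have h2 : (X - C β) ^ (t - 1) ∣ derivative F := pow_sub_one_dvd_derivative_of_pow_dvd h1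
    have e : W.map (Int.castRingHom ℚ) = F * derivative (Q.map (Int.castRingHom ℚ))
      - derivative F * Q.map (Int.castRingHom ℚ) := by
      simp [hWdef, hF, derivative_map]
      ring
    rw [e]
    exact dvd_sub (((pow_dvd_pow _ (Nat.sub_le _ _)).trans h1).mul_right _) (h2.mul_right _)
  have h3 := thue_gauss β (t-1) W hdiv
  have hlc : W.leadingCoeff ≠ 0 := leadingCoeff_ne_zero.mpr hW
  have h4 : (β.den:ℤ) ^ (t-1) ≤ |W.leadingCoeff| := Int.le_of_dvd (abs_pos.mpr hlc) ((dvd_abs _ _).mpr h3)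
  have hdegP : P.natDegree ≤ M := by
    exact natDegree_le_of_degree_le hP.le
  have hdegQ : Q.natDegree ≤ M := natDegree_le_of_degree_le hQ.le
  have hder : ∀ R : ℤ[X], R.degree < M → (∀ i, |R.coeff i| ≤ A) → ∀ i, |(derivative R).coeff i| ≤ M * A := by
    intro R hR hRA i
    rw [coeff_derivative, abs_mul, mul_comm]
    by_cases hi : i + 1 < M
    · have : |((i:ℤ) + 1)| ≤ M := by rw [abs_of_nonneg (by positivity)]; exact_mod_cast hi.le
      gcongr
      exact hRA _
    · have : R.coeff (i+1) = 0 := coeff_eq_zero_of_degree_lt (hR.trans_le (by exact_mod_cast (by omega)))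
      rw [this]; simp; positivity
  have hmul : ∀ (R S : ℤ[X]) (a b : ℤ), (∀ i, |R.coeff i| ≤ a) → (∀ i, |S.coeff i| ≤ b) → ∀ m ≤ 2 * M,
      |(R * S).coeff m| ≤ (2 * M + 1) * (a * b) := by
    intro R S a b hR hS m hm
    have ha : 0 ≤ a := (abs_nonneg _).trans (hR 0)
    have hb : 0 ≤ b := (abs_nonneg _).trans (hS 0)
    rw [coeff_mul]
    refine (Finset.abs_sum_le_sum_abs _ _).trans ?_
    calc _ ≤ ∑ x ∈ Finset.HasAntidiagonal.antidiagonal m, a * b := by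
          refine Finset.sum_le_sum fun x _ => ?_
          rw [abs_mul]
          exact mul_le_mul (hR _) (hS _) (abs_nonneg _) ha
      _ = (m + 1) * (a * b) := by simp
      _ ≤ _ := by
          have : (m:ℤ) ≤ 2 * M := by exact_mod_cast hm
          gcongr
  have hWdeg : W.natDegree ≤ 2 * M := by
    rw [hWdef]
    refine (natDegree_sub_le _ _).trans (max_le ?_ ?_)
    · refine natDegree_mul_le.trans ?_
      have := natDegree_derivative_le Q
      omega
    · refine natDegree_mul_le.trans ?_
      have := natDegree_derivative_le P
      omega
  have h5 : |W.leadingCoeff| ≤ 8 * M ^ 2 * A ^ 2 := by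
    rw [leadingCoeff]
    have e1 := hmul P (derivative Q) A (M * A) hPA (hder Q hQ hQA) _ hWdeg
    have e2 := hmul (derivative P) Q (M * A) A (hder P hP hPA) hQA _ hWdeg
    have : |W.coeff W.natDegree| ≤ |(P * derivative Q).coeff W.natDegree| + |(derivative P * Q).coeff W.natDegree| := by
      conv_lhs => rw [hWdef, coeff_sub]
      exact abs_sub _ _
    have hM' : (1:ℤ) ≤ M := by exact_mod_cast hM
    have : |W.coeff W.natDegree| ≤ (4 * M + 2) * M * (A:ℤ)^2 := by
      linarith
    refine this.trans ?_
    have : (0:ℤ) ≤ (A:ℤ)^2 := by positivity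
    apply mul_le_mul_of_nonneg_right _ this
    nlinarith
  have := h4.trans h5
  exact_mod_cast this

end PartA2

section PartA3
set_option linter.all false

open Polynomial in
theorem hasse_eval_sum {R : Type*} [CommRing R] (G : R[X]) (M t : ℕ) (hG : G.degree < M) (z : R) :
    eval z (hasseDeriv t G) = ∑ l ∈ Finset.range M, G.coeff l * (l.choose t : R) * z ^ (l - t) := by
  rcases eq_or_ne G 0 with h | h
  · subst h; simp
  conv_lhs => rw [G.as_sum_range' M ((natDegree_lt_iff_degree_lt h).mpr hG)]
  rw [map_sum, eval_finsetSum]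
  refine Finset.sum_congr rfl fun l _ => ?_
  rw [hasseDeriv_monomial, eval_monomial]
  ring

open Polynomial in
theorem hasse_eval_bound (G : ℂ[X]) (M t : ℕ) (hM : 1 ≤ M) (hG : G.degree < M) (z : ℂ) (B T : ℝ)
    (hB : ∀ i, ‖G.coeff i‖ ≤ B) (hT : 1 ≤ T) (hz : ‖z‖ ≤ T) :
    ‖eval z (hasseDeriv t G)‖ ≤ B * (4 * T) ^ M := by
  rw [hasse_eval_sum G M t hG]
  have hB0 : 0 ≤ B := (norm_nonneg _).trans (hB 0)
  refine (norm_sum_le _ _).trans ?_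
  calc _ ≤ ∑ l ∈ Finset.range M, B * 2 ^ M * T ^ M := by
        refine Finset.sum_le_sum fun l hl => ?_
        rw [norm_mul, norm_mul, norm_pow]
        have hl' : l ≤ M := by simp at hl; omega
        have h1 : ‖((l.choose t : ℕ) : ℂ)‖ ≤ 2 ^ M := by
          rw [Complex.norm_natCast]
          have : l.choose t ≤ 2 ^ M := (Nat.choose_le_two_pow _ _).trans (Nat.pow_le_pow_right (by norm_num) hl')
          exact_mod_cast this
        have h2 : ‖z‖ ^ (l - t) ≤ T ^ M := by
          calc _ ≤ T ^ (l - t) := by gcongr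
            _ ≤ _ := pow_le_pow_right₀ hT (by omega)
        gcongr
        exact hB l
    _ = M * (B * 2 ^ M * T ^ M) := by simp
    _ ≤ 2 ^ M * (B * 2 ^ M * T ^ M) := by
        gcongr
        exact_mod_cast Nat.lt_two_pow_self.le
    _ = _ := by rw [mul_pow, show (4:ℝ) = 2 * 2 by norm_num, mul_pow]; ring

open Polynomial in
theorem thue_upper (θ : ℂ) (P Q : ℤ[X]) (M A n t : ℕ) (hM : 1 ≤ M) (hP : P.degree < M) (hQ : Q.degree < M)
    (hPA : ∀ i, |P.coeff i| ≤ A) (hQA : ∀ i, |Q.coeff i| ≤ A)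
    (hdvd : (X - C θ) ^ n ∣ P.map (Int.castRingHom ℂ) + C θ * Q.map (Int.castRingHom ℂ))
    (z w : ℂ) (hz : ‖z - θ‖ ≤ 1) (T : ℝ) (hT : T = ‖θ‖ + 2) :
    ‖eval z (hasseDeriv t (P.map (Int.castRingHom ℂ) + C w * Q.map (Int.castRingHom ℂ)))‖ ≤
      A * (16 * T ^ 2) ^ M * (‖z - θ‖ ^ (n - t) + ‖w - θ‖) := by
  have hT2 : 2 ≤ T := by rw [hT]; linarith [norm_nonneg θ]
  have hT1 : 1 ≤ T := by linarith
  set F := P.map (Int.castRingHom ℂ) + C θ * Q.map (Int.castRingHom ℂ) with hF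
  have hmapdeg : ∀ R : ℤ[X], R.degree < M → (R.map (Int.castRingHom ℂ)).degree < M :=
    fun R hR => (degree_map_le).trans_lt hR
  have hmapc : ∀ R : ℤ[X], (∀ i, |R.coeff i| ≤ A) → ∀ i, ‖(R.map (Int.castRingHom ℂ)).coeff i‖ ≤ A := by
    intro R hR i
    rw [coeff_map]
    simp only [eq_intCast, Complex.norm_intCast]
    exact_mod_cast hR i
  have hzT : ‖z‖ ≤ T := by
    calc ‖z‖ = ‖(z - θ) + θ‖ := by ring_nf
      _ ≤ ‖z - θ‖ + ‖θ‖ := norm_add_le _ _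
      _ ≤ T := by rw [hT]; linarith
  have hFdeg : F.degree < M := by
    refine (degree_add_le _ _).trans_lt (max_lt (hmapdeg P hP) ?_)
    rw [← smul_eq_C_mul]
    exact (degree_smul_le _ _).trans_lt (hmapdeg Q hQ)
  have hFc : ∀ i, ‖F.coeff i‖ ≤ A * T := by
    intro i
    rw [hF, coeff_add, coeff_C_mul]
    refine (norm_add_le _ _).trans ?_
    rw [norm_mul]
    have h1 := hmapc P hPA i
    have h2 := hmapc Q hQA i
    have : ‖θ‖ * ‖(Q.map (Int.castRingHom ℂ)).coeff i‖ ≤ ‖θ‖ * A := by gcongr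
    have hA : (0:ℝ) ≤ A := by positivity
    rw [hT]; nlinarith
  have hsplit : P.map (Int.castRingHom ℂ) + C w * Q.map (Int.castRingHom ℂ)
      = F + (w - θ) • Q.map (Int.castRingHom ℂ) := by
    rw [hF, smul_eq_C_mul, C_sub]; ring
  rw [hsplit, map_add, map_smul, eval_add, eval_smul]
  refine (norm_add_le _ _).trans ?_
  rw [smul_eq_mul, norm_mul]
  have hQb := hasse_eval_bound _ M t hM (hmapdeg Q hQ) z A T (hmapc Q hQA) hT1 hzT
  have hpow : (4 * T) ^ M ≤ (16 * T ^ 2) ^ M := by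
    exact pow_le_pow_left₀ (by positivity) (by nlinarith) M
  have hQb' : ‖w - θ‖ * ‖eval z (hasseDeriv t (Q.map (Int.castRingHom ℂ)))‖ ≤ A * (16 * T ^ 2) ^ M * ‖w - θ‖ := by
    rw [mul_comm]
    gcongr
    exact hQb.trans (mul_le_mul_of_nonneg_left hpow (by positivity))
  have hFb : ‖eval z (hasseDeriv t F)‖ ≤ A * (16 * T ^ 2) ^ M * ‖z - θ‖ ^ (n - t) := by
    set G := taylor θ F with hG
    have hGdeg : G.degree < M := by rw [hG, degree_taylor]; exact hFdeg
    have hGc : ∀ i, ‖G.coeff i‖ ≤ A * T * (4 * T) ^ M := by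
      intro i
      rw [hG, taylor_coeff]
      exact hasse_eval_bound F M i hM hFdeg θ (A * T) T hFc hT1 (by rw [hT]; linarith)
    have hGv : ∀ i < n, G.coeff i = 0 := by
      intro i hi
      rw [hG, taylor_coeff]
      exact (X_sub_C_pow_dvd_iff_hasse θ F n).mp hdvd i hi
    have e : eval z (hasseDeriv t F) = eval (z - θ) (hasseDeriv t G) := by
      rw [← taylor_coeff, ← taylor_coeff, hG, taylor_taylor]
      congr 2
      ring_nf
    rw [e, hasse_eval_sum G M t hGdeg]
    refine (norm_sum_le _ _).trans ?_
    calc _ ≤ ∑ l ∈ Finset.range M, A * T * (4 * T) ^ M * 2 ^ M * ‖z - θ‖ ^ (n - t) := by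
          refine Finset.sum_le_sum fun l hl => ?_
          by_cases hln : l < n
          · rw [hGv l hln]; simp; positivity
          rw [norm_mul, norm_mul, norm_pow]
          have hl' : l ≤ M := by simp at hl; omega
          have h1 : ‖((l.choose t : ℕ) : ℂ)‖ ≤ 2 ^ M := by
            rw [Complex.norm_natCast]
            have : l.choose t ≤ 2 ^ M := (Nat.choose_le_two_pow _ _).trans (Nat.pow_le_pow_right (by norm_num) hl')
            exact_mod_cast this
          have h2 : ‖z - θ‖ ^ (l - t) ≤ ‖z - θ‖ ^ (n - t) :=
            pow_le_pow_of_le_one (norm_nonneg _) hz (by omega)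
          gcongr
          exact hGc l
      _ = M * (A * T * (4 * T) ^ M * 2 ^ M * ‖z - θ‖ ^ (n - t)) := by simp
      _ ≤ 2 ^ M * (A * T ^ M * (4 * T) ^ M * 2 ^ M * ‖z - θ‖ ^ (n - t)) := by
          gcongr
          · exact_mod_cast Nat.lt_two_pow_self.le
          · exact le_self_pow₀ hT1 (by omega)
      _ = A * ((2 * T) * (4 * T) * 2) ^ M * ‖z - θ‖ ^ (n - t) := by
          simp only [mul_pow]; ring
      _ = _ := by ring_nf
  rw [mul_add]
  linarith

open Polynomial in
theorem thue_lower (P Q : ℤ[X]) (M t : ℕ) (hP : P.degree < M) (hQ : Q.degree < M) (β γ : ℚ)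
    (hne : eval β (hasseDeriv t (P.map (Int.castRingHom ℚ) + C γ * Q.map (Int.castRingHom ℚ))) ≠ 0) :
    1 ≤ |eval β (hasseDeriv t (P.map (Int.castRingHom ℚ) + C γ * Q.map (Int.castRingHom ℚ)))| *
      (β.den ^ M * γ.den : ℚ) := by
  set r := eval β (hasseDeriv t (P.map (Int.castRingHom ℚ) + C γ * Q.map (Int.castRingHom ℚ))) with hr
  have hmapdeg : ∀ R : ℤ[X], R.degree < M → (R.map (Int.castRingHom ℚ)).degree < M :=
    fun R hR => (degree_map_le).trans_lt hR
  have hmem : r * (β.den ^ M * γ.den : ℚ) ∈ (Int.castRingHom ℚ).range := by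
    have hz : ∀ m : ℤ, (m : ℚ) ∈ (Int.castRingHom ℚ).range := fun m => ⟨m, rfl⟩
    have hn : ∀ m : ℕ, (m : ℚ) ∈ (Int.castRingHom ℚ).range := fun m => ⟨m, by simp⟩
    have hβ : ∀ j ≤ M, β ^ j * β.den ^ M ∈ (Int.castRingHom ℚ).range := by
      intro j hj
      have : β ^ j * β.den ^ M = (β.num : ℚ) ^ j * (β.den:ℚ) ^ (M - j) := by
        rw [← Rat.mul_den_eq_num β, mul_pow, mul_assoc, ← pow_add]
        congr 2; omega
      rw [this]
      exact mul_mem (pow_mem (hz _) _) (pow_mem (hn _) _)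
    have hterm : ∀ R : ℤ[X], R.degree < M → eval β (hasseDeriv t (R.map (Int.castRingHom ℚ))) * β.den ^ M
        ∈ (Int.castRingHom ℚ).range := by
      intro R hR
      rw [hasse_eval_sum _ M t (hmapdeg R hR), Finset.sum_mul]
      refine sum_mem fun l hl => ?_
      rw [mul_assoc]
      refine mul_mem (mul_mem ?_ (hn _)) (hβ _ (by simp at hl; omega))
      rw [coeff_map]
      exact hz _
    have e : r * (β.den ^ M * γ.den : ℚ) =
        (eval β (hasseDeriv t (P.map (Int.castRingHom ℚ))) * β.den ^ M) * γ.den +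
        (eval β (hasseDeriv t (Q.map (Int.castRingHom ℚ))) * β.den ^ M) * γ.num := by
      rw [hr, ← Rat.mul_den_eq_num γ, map_add, eval_add, ← smul_eq_C_mul, map_smul, eval_smul, smul_eq_mul]
      ring
    rw [e]
    exact add_mem (mul_mem (hterm P hP) (hn _)) (mul_mem (hterm Q hQ) (hz _))
  obtain ⟨m, hm⟩ := hmem
  have hpos : (0:ℚ) < (β.den ^ M * γ.den : ℚ) := by
    have h1 : (0:ℚ) < β.den := by exact_mod_cast β.den_pos
    have h2 : (0:ℚ) < γ.den := by exact_mod_cast γ.den_pos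
    positivity
  have hm0 : m ≠ 0 := by
    rintro rfl
    simp only [map_zero] at hm
    rcases mul_eq_zero.mp hm.symm with h | h
    · exact hne h
    · exact hpos.ne' h
  rw [← abs_of_pos hpos, ← abs_mul, ← hm]
  simp only [eq_intCast]
  exact_mod_cast Int.one_le_abs hm0

end PartA3

section PartA4
set_option linter.all false

theorem thue_final_ineq (d k t : ℕ) (q₁ q₂ : ℝ) (E C V ε₁ ε₂ r : ℝ) (hd : 3 ≤ d) (hk : d + 12 ≤ k)
    (hq₁ : 1 ≤ q₁) (hq₂0 : 0 < q₂) (hq₂ : q₂ ≤ q₁ ^ (12 * (k + 1))) (hq₂' : q₁ ^ (12 * k) ≤ q₂)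
    (hE : 1 ≤ E) (hC : 1 ≤ C) (hV : 1 ≤ V)
    (hε₁0 : 0 ≤ ε₁) (hε₁ : ε₁ ≤ C / q₁ ^ d) (hε₂ : ε₂ ≤ C / q₂ ^ d) (ht : q₁ ^ (t - 1) ≤ V ^ k)
    (hlow : 1 ≤ r * (q₁ ^ (7 * d * k) * q₂)) (hup : r ≤ E ^ k * (ε₁ ^ (12 * k - t) + ε₂)) :
    q₁ ^ 2 ≤ 2 * E * C ^ 12 * V ^ d := by
  have hq0 : 0 < q₁ := by linarith
  have hC12 : C ≤ C ^ (12 * k) := le_self_pow₀ hC (by omega)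
  have h1 : q₁ ^ (12 * d * k) * ε₁ ^ (12 * k - t) ≤ C ^ (12 * k) * q₁ ^ (d * t) := by
    calc q₁ ^ (12 * d * k) * ε₁ ^ (12 * k - t) ≤ q₁ ^ (12 * d * k) * (C / q₁ ^ d) ^ (12 * k - t) := by gcongr
      _ ≤ (q₁ ^ (d * (12 * k - t)) * q₁ ^ (d * t)) * (C / q₁ ^ d) ^ (12 * k - t) := by
          gcongr
          rw [← pow_add]
          apply pow_le_pow_right₀ hq₁
          rw [← mul_add]
          have : 12 * k ≤ 12 * k - t + t := by omega
          calc 12 * d * k = d * (12 * k) := by ring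
            _ ≤ _ := Nat.mul_le_mul_left _ this
      _ = C ^ (12 * k - t) * q₁ ^ (d * t) := by
          rw [div_pow, ← pow_mul]
          field_simp
      _ ≤ _ := by
          gcongr
          omega
  have h2 : q₁ ^ (12 * d * k) * ε₂ ≤ C ^ (12 * k) * q₁ ^ (d * t) := by
    have : q₁ ^ (12 * d * k) ≤ q₂ ^ d := by
      calc q₁ ^ (12 * d * k) = (q₁ ^ (12 * k)) ^ d := by rw [← pow_mul]; ring_nf
        _ ≤ _ := by gcongr
    calc q₁ ^ (12 * d * k) * ε₂ ≤ q₁ ^ (12 * d * k) * (C / q₂ ^ d) := by gcongr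
      _ ≤ q₂ ^ d * (C / q₂ ^ d) := by gcongr
      _ = C := by field_simp
      _ ≤ C ^ (12 * k) * 1 := by linarith
      _ ≤ _ := by gcongr; exact one_le_pow₀ hq₁
  have h3 : q₁ ^ (d * t) ≤ (V ^ d) ^ k * q₁ ^ d := by
    calc q₁ ^ (d * t) ≤ q₁ ^ ((t - 1) * d + d) := by
          apply pow_le_pow_right₀ hq₁
          have : t ≤ (t - 1) + 1 := by omega
          calc d * t ≤ d * ((t - 1) + 1) := Nat.mul_le_mul_left _ this
            _ = _ := by ring
      _ = (q₁ ^ (t - 1)) ^ d * q₁ ^ d := by rw [pow_add, pow_mul]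
      _ ≤ (V ^ k) ^ d * q₁ ^ d := by gcongr
      _ = _ := by rw [← pow_mul, ← pow_mul, mul_comm k d]
  have h4 : q₁ ^ (12 * d * k) ≤ 2 * (E ^ k * C ^ (12 * k) * q₁ ^ (d * t)) * (q₁ ^ (7 * d * k) * q₂) := by
    calc q₁ ^ (12 * d * k) = q₁ ^ (12 * d * k) * 1 := by ring
      _ ≤ q₁ ^ (12 * d * k) * (r * (q₁ ^ (7 * d * k) * q₂)) := by gcongr
      _ ≤ q₁ ^ (12 * d * k) * ((E ^ k * (ε₁ ^ (12 * k - t) + ε₂)) * (q₁ ^ (7 * d * k) * q₂)) := by gcongr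
      _ = E ^ k * (q₁ ^ (12 * d * k) * ε₁ ^ (12 * k - t) + q₁ ^ (12 * d * k) * ε₂) * (q₁ ^ (7 * d * k) * q₂) := by ring
      _ ≤ E ^ k * (C ^ (12 * k) * q₁ ^ (d * t) + C ^ (12 * k) * q₁ ^ (d * t)) * (q₁ ^ (7 * d * k) * q₂) := by gcongr
      _ = _ := by ring
  set Y := 2 * E * C ^ 12 * V ^ d with hY
  have h5 : q₁ ^ (12 * d * k) ≤ Y ^ k * q₁ ^ (d + 12) * q₁ ^ (7 * d * k + 12 * k) := by
    calc q₁ ^ (12 * d * k) ≤ 2 * (E ^ k * C ^ (12 * k) * q₁ ^ (d * t)) * (q₁ ^ (7 * d * k) * q₂) := h4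
      _ ≤ 2 ^ k * (E ^ k * C ^ (12 * k) * ((V ^ d) ^ k * q₁ ^ d)) * (q₁ ^ (7 * d * k) * q₁ ^ (12 * (k + 1))) := by
          gcongr
          exact le_self_pow₀ (by norm_num) (by omega)
      _ = _ := by
          rw [hY, mul_pow, mul_pow, mul_pow, ← pow_mul C]; ring
  have h6 : q₁ ^ (2 * k + (d + 12) + (7 * d * k + 12 * k)) ≤ q₁ ^ (12 * d * k) := by
    apply pow_le_pow_right₀ hq₁
    nlinarith
  have h7 : q₁ ^ (2 * k) ≤ Y ^ k := by
    have := h6.trans h5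
    rw [pow_add, pow_add] at this
    have h8 : q₁ ^ (2 * k) * (q₁ ^ (d + 12) * q₁ ^ (7 * d * k + 12 * k)) ≤ Y ^ k * (q₁ ^ (d + 12) * q₁ ^ (7 * d * k + 12 * k)) := by
      rw [← mul_assoc, ← mul_assoc]; exact this
    exact le_of_mul_le_mul_right h8 (by positivity)
  rw [pow_mul] at h7
  exact (pow_le_pow_iff_left₀ (by positivity) (by positivity) (by omega)).mp h7

open Polynomial in
theorem thue_integral (θ : ℂ) (hθ : IsIntegral ℤ θ) (d : ℕ) (hd : (minpoly ℚ θ).natDegree = d) (hd3 : 3 ≤ d)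
    (C₀ : ℝ) : {β : ℚ | ‖θ - β‖ ≤ C₀ / (β.den : ℝ) ^ d}.Finite := by
  by_contra hinf
  set S := {β : ℚ | ‖θ - β‖ ≤ C₀ / (β.den : ℝ) ^ d} with hS
  -- denominators are unbounded
  have hunb : ∀ B : ℕ, ∃ β ∈ S, B < β.den := by
    intro B
    by_contra hcon
    push Not at hcon
    apply hinf
    obtain ⟨N, hN⟩ := exists_nat_ge ((‖θ‖ + |C₀|) * B)
    have hsub : S ⊆ (fun p : ℤ × ℕ => (p.1 : ℚ) / p.2) '' ((Set.Icc (-(N:ℤ)) N) ×ˢ (Set.Iic B)) := by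
      intro β hβ
      refine ⟨(β.num, β.den), ⟨?_, hcon β hβ⟩, Rat.num_div_den β⟩
      have hβ' : ‖θ - β‖ ≤ |C₀| := by
        refine (show ‖θ - β‖ ≤ C₀ / (β.den : ℝ) ^ d from hβ).trans ?_
        have : (1:ℝ) ≤ (β.den : ℝ) ^ d := one_le_pow₀ (by exact_mod_cast β.den_pos)
        calc _ ≤ |C₀| / (β.den : ℝ) ^ d := by gcongr; exact le_abs_self _
          _ ≤ |C₀| := div_le_self (abs_nonneg _) this
      have h1 : |(β : ℝ)| ≤ ‖θ‖ + |C₀| := by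
        have : ‖(β : ℂ)‖ = |(β:ℝ)| := by simp
        rw [← this]
        calc ‖(β:ℂ)‖ = ‖θ - (θ - β)‖ := by ring_nf
          _ ≤ _ := (norm_sub_le _ _).trans (by gcongr)
      have h2 : |(β.num : ℝ)| ≤ N := by
        refine le_trans ?_ hN
        have : (β.num : ℝ) = β * β.den := by exact_mod_cast (Rat.mul_den_eq_num β).symm
        rw [this, abs_mul]
        have : |(β.den : ℝ)| ≤ B := by rw [abs_of_nonneg (by positivity)]; exact_mod_cast hcon β hβ
        gcongr
      have h3 : |β.num| ≤ N := by exact_mod_cast h2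
      exact abs_le.mp h3
    refine Set.Finite.subset (Set.Finite.image _ ?_) hsub
    exact (Set.finite_Icc _ _).prod (Set.finite_Iic _)
  have hθQ : IsIntegral ℚ θ := hθ.tower_top
  have hmin : minpoly ℚ θ = (minpoly ℤ θ).map (algebraMap ℤ ℚ) := minpoly.isIntegrallyClosed_eq_field_fractions' ℚ hθ
  have hmZ : (minpoly ℤ θ).natDegree = d := by
    rw [← hd, hmin, (minpoly.monic hθ).natDegree_map]
  have hirr : ∀ q : ℚ, θ ≠ q := by
    rintro q rfl
    have : minpoly ℚ ((q : ℚ) : ℂ) = X - C q := minpoly.eq_X_sub_C ℂ q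
    rw [this, natDegree_X_sub_C] at hd
    omega
  obtain ⟨c, hc1, hc⟩ := thue_aux θ (minpoly ℤ θ) (minpoly.monic hθ) (minpoly.aeval ℤ θ) d hmZ (by omega)
  set T : ℝ := ‖θ‖ + 2 with hT
  set C₁ : ℝ := max 1 C₀ with hC₁
  set E : ℝ := c * (16 * T ^ 2) ^ (7 * d) with hE
  set V : ℕ := 8 * 4 ^ (7 * d) * c ^ 2 with hV
  have hT2 : 2 ≤ T := by rw [hT]; linarith [norm_nonneg θ]
  have hcR : (1:ℝ) ≤ c := by exact_mod_cast hc1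
  have hE1 : 1 ≤ E := by
    rw [hE]
    exact one_le_mul_of_one_le_of_one_le hcR (one_le_pow₀ (by nlinarith))
  have hV1 : 1 ≤ V := by
    rw [hV]
    have : 1 ≤ 4 ^ (7 * d) := Nat.one_le_pow _ _ (by norm_num)
    have : 1 ≤ c ^ 2 := Nat.one_le_pow _ _ (by omega)
    nlinarith
  obtain ⟨Y, hY⟩ := exists_nat_ge (2 * E * C₁ ^ 12 * (V:ℝ) ^ d)
  obtain ⟨Y', hY'⟩ := exists_nat_ge C₁
  obtain ⟨β, hβS, hβ⟩ := hunb (Y + Y' + 1)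
  obtain ⟨γ, hγS, hγ⟩ := hunb (β.den ^ (12 * (12 + d)))
  set q₁ := β.den with hq₁
  set q₂ := γ.den with hq₂
  set k := Nat.log q₁ q₂ / 12 with hk
  have hq12 : 1 < q₁ := by omega
  have hlog : 12 * (12 + d) ≤ Nat.log q₁ q₂ := Nat.le_log_of_pow_le hq12 hγ.le
  have hkd : d + 12 ≤ k := by omega
  have hq2lo : q₁ ^ (12 * k) ≤ q₂ := by
    refine le_trans (Nat.pow_le_pow_right (by omega) ?_) (Nat.pow_log_le_self q₁ (x := q₂) (by have := γ.den_pos; omega))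
    omega
  have hq2hi : q₂ ≤ q₁ ^ (12 * (k + 1)) := by
    refine le_trans (Nat.lt_pow_succ_log_self hq12 q₂).le (Nat.pow_le_pow_right (by omega) ?_)
    omega
  obtain ⟨P, Q, hPQ, hPd, hQd, hPc, hQc, hdvd⟩ := hc k (by omega)
  set M := 7 * d * k with hM
  have hM1 : 1 ≤ M := Nat.one_le_iff_ne_zero.mpr (by rw [hM]; have : k ≠ 0 := by omega
                                                     have : d ≠ 0 := by omega
                                                     positivity)
  have hinj : Function.Injective (Polynomial.map (Int.castRingHom ℚ)) := Polynomial.map_injective _ Int.cast_injective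
  have hW : P * derivative Q - derivative P * Q ≠ 0 := by
    have hm2 : ∀ R : ℤ[X], (R.map (Int.castRingHom ℚ)).map (algebraMap ℚ ℂ) = R.map (Int.castRingHom ℂ) := by
      intro R
      rw [Polynomial.map_map]
      congr 1
    have := thue_wronskian θ hθQ hirr (12 * k) M (by rw [hd, hM]; nlinarith) (P.map (Int.castRingHom ℚ))
      (Q.map (Int.castRingHom ℚ)) (by
        rcases hPQ with h | h
        · left; rwa [Ne, Polynomial.map_eq_zero_iff Int.cast_injective]
        · right; rwa [Ne, Polynomial.map_eq_zero_iff Int.cast_injective])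
      (degree_map_le.trans_lt hPd) (degree_map_le.trans_lt hQd) (by rw [hm2, hm2]; exact hdvd)
    intro h
    apply this
    have h2 := congrArg (Polynomial.map (Int.castRingHom ℚ)) h
    simpa [derivative_map] using h2
  have hPc' : ∀ i, |P.coeff i| ≤ ((c ^ k : ℕ) : ℤ) := by intro i; push_cast; exact hPc i
  have hQc' : ∀ i, |Q.coeff i| ≤ ((c ^ k : ℕ) : ℤ) := by intro i; push_cast; exact hQc i
  have hVk : 8 * M ^ 2 * (c ^ k) ^ 2 ≤ V ^ k := by
    have e1 : M ^ 2 ≤ 4 ^ M := by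
      have : M ≤ 2 ^ M := Nat.lt_two_pow_self.le
      calc M ^ 2 ≤ (2 ^ M) ^ 2 := Nat.pow_le_pow_left this 2
        _ = 4 ^ M := by rw [← pow_mul, mul_comm, pow_mul]; norm_num
    have e2 : 8 ≤ 8 ^ k := Nat.le_self_pow (by omega) 8
    calc 8 * M ^ 2 * (c ^ k) ^ 2 ≤ 8 ^ k * 4 ^ M * (c ^ k) ^ 2 := by gcongr
      _ = V ^ k := by rw [hV, hM, mul_pow, mul_pow]; ring
  have hnv := thue_nonvanish P Q M (c ^ k) hPd hQd hPc' hQc' hW β γ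
  have hex : ∃ t, eval β (hasseDeriv t (P.map (Int.castRingHom ℚ) + C γ * Q.map (Int.castRingHom ℚ))) ≠ 0 := by
    by_contra hcon
    push Not at hcon
    have h1 := hnv (8 * M ^ 2 * (c ^ k) ^ 2 + 1) (fun j _ => hcon j)
    have h2 := Nat.lt_pow_self hq12 (n := 8 * M ^ 2 * (c ^ k) ^ 2)
    simp only [Nat.add_sub_cancel] at h1
    exact absurd (h2.trans_le h1) (lt_irrefl _)
  classical
  obtain ⟨t, htne, htmin⟩ : ∃ t, eval β (hasseDeriv t (P.map (Int.castRingHom ℚ) + C γ * Q.map (Int.castRingHom ℚ))) ≠ 0 ∧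
      ∀ j < t, eval β (hasseDeriv j (P.map (Int.castRingHom ℚ) + C γ * Q.map (Int.castRingHom ℚ))) = 0 :=
    ⟨Nat.find hex, Nat.find_spec hex, fun j hj => not_not.mp (Nat.find_min hex hj)⟩
  have ht := (hnv t htmin).trans hVk
  have hlow := thue_lower P Q M t hPd hQd β γ htne
  set r := eval β (hasseDeriv t (P.map (Int.castRingHom ℚ) + C γ * Q.map (Int.castRingHom ℚ))) with hr
  have hrC : (r : ℂ) = eval (β:ℂ) (hasseDeriv t (P.map (Int.castRingHom ℂ) + C (γ:ℂ) * Q.map (Int.castRingHom ℂ))) := by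
    have hPd' : (P.map (Int.castRingHom ℚ) + C γ * Q.map (Int.castRingHom ℚ)).degree < M := by
      refine (degree_add_le _ _).trans_lt (max_lt (degree_map_le.trans_lt hPd) ?_)
      rw [← smul_eq_C_mul]
      exact (degree_smul_le _ _).trans_lt (degree_map_le.trans_lt hQd)
    have hPd'' : (P.map (Int.castRingHom ℂ) + C (γ:ℂ) * Q.map (Int.castRingHom ℂ)).degree < M := by
      refine (degree_add_le _ _).trans_lt (max_lt (degree_map_le.trans_lt hPd) ?_)
      rw [← smul_eq_C_mul]
      exact (degree_smul_le _ _).trans_lt (degree_map_le.trans_lt hQd)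
    rw [hr, hasse_eval_sum _ M t hPd', hasse_eval_sum _ M t hPd'']
    push_cast
    refine Finset.sum_congr rfl fun l _ => ?_
    simp
  have hβS' : ‖(β:ℂ) - θ‖ ≤ C₁ / (q₁:ℝ) ^ d := by
    rw [norm_sub_rev]
    refine (show ‖θ - β‖ ≤ C₀ / (β.den : ℝ) ^ d from hβS).trans ?_
    gcongr
    exact le_max_right _ _
  have hγS' : ‖(γ:ℂ) - θ‖ ≤ C₁ / (q₂:ℝ) ^ d := by
    rw [norm_sub_rev]
    refine (show ‖θ - γ‖ ≤ C₀ / (γ.den : ℝ) ^ d from hγS).trans ?_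
    gcongr
    exact le_max_right _ _
  have hC1 : 1 ≤ C₁ := le_max_left _ _
  have hq1R : (1:ℝ) ≤ q₁ := by exact_mod_cast hq12.le
  have hβ1 : ‖(β:ℂ) - θ‖ ≤ 1 := by
    refine hβS'.trans ?_
    rw [div_le_one (by positivity)]
    have h1 : C₁ ≤ q₁ := hY'.trans (by exact_mod_cast (by omega))
    exact h1.trans (le_self_pow₀ hq1R (by omega))
  have hup := thue_upper θ P Q M (c ^ k) (12 * k) t hM1 hPd hQd hPc' hQc' hdvd β γ hβ1 T hT
  rw [← hrC] at hup
  have hfin := thue_final_ineq d k t q₁ q₂ E C₁ V ‖(β:ℂ) - θ‖ ‖(γ:ℂ) - θ‖ ‖(r:ℂ)‖ hd3 hkd hq1R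
    (by exact_mod_cast γ.den_pos) (by exact_mod_cast hq2hi) (by exact_mod_cast hq2lo) hE1 hC1 (by exact_mod_cast hV1)
    (norm_nonneg _) hβS' hγS' (by exact_mod_cast ht) (by
      have : ‖(r:ℂ)‖ = ((|r| : ℚ) : ℝ) := by simp
      rw [this]
      exact_mod_cast hlow) (by
      refine hup.trans (le_of_eq ?_)
      rw [hE, hM]
      push_cast
      ring)
  have h8 := hfin.trans hY
  have h9 : (q₁ ^ 2 : ℕ) ≤ Y := by exact_mod_cast h8
  nlinarith

end PartA4

section PartA5
set_option linter.all false
open Polynomial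

theorem form_dehom (f : MvPolynomial (Fin 2) ℚ) (d : ℕ) (hd : 3 ≤ d) (hirr : Irreducible f)
    (hhom : f.IsHomogeneous d) :
    ∃ F : ℚ[X], Irreducible F ∧ F.natDegree = d ∧ F.homogenize d = f := by
  set F : ℚ[X] := MvPolynomial.aeval ![X, 1] f with hF
  have hFf : F.homogenize d = f := homogenize_eq_of_isHomogeneous hhom rfl
  have hunit : ∀ g : ℚ[X], ∀ n, IsUnit (g.homogenize n) → n = 0 := by
    intro g n hg
    have h0 : g.homogenize n ≠ 0 := hg.ne_zero
    have h1 := (isHomogeneous_homogenize g (n := n)).totalDegree h0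
    rw [← h1]
    exact (MvPolynomial.isUnit_iff_totalDegree_of_isReduced.mp hg).2
  have hF0 : F ≠ 0 := by
    intro h
    rw [h, homogenize_zero] at hFf
    exact hirr.ne_zero hFf.symm
  have hle : F.natDegree ≤ d := by
    by_contra hcon
    push Not at hcon
    have h1 : (F.homogenize d) = ((F - C F.leadingCoeff * X ^ F.natDegree).homogenize d) := by
      rw [homogenize_sub, C_mul_X_pow_eq_monomial, homogenize_monomial_of_lt hcon, sub_zero]
    have h2 : MvPolynomial.aeval ![X, 1] f = F := rfl
    rw [← hFf] at h2
    have h3 : ((MvPolynomial.aeval ![(X:ℚ[X]), 1]) (F.homogenize d)).natDegree ≤ d := by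
      rw [homogenize, _root_.map_sum]
      apply natDegree_sum_le_of_forall_le
      intro kl hkl
      rw [MvPolynomial.aeval_monomial]
      rw [Finset.HasAntidiagonal.mem_antidiagonal] at hkl
      rw [Finsupp.prod_fintype _ _ (by simp)]
      simp
      refine (natDegree_C_mul_X_pow_le _ _).trans ?_
      omega
    rw [h2] at h3
    omega
  have hdeg : F.natDegree = d := by
    by_contra hne
    have hlt : F.natDegree ≤ d - 1 := by omega
    have h1 : f = F.homogenize (d - 1) * (1 : ℚ[X]).homogenize 1 := by
      rw [← homogenize_mul F 1 hlt (by simp), mul_one, ← hFf]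
      congr 1; omega
    rcases hirr.isUnit_or_isUnit h1 with h | h
    · have := hunit _ _ h; omega
    · have := hunit _ _ h; omega
  refine ⟨F, ?_, hdeg, hFf⟩
  constructor
  · intro h
    have := natDegree_eq_zero_of_isUnit h
    omega
  · intro a b hab
    have ha0 : a ≠ 0 := by rintro rfl; simp at hab; exact hF0 hab
    have hb0 : b ≠ 0 := by rintro rfl; simp at hab; exact hF0 hab
    have h1 : f = a.homogenize a.natDegree * b.homogenize b.natDegree := by
      rw [← homogenize_mul a b le_rfl le_rfl, ← hab, ← hFf, ← hdeg]
      congr 1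
      rw [hab, natDegree_mul ha0 hb0]
    rcases hirr.isUnit_or_isUnit h1 with h | h
    · left
      have := hunit _ _ h
      rw [Polynomial.isUnit_iff_degree_eq_zero, degree_eq_natDegree ha0, this]; rfl
    · right
      have := hunit _ _ h
      rw [Polynomial.isUnit_iff_degree_eq_zero, degree_eq_natDegree hb0, this]; rfl

theorem thue_algebraic (θ : ℂ) (hθ : IsIntegral ℚ θ) (d : ℕ) (hd : (minpoly ℚ θ).natDegree = d) (hd3 : 3 ≤ d)
    (C₀ : ℝ) : {β : ℚ | ‖θ - β‖ ≤ C₀ / (β.den : ℝ) ^ d}.Finite := by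
  obtain ⟨a, ha0, ha⟩ := IsAlgebraic.exists_integral_multiple
    ((IsFractionRing.isAlgebraic_iff ℤ ℚ ℂ (x := θ)).mpr hθ.isAlgebraic)
  have hdeg : (minpoly ℚ (a • θ)).natDegree = d := by
    have : a • θ = (a : ℚ) • θ := by simp [Algebra.smul_def]
    rw [this, IsIntegrallyClosed.minpoly_smul (by exact_mod_cast ha0) hθ, natDegree_scaleRoots, hd]
  have h1 := thue_integral (a • θ) ha d hdeg hd3 (|(a:ℝ)| * |C₀|)
  refine Set.Finite.of_injOn (f := fun β : ℚ => (a : ℚ) * β) ?_ ?_ h1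
  · intro β hβ
    simp only [Set.mem_setOf_eq] at hβ ⊢
    have h2 : a • θ - (((a : ℚ) * β : ℚ) : ℂ) = a * (θ - β) := by
      push_cast; rw [zsmul_eq_mul]; ring
    rw [h2, norm_mul]
    have h3 : ((a:ℚ) * β).den ≤ β.den := by
      apply Nat.le_of_dvd β.den_pos
      simpa using Rat.mul_den_dvd (a:ℚ) β
    have h3' : (0:ℝ) < ((a:ℚ) * β).den := by exact_mod_cast Rat.den_pos _
    have h4 : ‖(a:ℂ)‖ = |(a:ℝ)| := by simp
    rw [h4, mul_div_assoc]
    gcongr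
    refine hβ.trans ?_
    calc C₀ / (β.den:ℝ) ^ d ≤ |C₀| / (β.den:ℝ)^d := by gcongr; exact le_abs_self _
      _ ≤ _ := by gcongr
  · intro x _ y _ hxy
    have : (a:ℚ) ≠ 0 := by exact_mod_cast ha0
    exact mul_left_cancel₀ this hxy

theorem thue_form (F : ℚ[X]) (d : ℕ) (hd : 3 ≤ d) (hirr : Irreducible F) (hF : F.natDegree = d) (m : ℚ) (hm : m ≠ 0) :
    {p : ℤ × ℤ | MvPolynomial.eval ![(p.1 : ℚ), (p.2 : ℚ)] (F.homogenize d) = m}.Finite := by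
  classical
  set Fc := F.map (algebraMap ℚ ℂ) with hFc
  have hsplit : Fc.Splits := IsAlgClosed.splits Fc
  have hsep : Fc.Separable := hirr.separable.map
  set R := Fc.roots.toFinset with hR
  have hprod : ∀ z : ℂ, Fc.eval z = Fc.leadingCoeff * ∏ θ ∈ R, (z - θ) := by
    intro z
    conv_lhs => rw [hsplit.eq_prod_roots]
    rw [eval_mul, eval_C, eval_multiset_prod, Multiset.map_map, hR, Finset.prod, Multiset.toFinset_val,
      Multiset.dedup_eq_self.mpr (nodup_roots hsep)]
    simp
  have hmin : ∀ θ ∈ R, IsIntegral ℚ θ ∧ (minpoly ℚ θ).natDegree = d := by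
    intro θ hθ
    rw [hR, Multiset.mem_toFinset, mem_roots', hFc, IsRoot, eval_map_algebraMap] at hθ
    refine ⟨IsAlgebraic.isIntegral ⟨F, hirr.ne_zero, hθ.2⟩, ?_⟩
    rw [← minpoly.eq_of_irreducible hirr hθ.2, natDegree_mul_C (by simpa using hirr.ne_zero), hF]
  have hlc : Fc.leadingCoeff ≠ 0 := by
    rw [Ne, leadingCoeff_eq_zero, hFc, Polynomial.map_eq_zero]; exact hirr.ne_zero
  -- separation
  obtain ⟨δ, hδ0, hδ⟩ : ∃ δ : ℝ, 0 < δ ∧ ∀ θ ∈ R, ∀ θ' ∈ R, θ ≠ θ' → 2 * δ ≤ ‖θ - θ'‖ := by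
    have : ∀ᶠ δ : ℝ in nhdsWithin 0 (Set.Ioi 0), ∀ p ∈ R ×ˢ R, p.1 ≠ p.2 → 2 * δ ≤ ‖p.1 - p.2‖ := by
      rw [Filter.eventually_all_finset]
      intro p _
      by_cases h : p.1 = p.2
      · simp [h]
      · have h0 : 0 < ‖p.1 - p.2‖ / 2 := by have := norm_pos_iff.mpr (sub_ne_zero.mpr h); linarith
        filter_upwards [nhdsWithin_le_nhds (Iio_mem_nhds h0)] with δ hδ _
        have : δ < ‖p.1 - p.2‖ / 2 := hδ
        linarith
    obtain ⟨δ, h1, h2⟩ := (this.and self_mem_nhdsWithin).exists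
    exact ⟨δ, h2, fun θ hθ θ' hθ' hne => h1 (θ, θ') (Finset.mem_product.mpr ⟨hθ, hθ'⟩) hne⟩
  have hRne : R.Nonempty := by
    rw [Finset.nonempty_iff_ne_empty]
    intro h
    have : Fc.natDegree = 0 := by
      rw [hsplit.natDegree_eq_card_roots]
      rw [hR, Multiset.toFinset_eq_empty] at h
      simp [h]
    rw [hFc, natDegree_map, hF] at this
    omega
  set c : ℝ := ‖Fc.leadingCoeff‖ * δ ^ (R.card - 1) with hc
  have hc0 : 0 < c := by have := norm_pos_iff.mpr hlc; positivity
  have hlow : ∀ z : ℂ, ∃ θ ∈ R, c * ‖z - θ‖ ≤ ‖Fc.eval z‖ := by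
    intro z
    obtain ⟨θ, hθ, hθm⟩ := R.exists_min_image (fun θ => ‖z - θ‖) hRne
    refine ⟨θ, hθ, ?_⟩
    rw [hprod, norm_mul, norm_prod, ← Finset.mul_prod_erase _ _ hθ]
    have : δ ^ (R.card - 1) ≤ ∏ x ∈ R.erase θ, ‖z - x‖ := by
      rw [← Finset.card_erase_of_mem hθ, ← Finset.prod_const]
      apply Finset.prod_le_prod
      · intros; exact hδ0.le
      · intro x hx
        have h1 := hδ θ hθ x (Finset.mem_of_mem_erase hx) (Finset.ne_of_mem_erase hx).symm
        have h2 := hθm x (Finset.mem_of_mem_erase hx)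
        have h3 : ‖θ - x‖ ≤ ‖z - x‖ + ‖z - θ‖ := by
          have := norm_sub_le (z - x) (z - θ)
          rwa [show z - x - (z - θ) = θ - x by ring] at this
        linarith
    calc c * ‖z - θ‖ = ‖Fc.leadingCoeff‖ * (‖z - θ‖ * δ ^ (R.card - 1)) := by rw [hc]; ring
      _ ≤ _ := by gcongr
  set T : Set ℚ := ⋃ θ ∈ R, {β : ℚ | ‖θ - β‖ ≤ (|(m:ℝ)| / c) / (β.den : ℝ) ^ d} with hT
  have hTfin : T.Finite := by
    rw [hT]
    refine Set.Finite.biUnion R.finite_toSet ?_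
    intro θ hθ
    exact thue_algebraic θ (hmin θ hθ).1 d (hmin θ hθ).2 hd _
  have hFβ : ∀ β : ℚ, F.eval β ≠ 0 := by
    intro β hβ
    have := degree_eq_one_of_irreducible_of_root hirr hβ
    have := natDegree_eq_of_degree_eq_some (n := 1) (by simpa using this)
    omega
  -- the y = 0 solutions
  have hy0 : {x : ℤ | MvPolynomial.eval ![(x : ℚ), (0 : ℚ)] (F.homogenize d) = m}.Finite := by
    have hp : (C (F.coeff d) * X ^ d - C m : ℚ[X]) ≠ 0 := by
      intro h
      have := congrArg (Polynomial.coeff · 0) h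
      simp [show ¬ (0 = d) by omega, show ¬ (d = 0) by omega] at this
      exact hm this
    refine Set.Finite.of_injOn (f := fun x : ℤ => (x : ℚ)) (t := {x : ℚ | x ∈ (C (F.coeff d) * X ^ d - C m : ℚ[X]).roots}) ?_ (Int.cast_injective.injOn) ?_
    · intro x hx
      simp only [Set.mem_setOf_eq] at hx ⊢
      rw [mem_roots hp]
      rw [homogenize, _root_.map_sum, Finset.sum_eq_single (d, 0)] at hx
      · simp [MvPolynomial.eval_monomial] at hx
        simp [hx]
      · intro b hb hne
        rw [Finset.HasAntidiagonal.mem_antidiagonal] at hb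
        have : b.2 ≠ 0 := by
          intro h0; apply hne; ext <;> simp <;> omega
        rw [MvPolynomial.eval_monomial, Finsupp.prod_fintype _ _ (by simp)]
        simp [this]
      · simp
    · exact Multiset.finite_toSet _
  have hyβ : ∀ β : ℚ, {y : ℤ | F.eval β * (y:ℚ) ^ d = m}.Finite := by
    intro β
    have hp : (C (F.eval β) * X ^ d - C m : ℚ[X]) ≠ 0 := by
      intro h
      have := congrArg (Polynomial.coeff · 0) h
      simp [show ¬ (0 = d) by omega, show ¬ (d = 0) by omega] at this
      exact hm this
    refine Set.Finite.of_injOn (f := fun x : ℤ => (x : ℚ)) (t := {x : ℚ | x ∈ (C (F.eval β) * X ^ d - C m : ℚ[X]).roots}) ?_ (Int.cast_injective.injOn) ?_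
    · intro x hx
      simp only [Set.mem_setOf_eq] at hx ⊢
      rw [mem_roots hp]
      simp [hx]
    · exact Multiset.finite_toSet _
  have hbig := (hy0.image (fun x => (x, (0:ℤ)))).union
    (Set.Finite.biUnion hTfin (t := fun β => (fun y : ℤ => ((β * y : ℚ).num, y)) '' {y : ℤ | F.eval β * (y:ℚ) ^ d = m})
    (fun β _ => (hyβ β).image _))
  refine hbig.subset ?_
  rintro ⟨x, y⟩ hxy
  simp only [Set.mem_setOf_eq] at hxy
  by_cases hy : y = 0
  · left
    subst hy
    exact ⟨x, by simpa using hxy, rfl⟩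
  · right
    have hyQ : (y:ℚ) ≠ 0 := by exact_mod_cast hy
    rw [eval_homogenize hF.le _ (by simpa using hyQ)] at hxy
    simp only [Matrix.cons_val_zero, Matrix.cons_val_one] at hxy
    set β : ℚ := x / y with hβ
    rw [Set.mem_iUnion₂]
    refine ⟨β, ?_, y, hxy, ?_⟩
    · rw [hT, Set.mem_iUnion₂]
      obtain ⟨θ, hθ, h1⟩ := hlow β
      refine ⟨θ, hθ, ?_⟩
      simp only [Set.mem_setOf_eq]
      rw [norm_sub_rev]
      have h2 : ‖Fc.eval (β:ℂ)‖ * |(y:ℝ)| ^ d = |(m:ℝ)| := by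
        have h3 : Fc.eval (β:ℂ) = ((F.eval β : ℚ) : ℂ) := by
          rw [hFc, eval_map]; exact eval₂_at_apply (algebraMap ℚ ℂ) β
        rw [h3, ← hxy]
        push_cast
        simp [abs_mul]
      have hden : (β.den : ℝ) ≤ |(y:ℝ)| := by
        have : (β.den : ℤ) ∣ y := by rw [hβ, ← Rat.divInt_eq_div]; exact Rat.den_dvd x y
        have := Int.le_of_dvd (abs_pos.mpr hy) ((dvd_abs _ _).mpr this)
        exact_mod_cast this
      have hden0 : (0:ℝ) < β.den := by exact_mod_cast β.den_pos
      rw [div_div, le_div_iff₀ (by positivity)]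
      calc ‖(β:ℂ) - θ‖ * (c * (β.den:ℝ) ^ d) = (c * ‖(β:ℂ) - θ‖) * (β.den:ℝ) ^ d := by ring
        _ ≤ ‖Fc.eval (β:ℂ)‖ * |(y:ℝ)| ^ d := by gcongr
        _ = _ := h2
    · simp [hβ, hyQ]

end PartA5

section PartW1
set_option linter.all false
open MeasureTheory Filter Topology

/-- The Fejer kernel (with the junk value `0` at `0`). -/
noncomputable def fejerK (L v : ℝ) : ℝ := 2 * (1 - Real.cos (L * v)) / (L * v ^ 2)

theorem fejerK_nonneg {L : ℝ} (hL : 0 < L) (v : ℝ) : 0 ≤ fejerK L v := by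
  unfold fejerK
  have := Real.cos_le_one (L * v)
  apply div_nonneg
  · linarith
  · positivity

theorem fejerK_le {L : ℝ} (hL : 0 < L) (v : ℝ) : fejerK L v ≤ (4 / L) * (v ^ 2)⁻¹ := by
  unfold fejerK
  have := Real.neg_one_le_cos (L * v)
  rw [div_eq_mul_inv, mul_inv, div_eq_mul_inv, ← mul_assoc]
  gcongr
  linarith

theorem fejerK_le' {L : ℝ} (hL : 0 < L) (v : ℝ) : fejerK L v ≤ L := by
  unfold fejerK
  have := Real.one_sub_sq_div_two_le_cos (x := L * v)
  rcases eq_or_ne v 0 with rfl | hv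
  · simp; exact hL.le
  rw [div_le_iff₀ (by positivity)]
  nlinarith

theorem fejerK_measurable (L : ℝ) : Measurable (fejerK L) := by
  unfold fejerK
  fun_prop

theorem fejerK_bound {L : ℝ} (hL : 0 < L) (v : ℝ) : fejerK L v ≤ (L + 4 / L) * (1 + v ^ 2)⁻¹ := by
  rw [← div_eq_mul_inv, le_div_iff₀ (by positivity)]
  have h1 := fejerK_le' hL v
  have h2 : fejerK L v * v ^ 2 ≤ 4 / L := by
    rcases eq_or_ne v 0 with rfl | hv
    · simp; positivity
    · have := fejerK_le hL v
      rwa [← div_eq_mul_inv, le_div_iff₀ (by positivity)] at this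
  linarith

theorem fejerK_integrable {L : ℝ} (hL : 0 < L) : Integrable (fejerK L) := by
  refine Integrable.mono' (integrable_inv_one_add_sq.const_mul (L + 4 / L)) (fejerK_measurable L).aestronglyMeasurable ?_
  filter_upwards with v
  rw [Real.norm_of_nonneg (fejerK_nonneg hL v)]
  exact fejerK_bound hL v

theorem fejerK_lower {L : ℝ} (hL : 0 < L) {v : ℝ} (hv : v ≠ 0) (hLv : |L * v| ≤ 1) : L * (4 / Real.pi ^ 2) ≤ fejerK L v := by
  unfold fejerK
  have := Real.cos_le_one_sub_mul_cos_sq (x := L * v) (hLv.trans (by linarith [Real.pi_gt_three]))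
  rw [le_div_iff₀ (by positivity)]
  have h2 : L * (4 / Real.pi ^ 2) * (L * v ^ 2) = 2 * (2 / Real.pi ^ 2 * (L * v) ^ 2) := by ring
  rw [h2]
  linarith

theorem fejerK_fourier {L : ℝ} (hL : 0 < L) {v : ℝ} (hv : v ≠ 0) :
    ∫ t in (-L)..L, ((1 - |t| / L : ℝ) : ℂ) * Complex.exp (Complex.I * t * v) = fejerK L v := by
  have hLc : (L : ℂ) ≠ 0 := by exact_mod_cast hL.ne'
  have hvc : (v : ℂ) ≠ 0 := by exact_mod_cast hv
  have hI := Complex.I_ne_zero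
  have hcont : Continuous fun t : ℝ => ((1 - |t| / L : ℝ) : ℂ) * Complex.exp (Complex.I * t * v) := by fun_prop
  rw [← intervalIntegral.integral_add_adjacent_intervals (b := 0) (hcont.intervalIntegrable _ _) (hcont.intervalIntegrable _ _)]
  have key : ∀ σ : ℂ, ∀ t : ℝ, HasDerivAt (fun t : ℝ => (1 - σ * t / L) * (Complex.exp (Complex.I * t * v) / (Complex.I * v))
      + σ * Complex.exp (Complex.I * t * v) / (L * (Complex.I * v) ^ 2)) ((1 - σ * t / L) * Complex.exp (Complex.I * t * v)) t := by
    intro σ t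
    have h1 : HasDerivAt (fun t : ℝ => Complex.exp (Complex.I * t * v)) (Complex.exp (Complex.I * t * v) * (Complex.I * 1 * v)) t := by
      apply HasDerivAt.cexp
      exact (Complex.ofRealCLM.hasDerivAt.const_mul Complex.I).mul_const _
    have h2 : HasDerivAt (fun t : ℝ => (1 - σ * t / L : ℂ)) (-(σ * 1 / L)) t := by
      exact ((Complex.ofRealCLM.hasDerivAt.const_mul σ).div_const _).const_sub 1
    refine HasDerivAt.congr_deriv ((h2.mul (h1.div_const (Complex.I * v))).add ((h1.const_mul σ).div_const (L * (Complex.I * v) ^ 2))) ?_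
    field_simp
    ring
  have i1 : ∫ t in (-L)..0, ((1 - |t| / L : ℝ) : ℂ) * Complex.exp (Complex.I * t * v) =
      ∫ t in (-L)..0, (1 - (-1) * (t:ℂ) / L) * Complex.exp (Complex.I * t * v) := by
    apply intervalIntegral.integral_congr
    intro t ht
    rw [Set.uIcc_of_le (by linarith)] at ht
    simp only [abs_of_nonpos ht.2]
    push_cast
    ring
  have i2 : ∫ t in (0:ℝ)..L, ((1 - |t| / L : ℝ) : ℂ) * Complex.exp (Complex.I * t * v) =
      ∫ t in (0:ℝ)..L, (1 - 1 * (t:ℂ) / L) * Complex.exp (Complex.I * t * v) := by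
    apply intervalIntegral.integral_congr
    intro t ht
    rw [Set.uIcc_of_le (by linarith)] at ht
    simp only [abs_of_nonneg ht.1]
    push_cast
    ring
  rw [i1, i2, intervalIntegral.integral_eq_sub_of_hasDerivAt (fun t _ => key (-1) t) (by apply Continuous.intervalIntegrable; fun_prop),
    intervalIntegral.integral_eq_sub_of_hasDerivAt (fun t _ => key 1 t) (by apply Continuous.intervalIntegrable; fun_prop)]
  unfold fejerK
  push_cast
  have hcos : Complex.cos (L * v) = (Complex.exp (Complex.I * L * v) + Complex.exp (Complex.I * (-L) * v)) / 2 := by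
    rw [Complex.cos]; ring_nf
  rw [hcos]
  simp only [mul_zero, zero_mul, Complex.exp_zero]
  field_simp
  rw [Complex.I_sq]
  ring

/-- The key Fourier analytic step of the Wiener-Ikehara theorem. -/
theorem wi_core (D : ℝ → ℝ) (hDm : Measurable D) (M : ℝ) (hM : ∀ u, |D u| ≤ M) (Φ : ℂ → ℂ)
    (hΦ : ∀ z : ℂ, 0 < z.re → ∫ u in Set.Ioi (0:ℝ), (D u : ℂ) * Complex.exp (-z * u) = Φ z)
    (hlim : ∀ t : ℝ, ∃ l, Tendsto Φ (𝓝[{z | 0 < z.re}] (Complex.I * t)) (𝓝 l)) (L : ℝ) (hL : 0 < L) :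
    Tendsto (fun y => ∫ u in Set.Ioi (0:ℝ), D u * fejerK L (y - u)) atTop (𝓝 0) := by
  have hM0 : 0 ≤ M := (abs_nonneg _).trans (hM 0)
  set A : Set ℂ := {z | 0 < z.re} with hA
  have hclos : closure A = {z | 0 ≤ z.re} := by
    rw [hA]; exact Complex.closure_setOf_lt_re 0
  have hAo : IsOpen A := isOpen_lt continuous_const Complex.continuous_re
  -- Φ is continuous on A
  have hΦc : ContinuousOn Φ A := by
    have : ContinuousOn (fun z : ℂ => ∫ u in Set.Ioi (0:ℝ), (D u : ℂ) * Complex.exp (-z * u)) A := by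
      intro z₀ hz₀
      apply ContinuousAt.continuousWithinAt
      have hz₀' : 0 < z₀.re := hz₀
      refine continuousAt_of_dominated (bound := fun u => M * Real.exp (-(z₀.re / 2) * u)) ?_ ?_ ?_ ?_
      · filter_upwards with z
        refine Measurable.aestronglyMeasurable ?_
        fun_prop
      · have : ∀ᶠ z : ℂ in 𝓝 z₀, z₀.re / 2 < z.re :=
          Complex.continuous_re.continuousAt.eventually (lt_mem_nhds (by linarith))
        filter_upwards [this] with z hz
        filter_upwards [ae_restrict_mem measurableSet_Ioi] with u hu
        have hu' : (0:ℝ) < u := hu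
        rw [norm_mul, Complex.norm_real, Complex.norm_exp]
        have : (-z * (u:ℂ)).re = -z.re * u := by simp
        rw [this]
        have h1 := hM u
        rw [Real.norm_eq_abs]
        gcongr
      · exact (integrableOn_exp_mul_Ioi (by linarith) 0).const_mul M
      · filter_upwards with u
        fun_prop
    exact this.congr (fun z hz => (hΦ z hz).symm)
  have hΨc : ContinuousOn (extendFrom A Φ) (closure A) := by
    apply continuousOn_extendFrom le_rfl
    intro z hz
    rw [hclos] at hz
    rcases (show (0:ℝ) ≤ z.re from hz).eq_or_lt with h | h
    · obtain ⟨l, hl⟩ := hlim z.im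
      have : z = Complex.I * z.im := by
        apply Complex.ext <;> simp [← h]
      rw [← this] at hl
      exact ⟨l, hl⟩
    · exact ⟨Φ z, hΦc.continuousWithinAt h⟩
  set Ψ := extendFrom A Φ with hΨ
  have hΨeq : ∀ z ∈ A, Ψ z = Φ z := fun z hz =>
    extendFrom_eq (subset_closure hz) (hΦc.continuousWithinAt hz)
  have hpath : ∀ ε : ℝ, 0 ≤ ε → ∀ t : ℝ, (ε + Complex.I * t : ℂ) ∈ closure A := by
    intro ε hε t
    rw [hclos]; simp [hε]
  -- identity for ε > 0
  have hid : ∀ y ε : ℝ, 0 < ε → ∫ u in Set.Ioi (0:ℝ), ((D u * Real.exp (-ε * u) * fejerK L (y - u) : ℝ) : ℂ) =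
      ∫ t in (-L)..L, ((1 - |t| / L : ℝ) : ℂ) * Complex.exp (Complex.I * t * y) * Ψ (ε + Complex.I * t) := by
    intro y ε hε
    have h1 : ∀ t : ℝ, Ψ (ε + Complex.I * t) = ∫ u in Set.Ioi (0:ℝ), (D u : ℂ) * Complex.exp (-(ε + Complex.I * t) * u) := by
      intro t
      rw [hΨeq _ (by simp [hA, hε]), hΦ _ (by simp [hε])]
    simp_rw [h1, ← integral_const_mul]
    rw [intervalIntegral.integral_of_le (by linarith)]
    rw [integral_integral_swap]
    · apply setIntegral_congr_ae measurableSet_Ioi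
      have : ∀ᵐ u : ℝ, u ≠ y := by
        simp [ae_iff]
      filter_upwards [this] with u hu _
      push_cast
      rw [← fejerK_fourier hL (sub_ne_zero.mpr hu.symm), ← intervalIntegral.integral_of_le (by linarith),
        ← intervalIntegral.integral_const_mul]
      apply intervalIntegral.integral_congr
      intro t _
      simp only
      have : Complex.exp (Complex.I * t * y) * Complex.exp (-(ε + Complex.I * t) * u) =
        Complex.exp (-ε * u) * Complex.exp (Complex.I * t * ((y - u : ℝ) : ℂ)) := by
        rw [← Complex.exp_add, ← Complex.exp_add]; push_cast; ring_nf
      push_cast at this ⊢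
      linear_combination (-(1 - ((|t| : ℝ):ℂ) / L) * D u) * this
    · have hb : Integrable (fun p : ℝ × ℝ => (1:ℝ) * (M * Real.exp (-ε * p.2))) ((volume.restrict (Set.Ioc (-L) L)).prod (volume.restrict (Set.Ioi 0))) := by
        apply Integrable.mul_prod (f := fun _ : ℝ => (1:ℝ)) (g := fun u => M * Real.exp (-ε * u))
        · exact integrable_const _
        · exact (integrableOn_exp_mul_Ioi (by linarith) 0).const_mul M
      refine Integrable.mono' hb ?_ ?_
      · refine Measurable.aestronglyMeasurable ?_
        unfold Function.uncurry
        fun_prop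
      · rw [Measure.prod_restrict]
        filter_upwards [ae_restrict_mem (measurableSet_Ioc.prod measurableSet_Ioi)] with p hp
        obtain ⟨hp1, hp2⟩ := hp
        have hu : (0:ℝ) < p.2 := hp2
        simp only [Function.uncurry]
        rw [norm_mul, norm_mul, norm_mul, Complex.norm_real, Complex.norm_real, Complex.norm_exp, Complex.norm_exp]
        have e1 : (Complex.I * (p.1:ℂ) * y).re = 0 := by simp
        have e2 : (-(ε + Complex.I * (p.1:ℂ)) * (p.2:ℂ)).re = -ε * p.2 := by simp
        rw [e1, e2, Real.exp_zero, mul_one]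
        have : ‖1 - |p.1| / L‖ ≤ 1 := by
          have : |p.1| ≤ L := abs_le.mpr ⟨hp1.1.le, hp1.2⟩
          have h3 : |p.1| / L ≤ 1 := by rw [div_le_one hL]; exact this
          have h4 : 0 ≤ |p.1| / L := by positivity
          rw [Real.norm_eq_abs, abs_le]; constructor <;> linarith
        rw [Real.norm_eq_abs (D p.2)]
        have := hM p.2
        gcongr
  -- limit ε → 0
  have hid0 : ∀ y : ℝ, ∫ u in Set.Ioi (0:ℝ), ((D u * fejerK L (y - u) : ℝ) : ℂ) =
      ∫ t in (-L)..L, ((1 - |t| / L : ℝ) : ℂ) * Complex.exp (Complex.I * t * y) * Ψ (Complex.I * t) := by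
    intro y
    have hFi : Integrable (fun u => M * fejerK L (y - u)) :=
      ((fejerK_integrable hL).comp_sub_left y).const_mul M
    have hl : Tendsto (fun ε : ℝ => ∫ u in Set.Ioi (0:ℝ), ((D u * Real.exp (-ε * u) * fejerK L (y - u) : ℝ) : ℂ)) (𝓝[>] 0)
        (𝓝 (∫ u in Set.Ioi (0:ℝ), ((D u * fejerK L (y - u) : ℝ) : ℂ))) := by
      refine tendsto_integral_filter_of_dominated_convergence (fun u => M * fejerK L (y - u)) ?_ ?_ hFi.integrableOn ?_
      · filter_upwards with ε
        refine Measurable.aestronglyMeasurable ?_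
        have := fejerK_measurable L
        fun_prop
      · filter_upwards [self_mem_nhdsWithin] with ε hε
        filter_upwards [ae_restrict_mem measurableSet_Ioi] with u hu
        have hu' : (0:ℝ) < u := hu
        have hε' : (0:ℝ) < ε := hε
        rw [Complex.norm_real, norm_mul, norm_mul, Real.norm_of_nonneg (fejerK_nonneg hL _), Real.norm_of_nonneg (Real.exp_pos _).le,
          Real.norm_eq_abs]
        have h1 := fejerK_nonneg hL (y - u)
        have h2 : Real.exp (-ε * u) ≤ 1 := by rw [Real.exp_le_one_iff]; nlinarith
        have h3 := hM u
        calc |D u| * Real.exp (-ε * u) * fejerK L (y - u) ≤ M * 1 * fejerK L (y - u) := by gcongr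
          _ = _ := by ring
      · filter_upwards with u
        have : Continuous (fun ε : ℝ => ((D u * Real.exp (-ε * u) * fejerK L (y - u) : ℝ) : ℂ)) := by fun_prop
        have := (this.tendsto 0).mono_left (nhdsWithin_le_nhds (s := Set.Ioi 0))
        simpa using this
    -- bound of Ψ on compact
    have hcompact : IsCompact ((fun p : ℝ × ℝ => (p.1 + Complex.I * p.2 : ℂ)) '' (Set.Icc 0 1 ×ˢ Set.Icc (-L) L)) := by
      apply IsCompact.image (isCompact_Icc.prod isCompact_Icc)
      fun_prop
    obtain ⟨B, hB⟩ := hcompact.exists_bound_of_continuousOn (f := Ψ) (hΨc.mono (by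
      rintro _ ⟨p, hp, rfl⟩
      exact hpath p.1 hp.1.1 p.2))
    have hΨline : ∀ ε : ℝ, 0 ≤ ε → Continuous (fun t : ℝ => Ψ (ε + Complex.I * t)) := by
      intro ε hε
      have := hΨc.comp_continuous (f := fun t : ℝ => (ε + Complex.I * t : ℂ)) (by fun_prop) (hpath ε hε)
      exact this
    have hr : Tendsto (fun ε : ℝ => ∫ t in (-L)..L, ((1 - |t| / L : ℝ) : ℂ) * Complex.exp (Complex.I * t * y) * Ψ (ε + Complex.I * t)) (𝓝[>] 0)
        (𝓝 (∫ t in (-L)..L, ((1 - |t| / L : ℝ) : ℂ) * Complex.exp (Complex.I * t * y) * Ψ (Complex.I * t))) := by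
      refine intervalIntegral.tendsto_integral_filter_of_dominated_convergence (fun t => ‖((1 - |t| / L : ℝ) : ℂ)‖ * B) ?_ ?_ ?_ ?_
      · filter_upwards [self_mem_nhdsWithin] with ε hε
        have := hΨline ε (le_of_lt hε)
        apply Continuous.aestronglyMeasurable
        refine Continuous.mul ?_ this
        fun_prop
      · filter_upwards [Ioc_mem_nhdsGT (show (0:ℝ) < 1 by norm_num)] with ε hε
        filter_upwards with t ht
        rw [Set.uIoc_of_le (by linarith)] at ht
        have h1 := hB (ε + Complex.I * t) ⟨(ε, t), ⟨⟨hε.1.le, hε.2⟩, ⟨ht.1.le, ht.2⟩⟩, rfl⟩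
        rw [norm_mul, norm_mul, Complex.norm_exp]
        have e1 : (Complex.I * (t:ℂ) * y).re = 0 := by simp
        rw [e1, Real.exp_zero, mul_one]
        gcongr
      · apply Continuous.intervalIntegrable
        fun_prop
      · filter_upwards with t ht
        apply Tendsto.const_mul
        have h1 : ContinuousWithinAt Ψ (closure A) (Complex.I * t) := hΨc _ (by simpa using hpath 0 le_rfl t)
        refine h1.tendsto.comp ?_
        apply tendsto_nhdsWithin_of_tendsto_nhds_of_eventually_within
        · have : Continuous (fun ε : ℝ => (ε + Complex.I * t : ℂ)) := by fun_prop
          have := (this.tendsto 0).mono_left (nhdsWithin_le_nhds (s := Set.Ioi 0))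
          simpa using this
        · filter_upwards [self_mem_nhdsWithin] with ε hε
          exact hpath ε (le_of_lt hε) t
    refine tendsto_nhds_unique hl (hr.congr' ?_)
    filter_upwards [self_mem_nhdsWithin] with ε hε
    rw [hid y ε hε]
  -- Riemann-Lebesgue
  have hRL := Real.tendsto_integral_exp_smul_cocompact (fun t : ℝ => Set.indicator (Set.Ioc (-L) L)
    (fun t : ℝ => ((1 - |t| / L : ℝ) : ℂ) * Ψ (Complex.I * t)) t)
  have hw : Tendsto (fun y : ℝ => -(y / (2 * Real.pi))) atTop (cocompact ℝ) := by
    rw [cocompact_eq_atBot_atTop]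
    refine Tendsto.mono_right ?_ le_sup_left
    apply Filter.tendsto_neg_atTop_atBot.comp
    exact tendsto_id.atTop_div_const (by positivity)
  have hfin := hRL.comp hw
  have heq : ∀ y : ℝ, ((∫ u in Set.Ioi (0:ℝ), D u * fejerK L (y - u) : ℝ) : ℂ) =
    ∫ v : ℝ, Real.fourierChar (-(v * (-(y / (2 * Real.pi))))) • Set.indicator (Set.Ioc (-L) L)
    (fun t : ℝ => ((1 - |t| / L : ℝ) : ℂ) * Ψ (Complex.I * t)) v := by
    intro y
    rw [← integral_complex_ofReal, hid0 y, intervalIntegral.integral_of_le (by linarith), ← integral_indicator measurableSet_Ioc]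
    congr 1
    ext t
    by_cases ht : t ∈ Set.Ioc (-L) L
    · rw [Set.indicator_of_mem ht, Set.indicator_of_mem ht, Circle.smul_def, Real.fourierChar_apply, smul_eq_mul]
      have : ((2 * Real.pi * -(t * -(y / (2 * Real.pi))) : ℝ) : ℂ) * Complex.I = Complex.I * t * y := by
        have hpi : (Real.pi : ℂ) ≠ 0 := by exact_mod_cast Real.pi_ne_zero
        push_cast
        field_simp
      rw [this]
      ring
    · rw [Set.indicator_of_notMem ht, Set.indicator_of_notMem ht, smul_zero]
  have h0 : Tendsto (fun y : ℝ => ((∫ u in Set.Ioi (0:ℝ), D u * fejerK L (y - u) : ℝ) : ℂ)) atTop (𝓝 0) := by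
    refine hfin.congr ?_
    intro y
    rw [heq y]
    rfl
  have := (Complex.continuous_re.tendsto 0).comp h0
  simpa [Function.comp_def] using this

end PartW1

section PartW2
set_option linter.all false
open MeasureTheory Filter Topology

theorem wi_mass (D : ℝ → ℝ) (hDm : Measurable D) (M : ℝ) (hM : ∀ u, |D u| ≤ M) (L δ η y : ℝ) (hL : 0 < L)
    (hδ : 0 < δ) (hη : 0 < η) (hLδ : 1 / L ≤ δ) (hy : δ < y) (hD : ∀ u, |y - u| ≤ δ → η ≤ D u) :
    η * (8 / Real.pi ^ 2) - M * (4 / L) * (1 + 1 / δ ^ 2) * Real.pi ≤ ∫ u in Set.Ioi (0:ℝ), D u * fejerK L (y - u) := by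
  have hM0 : 0 ≤ M := (abs_nonneg _).trans (hM 0)
  have hFi : Integrable (fun u => fejerK L (y - u)) := (fejerK_integrable hL).comp_sub_left y
  have hIntg : Integrable (fun u => D u * fejerK L (y - u)) := by
    refine hFi.bdd_mul (c := M) hDm.aestronglyMeasurable ?_
    filter_upwards with u
    exact hM u
  rw [← integral_indicator measurableSet_Ioi]
  set g : ℝ → ℝ := fun u => (Set.Icc (y - 1 / L) (y + 1 / L)).indicator (fun _ => η * (L * (4 / Real.pi ^ 2))) u
    - M * (4 / L) * (1 + 1 / δ ^ 2) * (1 + (y - u) ^ 2)⁻¹ with hg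
  have hgi1 : Integrable (fun u => (Set.Icc (y - 1 / L) (y + 1 / L)).indicator (fun _ => η * (L * (4 / Real.pi ^ 2))) u) := by
    rw [integrable_indicator_iff measurableSet_Icc]
    exact integrableOn_const (by simp)
  have hgi2 : Integrable (fun u => M * (4 / L) * (1 + 1 / δ ^ 2) * (1 + (y - u) ^ 2)⁻¹) :=
    (integrable_inv_one_add_sq.comp_sub_left y).const_mul _
  have hgint : ∫ u, g u = η * (8 / Real.pi ^ 2) - M * (4 / L) * (1 + 1 / δ ^ 2) * Real.pi := by
    have e2 : ∫ u, M * (4 / L) * (1 + 1 / δ ^ 2) * (1 + (y - u) ^ 2)⁻¹ = M * (4 / L) * (1 + 1 / δ ^ 2) * Real.pi := by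
      rw [integral_const_mul, integral_sub_left_eq_self (fun v : ℝ => (1 + v ^ 2)⁻¹) volume y, integral_univ_inv_one_add_sq]
    have e1 : ∫ u, (Set.Icc (y - 1 / L) (y + 1 / L)).indicator (fun _ => η * (L * (4 / Real.pi ^ 2))) u = η * (8 / Real.pi ^ 2) := by
      rw [integral_indicator measurableSet_Icc, setIntegral_const, Real.volume_real_Icc, max_eq_left (by
        have : 0 < 1 / L := by positivity
        linarith)]
      simp only [smul_eq_mul]
      field_simp
      ring
    rw [hg, integral_sub hgi1 hgi2, e1, e2]
  rw [← hgint]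
  apply integral_mono_ae (hgi1.sub hgi2) (hIntg.indicator measurableSet_Ioi)
  have hne : ∀ᵐ u : ℝ, u ≠ y := by simp [ae_iff]
  filter_upwards [hne] with u hu
  have hv : y - u ≠ 0 := sub_ne_zero.mpr hu.symm
  have hF0 := fejerK_nonneg hL (y - u)
  have ht0 : 0 ≤ M * (4 / L) * (1 + 1 / δ ^ 2) * (1 + (y - u) ^ 2)⁻¹ := by positivity
  show g u ≤ _
  simp only [hg]
  by_cases h : |y - u| ≤ δ
  · have hu0 : u ∈ Set.Ioi (0:ℝ) := by
      have := (abs_le.mp h).2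
      simp only [Set.mem_Ioi]; linarith
    rw [Set.indicator_of_mem hu0]
    have hDu := hD u h
    by_cases h2 : u ∈ Set.Icc (y - 1 / L) (y + 1 / L)
    · rw [Set.indicator_of_mem h2]
      have h3 : |L * (y - u)| ≤ 1 := by
        rw [abs_mul, abs_of_pos hL]
        have : |y - u| ≤ 1 / L := by rw [abs_le]; constructor <;> linarith [h2.1, h2.2]
        calc L * |y - u| ≤ L * (1 / L) := by gcongr
          _ = 1 := by field_simp
      have h4 := fejerK_lower hL hv h3
      have : η * (L * (4 / Real.pi ^ 2)) ≤ D u * fejerK L (y - u) := by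
        have hDu0 : 0 ≤ D u := hη.le.trans hDu
        gcongr
      linarith
    · rw [Set.indicator_of_notMem h2]
      have : 0 ≤ D u * fejerK L (y - u) := mul_nonneg (hη.le.trans hDu) hF0
      linarith
  · push Not at h
    have h2 : u ∉ Set.Icc (y - 1 / L) (y + 1 / L) := by
      intro h2
      have : |y - u| ≤ 1 / L := by rw [abs_le]; constructor <;> linarith [h2.1, h2.2]
      linarith
    rw [Set.indicator_of_notMem h2]
    have h5 : M * fejerK L (y - u) ≤ M * (4 / L) * (1 + 1 / δ ^ 2) * (1 + (y - u) ^ 2)⁻¹ := by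
      have h6 : δ ^ 2 ≤ (y - u) ^ 2 := by rw [← sq_abs (y - u)]; gcongr
      have h7 : ((y - u) ^ 2)⁻¹ ≤ (1 + 1 / δ ^ 2) * (1 + (y - u) ^ 2)⁻¹ := by
        rw [← div_eq_mul_inv, le_div_iff₀ (by positivity), inv_mul_le_iff₀ (by positivity)]
        have : 1 ≤ (y - u) ^ 2 * (1 / δ ^ 2) := by
          rw [mul_one_div, le_div_iff₀ (by positivity)]; linarith
        linarith
      calc M * fejerK L (y - u) ≤ M * ((4 / L) * ((y - u) ^ 2)⁻¹) := by gcongr; exact fejerK_le hL _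
        _ ≤ M * ((4 / L) * ((1 + 1 / δ ^ 2) * (1 + (y - u) ^ 2)⁻¹)) := by gcongr
        _ = _ := by ring
    by_cases hu0 : u ∈ Set.Ioi (0:ℝ)
    · rw [Set.indicator_of_mem hu0]
      have h8 := (abs_le.mp (hM u)).1
      have : -(M * fejerK L (y - u)) ≤ D u * fejerK L (y - u) := by nlinarith
      linarith
    · rw [Set.indicator_of_notMem hu0]
      linarith

/-- If all Fejer means of `D` tend to zero, then `D` cannot be `≥ η` on intervals of fixed length far out. -/
theorem wi_noint (D : ℝ → ℝ) (hDm : Measurable D) (M : ℝ) (hM : ∀ u, |D u| ≤ M)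
    (hlim : ∀ L : ℝ, 0 < L → Tendsto (fun y => ∫ u in Set.Ioi (0:ℝ), D u * fejerK L (y - u)) atTop (𝓝 0))
    (δ η : ℝ) (hδ : 0 < δ) (hη : 0 < η) : ∀ᶠ y in atTop, ∃ u, |y - u| ≤ δ ∧ D u < η := by
  have hM0 : 0 ≤ M := (abs_nonneg _).trans (hM 0)
  have hpi := Real.pi_pos
  obtain ⟨L, hL, hL1, hL2⟩ : ∃ L : ℝ, 0 < L ∧ 1 / L ≤ δ ∧ M * (4 / L) * (1 + 1 / δ ^ 2) * Real.pi ≤ η * (4 / Real.pi ^ 2) := by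
    have t1 : Tendsto (fun L : ℝ => 1 / L) atTop (𝓝 0) := by simpa using tendsto_inv_atTop_zero (𝕜 := ℝ)
    have t2 : Tendsto (fun L : ℝ => M * (4 / L) * (1 + 1 / δ ^ 2) * Real.pi) atTop (𝓝 0) := by
      have := t1.const_mul (M * 4 * (1 + 1 / δ ^ 2) * Real.pi)
      rw [mul_zero] at this
      refine this.congr ?_
      intro L; ring
    have e1 := t1.eventually (ge_mem_nhds hδ)
    have e2 := t2.eventually (ge_mem_nhds (show 0 < η * (4 / Real.pi ^ 2) by positivity))
    obtain ⟨L, a, b, c⟩ := (e1.and (e2.and (eventually_gt_atTop (0:ℝ)))).exists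
    exact ⟨L, c, a, b⟩
  have h1 := (hlim L hL).eventually (gt_mem_nhds (show 0 < η * (4 / Real.pi ^ 2) by positivity))
  filter_upwards [h1, eventually_gt_atTop δ] with y hy hyδ
  by_contra hcon
  push Not at hcon
  have := wi_mass D hDm M hM L δ η y hL hδ hη hL1 hyδ hcon
  have e : η * (8 / Real.pi ^ 2) = η * (4 / Real.pi ^ 2) + η * (4 / Real.pi ^ 2) := by ring
  linarith

/-- Wiener-Ikehara theorem (with an a priori Chebyshev bound). -/
theorem wiener_ikehara (A : ℕ → ℝ) (hA : ∀ n, 0 ≤ A n) (κ C : ℝ)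
    (hC : ∀ n : ℕ, ∑ k ∈ Finset.Icc 1 n, A k ≤ C * n)
    (hlim : ∀ t : ℝ, ∃ l : ℂ, Tendsto (fun s : ℂ => LSeries (fun n => (A n : ℂ)) s - κ / (s - 1))
      (𝓝[{s | 1 < s.re}] (1 + Complex.I * t)) (𝓝 l)) :
    Tendsto (fun x : ℝ => (∑ k ∈ Finset.Icc 1 ⌊x⌋₊, A k) / x) atTop (𝓝 κ) := by
  set S : ℝ → ℝ := fun x => ∑ k ∈ Finset.Icc 1 ⌊x⌋₊, A k with hS
  have hSmono : Monotone S := by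
    intro x y hxy
    apply Finset.sum_le_sum_of_subset_of_nonneg
    · exact Finset.Icc_subset_Icc_right (Nat.floor_mono hxy)
    · intros; exact hA _
  have hS0 : ∀ x, 0 ≤ S x := fun x => Finset.sum_nonneg fun _ _ => hA _
  have hC0 : 0 ≤ C := by
    have := hC 1
    simp at this
    exact (hA 1).trans this
  have hSC : ∀ x, 0 < x → S x ≤ C * x := by
    intro x hx
    refine (hC _).trans ?_
    gcongr
    exact Nat.floor_le hx.le
  set D : ℝ → ℝ := fun u => Real.exp (-u) * S (Real.exp u) - κ with hD
  have hDm : Measurable D := by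
    have := hSmono.measurable
    fun_prop
  have hB : ∀ u, Real.exp (-u) * S (Real.exp u) ≤ C := by
    intro u
    have := hSC _ (Real.exp_pos u)
    rw [Real.exp_neg, inv_mul_le_iff₀ (Real.exp_pos u)]
    linarith
  have hB0 : ∀ u, 0 ≤ Real.exp (-u) * S (Real.exp u) := fun u => mul_nonneg (Real.exp_pos _).le (hS0 _)
  have hDM : ∀ u, |D u| ≤ C + |κ| := by
    intro u
    refine (abs_sub _ _).trans ?_
    rw [abs_of_nonneg (hB0 u)]
    linarith [hB u]
  have hO : (fun n : ℕ => ∑ k ∈ Finset.Icc 1 n, A k) =O[atTop] fun n : ℕ => (n : ℝ) ^ (1:ℝ) := by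
    apply Asymptotics.IsBigO.of_bound C
    filter_upwards with n
    rw [Real.norm_of_nonneg (Finset.sum_nonneg fun _ _ => hA _), Real.rpow_one, Real.norm_of_nonneg (by positivity)]
    exact hC n
  set Φ : ℂ → ℂ := fun z => (LSeries (fun n => (A n : ℂ)) (1 + z) - κ / z - κ) / (1 + z) with hΦ
  have hΦint : ∀ z : ℂ, 0 < z.re → ∫ u in Set.Ioi (0:ℝ), (D u : ℂ) * Complex.exp (-z * u) = Φ z := by
    intro z hz
    have hz0 : z ≠ 0 := by rintro rfl; simp at hz
    have hz1 : 1 + z ≠ 0 := by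
      intro h
      have := congrArg Complex.re h
      simp at this; linarith
    have hL := LSeries_eq_mul_integral_of_nonneg A (r := 1) (s := 1 + z) zero_le_one (by simp [hz]) hO hA
    have himg : Real.exp '' (Set.Ioi 0) = Set.Ioi 1 := by
      ext x
      simp only [Set.mem_image, Set.mem_Ioi]
      constructor
      · rintro ⟨u, hu, rfl⟩; exact Real.one_lt_exp_iff.mpr hu
      · intro hx; exact ⟨Real.log x, Real.log_pos hx, Real.exp_log (by linarith)⟩
    rw [← himg, integral_image_eq_integral_abs_deriv_smul measurableSet_Ioi
      (fun u _ => (Real.hasDerivAt_exp u).hasDerivWithinAt) (Real.exp_injective.injOn)] at hL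
    have hI1 : ∫ u in Set.Ioi (0:ℝ), |Real.exp u| • ((∑ k ∈ Finset.Icc 1 ⌊Real.exp u⌋₊, (A k : ℂ)) * (Real.exp u : ℂ) ^ (-(1 + z + 1)))
        = ∫ u in Set.Ioi (0:ℝ), ((Real.exp (-u) * S (Real.exp u) : ℝ) : ℂ) * Complex.exp (-z * u) := by
      apply setIntegral_congr_fun measurableSet_Ioi
      intro u _
      simp only [hS]
      rw [abs_of_pos (Real.exp_pos u), Complex.real_smul, Complex.cpow_def_of_ne_zero (by exact_mod_cast (Real.exp_pos u).ne'),
        ← Complex.ofReal_log (Real.exp_pos u).le, Real.log_exp]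
      push_cast
      have : Complex.exp u * Complex.exp (u * -(1 + z + 1)) = Complex.exp (-u) * Complex.exp (-z * u) := by
        rw [← Complex.exp_add, ← Complex.exp_add]; ring_nf
      linear_combination (∑ k ∈ Finset.Icc 1 ⌊Real.exp u⌋₊, (A k : ℂ)) * this
    rw [hI1] at hL
    have hexpi : IntegrableOn (fun u : ℝ => Complex.exp (-z * u)) (Set.Ioi 0) :=
      integrableOn_exp_mul_complex_Ioi (by simpa using hz) 0
    have i1 : IntegrableOn (fun u : ℝ => ((Real.exp (-u) * S (Real.exp u) : ℝ) : ℂ) * Complex.exp (-z * u)) (Set.Ioi 0) := by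
      refine Integrable.bdd_mul (c := C) hexpi ?_ ?_
      · refine Measurable.aestronglyMeasurable ?_
        have := hSmono.measurable
        fun_prop
      · filter_upwards with u
        rw [Complex.norm_real, Real.norm_of_nonneg (hB0 u)]
        exact hB u
    have i2 : ∫ u in Set.Ioi (0:ℝ), (D u : ℂ) * Complex.exp (-z * u) =
        (∫ u in Set.Ioi (0:ℝ), ((Real.exp (-u) * S (Real.exp u) : ℝ) : ℂ) * Complex.exp (-z * u)) -
        ∫ u in Set.Ioi (0:ℝ), (κ : ℂ) * Complex.exp (-z * u) := by
      rw [← integral_sub i1 (hexpi.const_mul _)]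
      congr 1
      ext u
      rw [hD]; push_cast; ring
    rw [i2, integral_const_mul, integral_exp_mul_complex_Ioi (by simpa using hz)]
    simp only [hΦ]
    rw [hL]
    simp
    field_simp
    ring
  have hΦlim : ∀ t : ℝ, ∃ l, Tendsto Φ (𝓝[{z | 0 < z.re}] (Complex.I * t)) (𝓝 l) := by
    intro t
    obtain ⟨l, hl⟩ := hlim t
    have hsh : Tendsto (fun z : ℂ => 1 + z) (𝓝[{z | 0 < z.re}] (Complex.I * t)) (𝓝[{s | 1 < s.re}] (1 + Complex.I * t)) := by
      apply tendsto_nhdsWithin_of_tendsto_nhds_of_eventually_within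
      · exact ((continuous_const.add continuous_id).tendsto _).mono_left nhdsWithin_le_nhds
      · filter_upwards [self_mem_nhdsWithin] with z hz
        have : 0 < z.re := hz
        simp [this]
    have hne : (1 + Complex.I * t : ℂ) ≠ 0 := by
      intro h
      have := congrArg Complex.re h
      simp at this
    refine ⟨(l - κ) / (1 + Complex.I * t), ?_⟩
    have h2 := ((hl.comp hsh).sub_const (κ : ℂ)).div (hsh.mono_right nhdsWithin_le_nhds) hne
    refine h2.congr ?_
    intro z
    simp [hΦ]
  have hfe := wi_core D hDm (C + |κ|) hDM Φ hΦint hΦlim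
  have hfe' : ∀ L : ℝ, 0 < L → Tendsto (fun y => ∫ u in Set.Ioi (0:ℝ), (-D u) * fejerK L (y - u)) atTop (𝓝 0) := by
    intro L hL
    have := (hfe L hL).neg
    rw [neg_zero] at this
    refine this.congr ?_
    intro y
    rw [← integral_neg]
    congr 1
    ext u; ring
  have hgrow : ∀ u v, u ≤ v → Real.exp (u - v) * (D u + κ) ≤ D v + κ := by
    intro u v huv
    simp only [hD, sub_add_cancel]
    rw [← mul_assoc, ← Real.exp_add]
    have : u - v + -u = -v := by ring
    rw [this]
    gcongr
    exact hSmono (Real.exp_le_exp.mpr huv)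
  have hDtend : Tendsto D atTop (𝓝 0) := by
    rw [Metric.tendsto_atTop']
    intro η hη
    -- choose δ
    obtain ⟨δ, hδ, hδ1⟩ : ∃ δ : ℝ, 0 < δ ∧ (1 - Real.exp (-(2 * δ))) * (C + |κ| + |κ|) < η / 2 := by
      have : Tendsto (fun δ : ℝ => (1 - Real.exp (-(2 * δ))) * (C + |κ| + |κ|)) (𝓝[>] 0) (𝓝 0) := by
        have h : Continuous (fun δ : ℝ => (1 - Real.exp (-(2 * δ))) * (C + |κ| + |κ|)) := by fun_prop
        have := (h.tendsto 0).mono_left (nhdsWithin_le_nhds (s := Set.Ioi 0))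
        simpa using this
      obtain ⟨δ, h1, h2⟩ := ((this.eventually (gt_mem_nhds (show 0 < η / 2 by positivity))).and self_mem_nhdsWithin).exists
      exact ⟨δ, h2, h1⟩
    have hstep : ∀ u v, u ≤ v → v ≤ u + 2 * δ → D u - η / 2 < D v := by
      intro u v h1 h2
      have h3 := hgrow u v h1
      have h4 : Real.exp (-(2 * δ)) ≤ Real.exp (u - v) := Real.exp_le_exp.mpr (by linarith)
      have h5 : Real.exp (u - v) ≤ 1 := by rw [Real.exp_le_one_iff]; linarith
      have h6 : D u + κ ≤ C + |κ| + |κ| := by linarith [(abs_le.mp (hDM u)).2, le_abs_self κ]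
      have h7 : 0 ≤ D u + κ := by simp only [hD, sub_add_cancel]; exact hB0 u
      have h8 : (1 - Real.exp (u - v)) * (D u + κ) ≤ (1 - Real.exp (-(2 * δ))) * (C + |κ| + |κ|) := by
        have : 0 ≤ 1 - Real.exp (u - v) := by linarith
        gcongr
        linarith
      linarith
    have e1 := wi_noint D hDm _ hDM hfe δ (η / 2) hδ (by positivity)
    have e2 := wi_noint (fun u => -D u) hDm.neg _ (fun u => by rw [abs_neg]; exact hDM u) hfe' δ (η / 2) hδ (by positivity)
    obtain ⟨Y1, hY1⟩ := eventually_atTop.mp e1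
    obtain ⟨Y2, hY2⟩ := eventually_atTop.mp e2
    refine ⟨max Y1 Y2 + δ, fun u hu => ?_⟩
    rw [Real.dist_0_eq_abs, abs_lt]
    constructor
    · obtain ⟨v, hv1, hv2⟩ := hY2 (u - δ) (by linarith [le_max_right Y1 Y2])
      have := abs_le.mp hv1
      have := hstep v u (by linarith) (by linarith)
      linarith
    · obtain ⟨v, hv1, hv2⟩ := hY1 (u + δ) (by linarith [le_max_left Y1 Y2])
      have := abs_le.mp hv1
      have := hstep u v (by linarith) (by linarith)
      linarith
  have h1 := (hDtend.comp Real.tendsto_log_atTop).add_const κ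
  rw [zero_add] at h1
  refine h1.congr' ?_
  filter_upwards [eventually_gt_atTop 0] with x hx
  simp only [hD, Function.comp, Real.exp_log hx, Real.exp_neg]
  rw [sub_add_cancel, div_eq_inv_mul]

end PartW2

section PartZ1
set_option linter.all false
open Filter Topology

/-- division with remainder, coordinatewise -/
def latDivMod (ι : Type*) (m : ℕ) [NeZero m] : (ι → ℤ) ≃ (ι → ℤ) × (ι → Fin m) :=
  (Equiv.piCongrRight fun _ : ι => Int.divModEquiv m).trans (Equiv.arrowProdEquivProdArrow ι (fun _ => ℤ) (fun _ => Fin m))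

theorem latDivMod_symm (ι : Type*) (m : ℕ) [NeZero m] (p : (ι → ℤ) × (ι → Fin m)) :
    (latDivMod ι m).symm p = m • p.1 + fun i => ((p.2 i : ℕ) : ℤ) := by
  ext i
  simp [latDivMod, Equiv.arrowProdEquivProdArrow, mul_comm]

theorem lat_G {ι : Type*} [Fintype ι] [DecidableEq ι] [Nonempty ι] (H : (ι → ℤ) → ℂ → ℂ) (ν : (ι → ℤ) → ℝ)
    (hν0 : ∀ a, 0 ≤ ν a) (hν1 : ∀ a ≠ 0, 1 ≤ ν a)
    (hνsum : ∀ r : ℝ, (Fintype.card ι : ℝ) < r → Summable fun a => ν a ^ (-r))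
    (hdiff : ∀ a, Differentiable ℂ (H a))
    (hhom : ∀ m : ℕ, 0 < m → ∀ a s, H (m • a) s = (m : ℂ) ^ (-(Fintype.card ι * s)) * H a s)
    (hb1 : ∀ a s, 0 ≤ s.re → ‖H a s‖ ≤ 1)
    (hsum : ∀ s, 1 < s.re → Summable fun a => H a s)
    (hd : ∀ (ε : ι → ℤ) (T : ℝ), ∃ C, 0 ≤ C ∧ ∀ a ≠ 0, ∀ s : ℂ, 0 ≤ s.re → ‖s‖ ≤ T →
      ‖H (a + ε) s - H a s‖ ≤ C * ν a ^ (-(Fintype.card ι * s.re) - 1))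
    (m : ℕ) (hm : 2 ≤ m) :
    ∃ G : ℂ → ℂ, DifferentiableOn ℂ G {s | 1 - 1 / (Fintype.card ι : ℝ) < s.re} ∧
      ∀ s : ℂ, 1 < s.re → (1 - (m : ℂ) ^ (Fintype.card ι - Fintype.card ι * s)) * ∑' a, H a s = G s := by
  set n := Fintype.card ι with hn
  have hn1 : 1 ≤ n := Fintype.card_pos
  have hnR : (0:ℝ) < n := by exact_mod_cast hn1
  haveI : NeZero m := ⟨by omega⟩
  have hinj : Function.Injective (fun a : ι → ℤ => m • a) := by
    intro a b h
    ext i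
    have := congrFun h i
    simp at this
    rcases this with h | h
    · exact h
    · omega
  let E : (ι → Fin m) → ι → ℤ := fun e i => ((e i : ℕ) : ℤ)
  refine ⟨fun s => ∑' a, ∑ e, (H (m • a + E e) s - H (m • a) s), ?_, ?_⟩
  · intro s0 hs0
    simp only [Set.mem_setOf_eq] at hs0
    obtain ⟨σ, hσ1, hσ2⟩ := exists_between hs0
    have hσ0 : 0 ≤ σ := by
      have : 1 / (n:ℝ) ≤ 1 := by rw [div_le_one hnR]; exact_mod_cast hn1
      linarith
    let V : Set ℂ := {s | σ < s.re} ∩ Metric.ball 0 (‖s0‖ + 1)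
    have hVo : IsOpen V := (isOpen_lt continuous_const Complex.continuous_re).inter Metric.isOpen_ball
    have hV0 : s0 ∈ V := ⟨hσ2, by simp⟩
    choose C hC0 hC using fun e => hd (E e) (‖s0‖ + 1)
    have hr : (n:ℝ) < n * σ + 1 := by
      have : (n:ℝ) * (1 - 1 / n) < n * σ := by gcongr
      rw [mul_sub, mul_one_div_cancel hnR.ne'] at this
      linarith
    have hu : Summable fun a : ι → ℤ => (if a = 0 then (2 * Fintype.card (ι → Fin m) : ℝ) else 0) + (∑ e, C e) * ν (m • a) ^ (-(n * σ + 1)) := by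
      apply Summable.add
      · apply summable_of_ne_finset_zero (s := {0})
        intro b hb
        simp at hb
        simp [hb]
      · exact ((hνsum _ hr).comp_injective hinj).mul_left _
    have := Complex.differentiableOn_tsum_of_summable_norm (F := fun a s => ∑ e, (H (m • a + E e) s - H (m • a) s)) hu
      (U := V) (fun a => ?_) hVo ?_
    · exact ((this s0 hV0).differentiableAt (hVo.mem_nhds hV0)).differentiableWithinAt
    · apply Differentiable.differentiableOn
      apply Differentiable.fun_sum
      intro e _
      exact (hdiff _).sub (hdiff _)
    · intro a s hs
      have hsre : σ < s.re := hs.1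
      have hsT : ‖s‖ ≤ ‖s0‖ + 1 := by have := hs.2; simp at this; exact this.le
      refine (norm_sum_le _ _).trans ?_
      by_cases ha : a = 0
      · subst ha
        have : ∑ e : ι → Fin m, ‖H (m • 0 + E e) s - H (m • 0) s‖ ≤ ∑ e : ι → Fin m, (2:ℝ) := by
          gcongr with e
          refine (norm_sub_le _ _).trans ?_
          linarith [hb1 (m • 0 + E e) s (by linarith), hb1 (m • 0) s (by linarith)]
        have h3 : 0 ≤ (∑ e, C e) * ν (m • 0) ^ (-(n * σ + 1)) := by
          apply mul_nonneg (Finset.sum_nonneg fun e _ => hC0 e)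
          exact Real.rpow_nonneg (hν0 _) _
        simp only [if_true]
        have h4 : ∑ e : ι → Fin m, (2:ℝ) = 2 * Fintype.card (ι → Fin m) := by
          rw [Finset.sum_const, Finset.card_univ, nsmul_eq_mul, mul_comm]
        rw [h4] at this
        exact this.trans (le_add_of_nonneg_right h3)
      · have hma : m • a ≠ 0 := by
          intro h; apply ha; apply hinj; simpa using h
        simp only [if_neg ha, zero_add]
        rw [Finset.sum_mul]
        gcongr with e
        refine (hC e (m • a) hma s (by linarith) hsT).trans ?_
        have := hν1 _ hma
        have := hC0 e
        gcongr
        nlinarith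
  · intro s hs
    have hs1 := hsum s hs
    have hs2 : Summable fun p : (ι → ℤ) × (ι → Fin m) => H (m • p.1 + E p.2) s := by
      have := (latDivMod ι m).symm.summable_iff.mpr hs1
      refine this.congr fun p => ?_
      simp [latDivMod_symm, E]
    have e1 : ∑' a, H a s = ∑' a, ∑ e, H (m • a + E e) s := by
      rw [← (latDivMod ι m).symm.tsum_eq]
      have : (fun p => H ((latDivMod ι m).symm p) s) = fun p : (ι → ℤ) × (ι → Fin m) => H (m • p.1 + E p.2) s := by
        ext p; rw [latDivMod_symm]
      rw [this, hs2.tsum_prod]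
      simp_rw [tsum_fintype]
    have hs3 : Summable fun a : ι → ℤ => ∑ e, H (m • a + E e) s := by
      have := hs2.prod
      simpa [tsum_fintype] using this
    have hs4 : Summable fun a : ι → ℤ => ∑ e : ι → Fin m, H (m • a) s := by
      simp only [Finset.sum_const, nsmul_eq_mul]
      exact (hs1.comp_injective hinj).mul_left _
    have e2 : ∑' a : ι → ℤ, ∑ e : ι → Fin m, H (m • a) s = (m : ℂ) ^ (n - n * s) * ∑' a, H a s := by
      rw [← tsum_mul_left]
      congr 1
      ext a
      have hm0 : (m : ℂ) ≠ 0 := by exact_mod_cast (by omega : m ≠ 0)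
      rw [Finset.sum_const, hhom m (by omega), Finset.card_univ, Fintype.card_fun, Fintype.card_fin, nsmul_eq_mul, ← hn,
        sub_eq_add_neg, Complex.cpow_add _ _ hm0, Complex.cpow_natCast]
      push_cast
      ring
    simp_rw [Finset.sum_sub_distrib]
    rw [hs3.tsum_sub hs4, ← e1, e2]
    ring

theorem lat_cont {ι : Type*} [Fintype ι] [DecidableEq ι] [Nonempty ι] (H : (ι → ℤ) → ℂ → ℂ) (ν : (ι → ℤ) → ℝ)
    (hν0 : ∀ a, 0 ≤ ν a) (hν1 : ∀ a ≠ 0, 1 ≤ ν a)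
    (hνsum : ∀ r : ℝ, (Fintype.card ι : ℝ) < r → Summable fun a => ν a ^ (-r))
    (hdiff : ∀ a, Differentiable ℂ (H a))
    (hhom : ∀ m : ℕ, 0 < m → ∀ a s, H (m • a) s = (m : ℂ) ^ (-(Fintype.card ι * s)) * H a s)
    (hb1 : ∀ a s, 0 ≤ s.re → ‖H a s‖ ≤ 1)
    (hsum : ∀ s, 1 < s.re → Summable fun a => H a s)
    (hd : ∀ (ε : ι → ℤ) (T : ℝ), ∃ C, 0 ≤ C ∧ ∀ a ≠ 0, ∀ s : ℂ, 0 ≤ s.re → ‖s‖ ≤ T →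
      ‖H (a + ε) s - H a s‖ ≤ C * ν a ^ (-(Fintype.card ι * s.re) - 1)) (s0 : ℂ) (hs0 : s0.re = 1) :
    ∃ g : ℂ → ℂ, AnalyticAt ℂ g s0 ∧ ∀ᶠ s in 𝓝[{s | 1 < s.re}] s0, (s - 1) * ∑' a, H a s = g s := by
  have key := lat_G H ν hν0 hν1 hνsum hdiff hhom hb1 hsum hd
  set n := Fintype.card ι with hn
  have hn1 : 1 ≤ n := Fintype.card_pos
  have hnR : (0:ℝ) < n := by exact_mod_cast hn1
  have hnC : (n:ℂ) ≠ 0 := by exact_mod_cast hnR.ne'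
  have hGan : ∀ G : ℂ → ℂ, DifferentiableOn ℂ G {s | 1 - 1 / (n : ℝ) < s.re} → AnalyticAt ℂ G s0 := by
    intro G hG
    apply hG.analyticAt
    apply (isOpen_lt continuous_const Complex.continuous_re).mem_nhds
    simp only [Set.mem_setOf_eq, hs0]
    have : 0 < 1 / (n:ℝ) := by positivity
    linarith
  have hEan : ∀ m : ℕ, 2 ≤ m → AnalyticAt ℂ (fun s : ℂ => 1 - (m : ℂ) ^ (n - n * s)) s0 := by
    intro m hm
    apply Differentiable.analyticAt
    have : (m:ℂ) ≠ 0 := by exact_mod_cast (by omega : m ≠ 0)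
    intro s
    refine DifferentiableAt.sub (by fun_prop) ?_
    exact DifferentiableAt.const_cpow (by fun_prop) (Or.inl this)
  by_cases h2 : ∃ m : ℕ, 2 ≤ m ∧ (1 - (m : ℂ) ^ (n - n * s0)) ≠ 0
  · obtain ⟨m, hm, hne⟩ := h2
    obtain ⟨G, hG1, hG2⟩ := key m hm
    refine ⟨fun s => (s - 1) * (G s / (1 - (m : ℂ) ^ (n - n * s))), ?_, ?_⟩
    · exact (analyticAt_id.sub analyticAt_const).mul ((hGan G hG1).div (hEan m hm) hne)
    · have e := (hEan m hm).continuousAt.eventually_ne hne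
      filter_upwards [self_mem_nhdsWithin, e.filter_mono nhdsWithin_le_nhds] with s hs hs'
      rw [← hG2 s hs, mul_div_cancel_left₀ _ hs']
  · push Not at h2
    have hs01 : s0 = 1 := by
      have a2 := h2 2 le_rfl
      have a3 := h2 3 (by norm_num)
      rw [sub_eq_zero, eq_comm, Complex.cpow_def_of_ne_zero (by norm_num), Complex.exp_eq_one_iff] at a2 a3
      obtain ⟨k2, hk2⟩ := a2
      obtain ⟨k3, hk3⟩ := a3
      have im : ∀ (m : ℕ) (k : ℤ), 2 ≤ m → Complex.log m * (n - n * s0) = k * (2 * Real.pi * Complex.I) →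
          Real.log m * (n * s0.im) = - k * (2 * Real.pi) := by
        intro m k hm h
        rw [← Complex.natCast_log] at h
        generalize Real.log m = l at h ⊢
        have := congrArg Complex.im h
        simp at this
        linarith
      have i2 := im 2 k2 le_rfl (by exact_mod_cast hk2)
      have i3 := im 3 k3 (by norm_num) (by exact_mod_cast hk3)
      have him : s0.im = 0 := by
        by_contra hne
        have hk20 : k2 ≠ 0 := by
          rintro rfl
          have : Real.log (2:ℕ) ≠ 0 := by
            have := Real.log_pos (x := (2:ℕ)) (by norm_num); exact this.ne'
          simp at i2
          simp_all
        have hpi := Real.pi_pos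
        -- k3 log 2 = k2 log 3
        have h1 : (k3:ℝ) * Real.log 2 = k2 * Real.log 3 := by
          push_cast at i2 i3
          have : (n * s0.im) ≠ 0 := mul_ne_zero hnR.ne' hne
          apply mul_right_cancel₀ this
          have e1 : (k3:ℝ) * Real.log 2 * (n * s0.im) = k3 * (Real.log 2 * (n * s0.im)) := by ring
          have e2 : (k2:ℝ) * Real.log 3 * (n * s0.im) = k2 * (Real.log 3 * (n * s0.im)) := by ring
          rw [e1, e2, i2, i3]; ring
        have h2' : (k3.natAbs:ℝ) * Real.log 2 = k2.natAbs * Real.log 3 := by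
          have := congrArg abs h1
          rw [abs_mul, abs_mul, abs_of_pos (Real.log_pos (by norm_num : (1:ℝ) < 2)), abs_of_pos (Real.log_pos (by norm_num : (1:ℝ) < 3))] at this
          simpa [Nat.cast_natAbs] using this
        have h3 : (2:ℝ) ^ k3.natAbs = 3 ^ k2.natAbs := by
          apply Real.log_injOn_pos (by simp) (by simp)
          rw [Real.log_pow, Real.log_pow, h2']
        have h4 : 2 ^ k3.natAbs = 3 ^ k2.natAbs := by exact_mod_cast h3
        have h5 : k2.natAbs ≠ 0 := by simpa using hk20
        have h6 : k3.natAbs ≠ 0 := by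
          intro h; rw [h] at h4
          have := Nat.one_lt_pow h5 (by norm_num : 1 < 3)
          omega
        have h7 : 2 ∣ 3 ^ k2.natAbs := h4 ▸ dvd_pow_self 2 h6
        have := Nat.prime_two.dvd_of_dvd_pow h7
        omega
      apply Complex.ext <;> simp [hs0, him]
    subst hs01
    obtain ⟨G, hG1, hG2⟩ := key 2 le_rfl
    set Φ : ℂ → ℂ := fun s => 1 - ((2:ℕ) : ℂ) ^ (n - n * s) with hΦ
    have hΦ1 : Φ 1 = 0 := h2 2 le_rfl
    have hder : HasDerivAt Φ (n * Complex.log 2) 1 := by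
      have h1 : HasDerivAt (fun s : ℂ => (n:ℂ) - n * s) (-n) 1 := by
        have := ((hasDerivAt_id (1:ℂ)).const_mul (n:ℂ)).const_sub (n:ℂ)
        simpa using this
      have h2 := (h1.const_cpow (c := ((2:ℕ):ℂ)) (Or.inl (by norm_num))).const_sub 1
      refine h2.congr_deriv ?_
      simp [mul_comm]
    have hds : AnalyticAt ℂ (dslope Φ 1) 1 := by
      obtain ⟨p, hp⟩ := hEan 2 le_rfl
      exact ⟨_, hp.has_fpower_series_dslope_fslope⟩
    have hds1 : dslope Φ 1 1 ≠ 0 := by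
      rw [dslope_same, hder.deriv]
      apply mul_ne_zero hnC
      have : Complex.log 2 = ((Real.log 2 : ℝ) : ℂ) := by
        rw [Complex.ofReal_log (by norm_num)]; norm_num
      rw [this]
      exact_mod_cast (Real.log_pos (by norm_num : (1:ℝ) < 2)).ne'
    refine ⟨fun s => G s / dslope Φ 1 s, (hGan G hG1).div hds hds1, ?_⟩
    have e := hds.continuousAt.eventually_ne hds1
    filter_upwards [self_mem_nhdsWithin, e.filter_mono nhdsWithin_le_nhds] with s hs hs'
    have hs1 : s ≠ 1 := by rintro rfl; simp at hs
    rw [eq_div_iff hs', ← hG2 s hs, dslope_of_ne _ hs1, slope_def_field, hΦ1]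
    have : s - 1 ≠ 0 := sub_ne_zero.mpr hs1
    field_simp
    simp only [hΦ]
    ring

end PartZ1

section PartZ2
set_option linter.all false
open Filter Topology NumberField NumberField.mixedEmbedding NumberField.Units NumberField.Units.dirichletUnitTheorem

noncomputable def tent (x : ℝ) : ℝ := max 0 (1 - |x|)

theorem tent_nonneg (x : ℝ) : 0 ≤ tent x := le_max_left _ _
theorem tent_le_one (x : ℝ) : tent x ≤ 1 := max_le zero_le_one (by linarith [abs_nonneg x])
theorem tent_lip (x y : ℝ) : |tent x - tent y| ≤ |x - y| := by
  unfold tent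
  refine (abs_max_sub_max_le_max _ _ _ _).trans ?_
  simp only [sub_self, abs_zero]
  rw [max_eq_right (abs_nonneg _)]
  have : 1 - |x| - (1 - |y|) = |y| - |x| := by ring
  rw [this, abs_sub_comm x y]
  exact abs_abs_sub_abs_le _ _
theorem tent_supp {x : ℝ} (h : tent x ≠ 0) : |x| < 1 := by
  by_contra hx
  push Not at hx
  apply h
  exact max_eq_left (by linarith)

theorem prod_lip {ι : Type*} (s : Finset ι) (f g : ι → ℝ) (hf0 : ∀ i, 0 ≤ f i) (hf1 : ∀ i, f i ≤ 1)
    (hg0 : ∀ i, 0 ≤ g i) (hg1 : ∀ i, g i ≤ 1) :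
    |∏ i ∈ s, f i - ∏ i ∈ s, g i| ≤ ∑ i ∈ s, |f i - g i| := by
  classical
  induction s using Finset.induction_on with
  | empty => simp
  | insert a s ha ih =>
    rw [Finset.prod_insert ha, Finset.prod_insert ha, Finset.sum_insert ha]
    have h1 : 0 ≤ ∏ i ∈ s, f i := Finset.prod_nonneg fun i _ => hf0 i
    have h2 : ∏ i ∈ s, f i ≤ 1 := Finset.prod_le_one (fun i _ => hf0 i) fun i _ => hf1 i
    have e : f a * ∏ i ∈ s, f i - g a * ∏ i ∈ s, g i = (f a - g a) * ∏ i ∈ s, f i + g a * (∏ i ∈ s, f i - ∏ i ∈ s, g i) := by ring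
    rw [e]
    refine (abs_add_le _ _).trans ?_
    rw [abs_mul, abs_mul, abs_of_nonneg h1, abs_of_nonneg (hg0 a)]
    have := abs_nonneg (f a - g a)
    have := abs_nonneg (∏ i ∈ s, f i - ∏ i ∈ s, g i)
    have := hg1 a
    have := hg0 a
    nlinarith

section
open scoped Classical
variable (K : Type*) [Field K] [NumberField K]

noncomputable def uBasis : Module.Basis (Fin (rank K)) ℝ (logSpace K) :=
  (basisUnitLattice K).ofZLatticeBasis ℝ (unitLattice K)

variable {K}

noncomputable def uW (x : mixedSpace K) : ℝ := ∏ i, tent ((uBasis K).repr (logMap x) i)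

theorem uW_nonneg (x : mixedSpace K) : 0 ≤ uW x := Finset.prod_nonneg fun i _ => tent_nonneg _
theorem uW_le_one (x : mixedSpace K) : uW x ≤ 1 :=
  Finset.prod_le_one (fun i _ => tent_nonneg _) fun i _ => tent_le_one _

variable (K) in
theorem uW_lip : ∃ C : ℝ, 0 ≤ C ∧ ∀ x y : mixedSpace K, |uW x - uW y| ≤ C * ‖logMap x - logMap y‖ := by
  let c : logSpace K →L[ℝ] (Fin (rank K) → ℝ) := LinearMap.toContinuousLinearMap ((uBasis K).equivFun.toLinearMap)
  refine ⟨rank K * ‖c‖, by positivity, fun x y => ?_⟩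
  refine (prod_lip _ _ _ (fun _ => tent_nonneg _) (fun _ => tent_le_one _) (fun _ => tent_nonneg _) (fun _ => tent_le_one _)).trans ?_
  calc _ ≤ ∑ i : Fin (rank K), ‖c‖ * ‖logMap x - logMap y‖ := by
        gcongr with i
        refine (tent_lip _ _).trans ?_
        have : (uBasis K).repr (logMap x) i - (uBasis K).repr (logMap y) i = c (logMap x - logMap y) i := by
          simp [c]
        rw [this, ← Real.norm_eq_abs]
        exact (norm_le_pi_norm _ i).trans (c.le_opNorm _)
    _ = _ := by simp; ring

variable (K) in
theorem uW_supp0 : ∃ B : ℝ, 0 ≤ B ∧ ∀ x : mixedSpace K, uW x ≠ 0 → ‖logMap x‖ ≤ B := by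
  refine ⟨∑ i, ‖uBasis K i‖, by positivity, fun x hx => ?_⟩
  rw [uW, Finset.prod_ne_zero_iff] at hx
  rw [← (uBasis K).sum_repr (logMap x)]
  refine (norm_sum_le _ _).trans ?_
  gcongr with i
  rw [_root_.norm_smul]
  have := tent_supp (hx i (Finset.mem_univ i))
  rw [← Real.norm_eq_abs] at this
  calc _ ≤ 1 * ‖uBasis K i‖ := by gcongr
    _ = _ := one_mul _

theorem normAtPlace_pos' {x : mixedSpace K} (hx : mixedEmbedding.norm x ≠ 0) (w : InfinitePlace K) :
    0 < normAtPlace w x :=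
  lt_of_le_of_ne (normAtPlace_nonneg w x) (Ne.symm (mixedEmbedding.norm_ne_zero_iff.mp hx w))

theorem log_norm_eq {x : mixedSpace K} (hx : mixedEmbedding.norm x ≠ 0) :
    Real.log (mixedEmbedding.norm x) = ∑ w : InfinitePlace K, w.mult * Real.log (normAtPlace w x) := by
  rw [mixedEmbedding.norm_apply, Real.log_prod]
  · simp [Real.log_pow]
  · intro w _
    exact pow_ne_zero _ (normAtPlace_pos' hx w).ne'

variable (K) in
theorem uW_supp : ∃ c : ℝ, 0 < c ∧ c ≤ 1 ∧ ∀ x : mixedSpace K, mixedEmbedding.norm x ≠ 0 → uW x ≠ 0 →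
    ∀ w, c * ‖x‖ ≤ normAtPlace w x := by
  skip
  obtain ⟨B, hB, hBx⟩ := uW_supp0 K
  set B' := B + Fintype.card {w : InfinitePlace K // w ≠ w₀} * B with hB'
  have hB'0 : 0 ≤ B' := by positivity
  refine ⟨Real.exp (-(2 * B')), Real.exp_pos _, by rw [Real.exp_le_one_iff]; linarith, fun x hN hx => ?_⟩
  have h1 := hBx x hx
  set A := Real.log (mixedEmbedding.norm x) * (Module.finrank ℚ K : ℝ)⁻¹ with hA
  have hcomp : ∀ w : {w : InfinitePlace K // w ≠ w₀}, |w.1.mult * (Real.log (normAtPlace w.1 x) - A)| ≤ B := by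
    intro w
    rw [hA, ← logMap_apply, ← Real.norm_eq_abs]
    exact (norm_le_pi_norm _ w).trans h1
  have hzero : ∑ w : InfinitePlace K, w.mult * (Real.log (normAtPlace w x) - A) = 0 := by
    simp_rw [mul_sub]
    rw [Finset.sum_sub_distrib, ← log_norm_eq hN, ← Finset.sum_mul, ← Nat.cast_sum, InfinitePlace.sum_mult_eq, hA]
    have : (Module.finrank ℚ K : ℝ) ≠ 0 := by exact_mod_cast Module.finrank_pos.ne'
    field_simp
    ring
  have hmult : ∀ (w : InfinitePlace K) (z : ℝ), |z| ≤ |w.mult * z| := by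
    intro w z
    rw [abs_mul, Nat.abs_cast]
    have := InfinitePlace.one_le_mult (w := w)
    nlinarith [abs_nonneg z]
  have hall : ∀ w : InfinitePlace K, |Real.log (normAtPlace w x) - A| ≤ B' := by
    intro w
    by_cases hw : w = w₀
    · subst hw
      refine (hmult w₀ _).trans ?_
      rw [← Finset.add_sum_erase _ _ (Finset.mem_univ (w₀ : InfinitePlace K))] at hzero
      rw [eq_neg_of_add_eq_zero_left hzero, abs_neg]
      refine (Finset.abs_sum_le_sum_abs _ _).trans ?_
      calc _ ≤ ∑ w ∈ Finset.univ.erase (w₀ : InfinitePlace K), B := by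
            apply Finset.sum_le_sum
            intro w hw
            exact hcomp ⟨w, (Finset.mem_erase.mp hw).1⟩
        _ ≤ B' := by
            rw [Finset.sum_const, nsmul_eq_mul, hB']
            have : (Finset.univ.erase (w₀ : InfinitePlace K)).card = Fintype.card {w : InfinitePlace K // w ≠ w₀} := by
              rw [Fintype.card_subtype]
              congr 1
              ext w; simp
            rw [this]
            linarith
    · refine (hmult _ _).trans ((hcomp ⟨w, hw⟩).trans ?_)
      rw [hB']
      have : 0 ≤ (Fintype.card {w : InfinitePlace K // w ≠ w₀} : ℝ) * B := by positivity
      linarith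
  intro w
  rw [norm_eq_sup'_normAtPlace]
  obtain ⟨w', -, hw'⟩ := Finset.exists_mem_eq_sup' (Finset.univ_nonempty (α := InfinitePlace K)) (fun w => normAtPlace w x)
  rw [hw']
  have e1 := Real.exp_log (normAtPlace_pos' hN w)
  have e2 := Real.exp_log (normAtPlace_pos' hN w')
  rw [← e1, ← e2, ← Real.exp_add]
  apply Real.exp_le_exp.mpr
  have a1 := abs_le.mp (hall w)
  have a2 := abs_le.mp (hall w')
  linarith [a1.1, a2.2]

theorem log_diff_le {a b δ E : ℝ} (hδ : 0 < δ) (ha : δ ≤ a) (hb : δ ≤ b) (hab : |a - b| ≤ E) :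
    |Real.log a - Real.log b| ≤ E / δ := by
  have key : ∀ a b : ℝ, δ ≤ a → δ ≤ b → |a - b| ≤ E → Real.log a - Real.log b ≤ E / δ := by
    intro a b ha hb hab
    have ha0 : 0 < a := by linarith
    have hb0 : 0 < b := by linarith
    have hE : 0 ≤ E := (abs_nonneg _).trans hab
    rw [← Real.log_div ha0.ne' hb0.ne']
    calc Real.log (a / b) ≤ a / b - 1 := Real.log_le_sub_one_of_pos (by positivity)
      _ = (a - b) / b := by field_simp
      _ ≤ E / b := by gcongr; exact (le_abs_self _).trans hab
      _ ≤ E / δ := by gcongr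
  rw [abs_le]
  constructor
  · have := key b a hb ha (by rw [abs_sub_comm]; exact hab)
    linarith
  · exact key a b ha hb hab

theorem normAtPlace_sub_le (w : InfinitePlace K) (x y : mixedSpace K) :
    |normAtPlace w x - normAtPlace w y| ≤ ‖x - y‖ := by
  have h1 : ∀ x y : mixedSpace K, normAtPlace w x - normAtPlace w y ≤ ‖x - y‖ := by
    intro x y
    have h2 := normAtPlace_add_le w (x - y) y
    rw [sub_add_cancel] at h2
    have h3 : normAtPlace w (x - y) ≤ ‖x - y‖ := by
      rw [norm_eq_sup'_normAtPlace]
      exact Finset.le_sup' (fun w => normAtPlace w (x - y)) (Finset.mem_univ w)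
    linarith
  rw [abs_le]
  constructor
  · have := h1 y x
    rw [norm_sub_rev] at this
    linarith
  · exact h1 x y

theorem pert_log {x y : mixedSpace K} {δ E : ℝ} (hδ : 0 < δ) (hx : ∀ w, δ ≤ normAtPlace w x) (hy : ∀ w, δ ≤ normAtPlace w y)
    (hE : ‖x - y‖ ≤ E) :
    |Real.log (mixedEmbedding.norm x) - Real.log (mixedEmbedding.norm y)| ≤ Module.finrank ℚ K * (E / δ) ∧
    ‖logMap x - logMap y‖ ≤ 4 * (E / δ) := by
  have hE0 : 0 ≤ E := (norm_nonneg _).trans hE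
  have hNx : mixedEmbedding.norm x ≠ 0 := mixedEmbedding.norm_ne_zero_iff.mpr fun w => (hδ.trans_le (hx w)).ne'
  have hNy : mixedEmbedding.norm y ≠ 0 := mixedEmbedding.norm_ne_zero_iff.mpr fun w => (hδ.trans_le (hy w)).ne'
  have hl : ∀ w : InfinitePlace K, |Real.log (normAtPlace w x) - Real.log (normAtPlace w y)| ≤ E / δ := fun w =>
    log_diff_le hδ (hx w) (hy w) ((normAtPlace_sub_le w x y).trans hE)
  have h1 : |Real.log (mixedEmbedding.norm x) - Real.log (mixedEmbedding.norm y)| ≤ Module.finrank ℚ K * (E / δ) := by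
    rw [log_norm_eq hNx, log_norm_eq hNy, ← Finset.sum_sub_distrib]
    refine (Finset.abs_sum_le_sum_abs _ _).trans ?_
    calc _ ≤ ∑ w : InfinitePlace K, (w.mult : ℝ) * (E / δ) := by
          gcongr with w
          rw [← mul_sub, abs_mul, Nat.abs_cast]
          gcongr
          exact hl w
      _ = _ := by rw [← Finset.sum_mul, ← Nat.cast_sum, InfinitePlace.sum_mult_eq]
  refine ⟨h1, ?_⟩
  have hn : (0:ℝ) < Module.finrank ℚ K := by exact_mod_cast Module.finrank_pos
  rw [pi_norm_le_iff_of_nonneg (by positivity)]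
  intro w
  rw [Pi.sub_apply, logMap_apply, logMap_apply, ← mul_sub, norm_mul, Real.norm_natCast, Real.norm_eq_abs]
  have hm : (w.1.mult : ℝ) ≤ 2 := by
    unfold InfinitePlace.mult; split_ifs <;> norm_num
  have h3 : |Real.log (normAtPlace w.1 x) - Real.log (mixedEmbedding.norm x) * (Module.finrank ℚ K : ℝ)⁻¹ -
      (Real.log (normAtPlace w.1 y) - Real.log (mixedEmbedding.norm y) * (Module.finrank ℚ K : ℝ)⁻¹)| ≤ 2 * (E / δ) := by
    have e : Real.log (normAtPlace w.1 x) - Real.log (mixedEmbedding.norm x) * (Module.finrank ℚ K : ℝ)⁻¹ -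
      (Real.log (normAtPlace w.1 y) - Real.log (mixedEmbedding.norm y) * (Module.finrank ℚ K : ℝ)⁻¹) =
      (Real.log (normAtPlace w.1 x) - Real.log (normAtPlace w.1 y)) - (Real.log (mixedEmbedding.norm x) - Real.log (mixedEmbedding.norm y)) * (Module.finrank ℚ K : ℝ)⁻¹ := by ring
    rw [e]
    refine (abs_sub _ _).trans ?_
    rw [abs_mul, abs_of_pos (inv_pos.mpr hn)]
    have : |Real.log (mixedEmbedding.norm x) - Real.log (mixedEmbedding.norm y)| * (Module.finrank ℚ K : ℝ)⁻¹ ≤ E / δ := by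
      rw [← div_eq_mul_inv, div_le_iff₀ hn]; linarith
    linarith [hl w.1]
  calc _ ≤ 2 * (2 * (E / δ)) := by gcongr
    _ = _ := by ring

theorem norm_ge_of_place {x : mixedSpace K} {δ : ℝ} (hδ : 0 < δ) (hx : ∀ w, δ ≤ normAtPlace w x) :
    Module.finrank ℚ K * Real.log δ ≤ Real.log (mixedEmbedding.norm x) := by
  have hNx : mixedEmbedding.norm x ≠ 0 := mixedEmbedding.norm_ne_zero_iff.mpr fun w => (hδ.trans_le (hx w)).ne'
  rw [log_norm_eq hNx, ← InfinitePlace.sum_mult_eq, Nat.cast_sum, Finset.sum_mul]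
  gcongr with w
  exact hx w

theorem exp_diff_le {s : ℂ} (hs : 0 ≤ s.re) {L L' m : ℝ} (hL : m ≤ L) (hL' : m ≤ L') :
    ‖Complex.exp (-(s * L)) - Complex.exp (-(s * L'))‖ ≤ 2 * ‖s‖ * |L - L'| * Real.exp (-(s.re * m)) := by
  have key : ∀ L L' : ℝ, m ≤ L → L ≤ L' → ‖Complex.exp (-(s * L)) - Complex.exp (-(s * L'))‖ ≤ 2 * ‖s‖ * |L - L'| * Real.exp (-(s.re * m)) := by
    intro L L' h1 h2
    have e : Complex.exp (-(s * L)) - Complex.exp (-(s * L')) = - (Complex.exp (-(s * L)) * (Complex.exp (-(s * (L' - L))) - 1)) := by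
      rw [mul_sub, ← Complex.exp_add, mul_one]; ring_nf
    rw [e, norm_neg, norm_mul, Complex.norm_exp]
    have h3 : ‖Complex.exp (-(s * (L' - L))) - 1‖ ≤ 2 * (‖s‖ * |L - L'|) := by
      have hz : ‖-(s * ((L':ℂ) - L))‖ = ‖s‖ * |L - L'| := by
        rw [norm_neg, norm_mul, ← Complex.ofReal_sub, Complex.norm_real, Real.norm_eq_abs, abs_sub_comm]
      by_cases h : ‖-(s * ((L':ℂ) - L))‖ ≤ 1
      · rw [← hz]; exact Complex.norm_exp_sub_one_le h
      · push Not at h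
        refine (norm_sub_le _ _).trans ?_
        rw [Complex.norm_exp, norm_one]
        have : (-(s * ((L':ℂ) - L))).re ≤ 0 := by
          rw [← Complex.ofReal_sub]
          simp
          nlinarith
        have := Real.exp_le_one_iff.mpr this
        linarith
    have h4 : (-(s * (L:ℂ))).re ≤ -(s.re * m) := by
      simp
      gcongr
    calc _ ≤ Real.exp (-(s.re * m)) * (2 * (‖s‖ * |L - L'|)) := by gcongr
      _ = _ := by ring
  rcases le_total L L' with h | h
  · exact key L L' hL h
  · rw [norm_sub_rev, abs_sub_comm]
    exact key L' L hL' h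

end

end PartZ2

section PartZ3
set_option linter.all false
open Filter Topology NumberField NumberField.mixedEmbedding NumberField.Units NumberField.Units.dirichletUnitTheorem

section Z3
open scoped Classical
variable {K : Type*} [Field K] [NumberField K]

noncomputable def uH (x : mixedSpace K) (s : ℂ) : ℂ :=
  if mixedEmbedding.norm x = 0 then 0 else (uW x : ℂ) * Complex.exp (-(s * (Real.log (mixedEmbedding.norm x) : ℂ)))

theorem uH_zero_of {x : mixedSpace K} (h : ¬ (mixedEmbedding.norm x ≠ 0 ∧ uW x ≠ 0)) (s : ℂ) : uH x s = 0 := by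
  unfold uH
  split_ifs with h1
  · rfl
  · have : uW x = 0 := by
      by_contra h2
      exact h ⟨h1, h2⟩
    simp [this]

theorem norm_exp_log (s : ℂ) (L : ℝ) : ‖Complex.exp (-(s * (L : ℂ)))‖ = Real.exp (-(s.re * L)) := by
  rw [Complex.norm_exp]; simp

theorem uH_le_one {x : mixedSpace K} (hx : mixedEmbedding.norm x = 0 ∨ 1 ≤ mixedEmbedding.norm x) {s : ℂ} (hs : 0 ≤ s.re) :
    ‖uH x s‖ ≤ 1 := by
  unfold uH
  split_ifs with h1
  · simp
  · have h2 : 1 ≤ mixedEmbedding.norm x := hx.resolve_left h1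
    rw [norm_mul, norm_exp_log, Complex.norm_real, Real.norm_eq_abs, abs_of_nonneg (uW_nonneg x)]
    have h3 := Real.log_nonneg h2
    have h4 : Real.exp (-(s.re * Real.log (mixedEmbedding.norm x))) ≤ 1 := by
      rw [Real.exp_le_one_iff]
      have := mul_nonneg hs h3
      linarith
    exact mul_le_one₀ (uW_le_one x) (Real.exp_nonneg _) h4

theorem uH_differentiable (x : mixedSpace K) : Differentiable ℂ (uH x) := by
  unfold uH
  split_ifs with h1
  · fun_prop
  · fun_prop

theorem exp_pow_aux {δ : ℝ} (hδ : 0 < δ) (n : ℕ) (σ : ℝ) :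
    Real.exp (-(σ * (n * Real.log δ))) = δ ^ (-(n * σ)) := by
  rw [Real.rpow_def_of_pos hδ]; congr 1; ring

variable (K) in
theorem uH_bound : ∃ c : ℝ, 0 < c ∧ c ≤ 1 ∧ ∀ x : mixedSpace K, 0 < ‖x‖ → ∀ s : ℂ, 0 ≤ s.re →
    ‖uH x s‖ ≤ (c * ‖x‖) ^ (-(Module.finrank ℚ K * s.re)) := by
  obtain ⟨c, hc0, hc1, hc⟩ := uW_supp K
  refine ⟨c, hc0, hc1, fun x hx s hs => ?_⟩
  by_cases h : mixedEmbedding.norm x ≠ 0 ∧ uW x ≠ 0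
  · have h1 := hc x h.1 h.2
    have hδ : 0 < c * ‖x‖ := by positivity
    have h2 := norm_ge_of_place hδ h1
    unfold uH
    rw [if_neg h.1, norm_mul, norm_exp_log, Complex.norm_real, Real.norm_eq_abs, abs_of_nonneg (uW_nonneg x),
      ← exp_pow_aux hδ]
    have h3 : Real.exp (-(s.re * Real.log (mixedEmbedding.norm x))) ≤ Real.exp (-(s.re * (Module.finrank ℚ K * Real.log (c * ‖x‖)))) := by
      apply Real.exp_le_exp.2
      have := mul_le_mul_of_nonneg_left h2 hs
      linarith
    calc _ ≤ 1 * Real.exp (-(s.re * Real.log (mixedEmbedding.norm x))) :=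
          mul_le_mul_of_nonneg_right (uW_le_one x) (Real.exp_nonneg _)
      _ ≤ _ := by rw [one_mul]; exact h3
  · rw [uH_zero_of h]; simp; positivity

set_option maxHeartbeats 1600000 in
variable (K) in
theorem uH_diff (E T : ℝ) (hE : 0 ≤ E) : ∃ C : ℝ, 0 ≤ C ∧ ∀ x y : mixedSpace K, ‖x - y‖ ≤ E → 1 ≤ ‖x‖ →
    (mixedEmbedding.norm x = 0 ∨ 1 ≤ mixedEmbedding.norm x) →
    (mixedEmbedding.norm y = 0 ∨ 1 ≤ mixedEmbedding.norm y) → ∀ s : ℂ, 0 ≤ s.re → ‖s‖ ≤ T →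
    ‖uH y s - uH x s‖ ≤ C * ‖x‖ ^ (-(Module.finrank ℚ K * s.re) - 1) := by
  obtain ⟨c, hc0, hc1, hc⟩ := uW_supp K
  obtain ⟨CW, hCW0, hCW⟩ := uW_lip K
  set n := Module.finrank ℚ K with hn
  set R : ℝ := max 1 (4 * E / c) with hR
  have hR1 : 1 ≤ R := le_max_left _ _
  set T' := max T 0 with hT'
  set C1 : ℝ := 2 * R ^ (n * T' + 1) with hC1
  set C2 : ℝ := (4 * CW + 2 * T' * n) * (2 * E / c) * (c / 2) ^ (-(n * T')) with hC2
  have hC1' : 0 ≤ C1 := by positivity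
  have hT0 : 0 ≤ T' := le_max_right _ _
  have hC2' : 0 ≤ C2 := by positivity
  refine ⟨C1 + C2, by positivity, fun x y hxy hx1 hx hy s hs hsT => ?_⟩
  have hx0 : 0 < ‖x‖ := by linarith
  have hσT : s.re ≤ T' := ((Complex.re_le_norm s).trans hsT).trans (le_max_left _ _)
  have hsT' : ‖s‖ ≤ T' := hsT.trans (le_max_left _ _)
  have hpos : 0 ≤ ‖x‖ ^ (-(n * s.re) - 1) := by positivity
  rcases lt_or_ge ‖x‖ R with hxR | hxR
  · have h1 : ‖uH y s - uH x s‖ ≤ 2 := by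
      refine (norm_sub_le _ _).trans ?_
      linarith [uH_le_one hx hs, uH_le_one hy hs]
    have h2 : ‖x‖ ^ (n * s.re + 1) ≤ R ^ (n * T' + 1) := by
      calc ‖x‖ ^ (n * s.re + 1) ≤ ‖x‖ ^ (n * T' + 1) := by
            apply Real.rpow_le_rpow_of_exponent_le hx1; gcongr
        _ ≤ _ := by
            apply Real.rpow_le_rpow hx0.le hxR.le; positivity
    have h3 : ‖x‖ ^ (-(n * s.re) - 1) = (‖x‖ ^ (n * s.re + 1))⁻¹ := by
      rw [← Real.rpow_neg hx0.le]; congr 1; ring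
    have h4 : 2 ≤ C1 * ‖x‖ ^ (-(n * s.re) - 1) := by
      rw [h3, hC1, ← div_eq_mul_inv, le_div_iff₀ (by positivity)]
      linarith
    nlinarith
  · suffices h : ‖uH y s - uH x s‖ ≤ C2 * ‖x‖ ^ (-(n * s.re) - 1) by nlinarith
    have hE4 : E ≤ c * ‖x‖ / 4 := by
      have : 4 * E / c ≤ ‖x‖ := (le_max_right _ _).trans hxR
      rw [div_le_iff₀ hc0] at this
      linarith
    by_cases hboth : ¬ (mixedEmbedding.norm x ≠ 0 ∧ uW x ≠ 0) ∧ ¬ (mixedEmbedding.norm y ≠ 0 ∧ uW y ≠ 0)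
    · rw [uH_zero_of hboth.1, uH_zero_of hboth.2]; simp; positivity
    set δ := c / 2 * ‖x‖ with hδ
    have hδ0 : 0 < δ := by positivity
    have hpl : (∀ w, δ ≤ normAtPlace w x) ∧ (∀ w, δ ≤ normAtPlace w y) := by
      by_cases hxx : mixedEmbedding.norm x ≠ 0 ∧ uW x ≠ 0
      · have h1 := hc x hxx.1 hxx.2
        refine ⟨fun w => ?_, fun w => ?_⟩
        · have := h1 w; nlinarith
        · have := h1 w
          have h2 := abs_le.1 ((normAtPlace_sub_le w x y).trans hxy)
          nlinarith
      · have hyy : mixedEmbedding.norm y ≠ 0 ∧ uW y ≠ 0 := by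
          by_contra h; exact hboth ⟨hxx, h⟩
        have h1 := hc y hyy.1 hyy.2
        have h3 : ‖x‖ - E ≤ ‖y‖ := by
          have := norm_sub_norm_le x y; linarith
        have h4 : c * (‖x‖ - E) ≤ c * ‖y‖ := by gcongr
        have h5 : c * E ≤ E := by nlinarith
        refine ⟨fun w => ?_, fun w => ?_⟩
        · have := h1 w
          have h2 := abs_le.1 ((normAtPlace_sub_le w x y).trans hxy)
          rw [hδ]; linarith
        · have := h1 w
          rw [hδ]; linarith
    obtain ⟨hplx, hply⟩ := hpl
    have hnx : mixedEmbedding.norm x ≠ 0 := by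
      intro h
      obtain ⟨w, hw⟩ := mixedEmbedding.norm_eq_zero_iff.1 h
      have := hplx w; linarith
    have hny : mixedEmbedding.norm y ≠ 0 := by
      intro h
      obtain ⟨w, hw⟩ := mixedEmbedding.norm_eq_zero_iff.1 h
      have := hply w; linarith
    obtain ⟨hp1, hp2⟩ := pert_log hδ0 hplx hply hxy
    have hgx := norm_ge_of_place hδ0 hplx
    have hgy := norm_ge_of_place hδ0 hply
    have hexp := exp_diff_le hs hgy hgx
    rw [exp_pow_aux hδ0, abs_sub_comm] at hexp
    unfold uH
    rw [if_neg hnx, if_neg hny]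
    set Lx := Real.log (mixedEmbedding.norm x)
    set Ly := Real.log (mixedEmbedding.norm y)
    have heq : (uW y : ℂ) * Complex.exp (-(s * (Ly : ℂ))) - (uW x : ℂ) * Complex.exp (-(s * (Lx : ℂ)))
        = ((uW y - uW x : ℝ) : ℂ) * Complex.exp (-(s * (Lx : ℂ))) + (uW y : ℂ) * (Complex.exp (-(s * (Ly : ℂ))) - Complex.exp (-(s * (Lx : ℂ)))) := by
      push_cast; ring
    rw [heq]
    refine (norm_add_le _ _).trans ?_
    rw [norm_mul, norm_mul, norm_exp_log, Complex.norm_real, Complex.norm_real, Real.norm_eq_abs, Real.norm_eq_abs,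
      abs_of_nonneg (uW_nonneg y)]
    have h1 : |uW y - uW x| ≤ CW * (4 * (E / δ)) := by
      rw [abs_sub_comm]
      exact (hCW x y).trans (mul_le_mul_of_nonneg_left hp2 hCW0)
    have h2 : Real.exp (-(s.re * Lx)) ≤ δ ^ (-(n * s.re)) := by
      rw [← exp_pow_aux hδ0]
      apply Real.exp_le_exp.2
      have := mul_le_mul_of_nonneg_left hgx hs
      linarith
    have h3 : δ ^ (-(n * s.re)) ≤ (c / 2) ^ (-(n * T')) * ‖x‖ ^ (-(n * s.re)) := by
      rw [hδ, Real.mul_rpow (by positivity) hx0.le]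
      apply mul_le_mul_of_nonneg_right _ (by positivity)
      apply Real.rpow_le_rpow_of_exponent_ge (by positivity) (by linarith)
      have : (n : ℝ) * s.re ≤ n * T' := by gcongr
      linarith
    have h4 : ‖x‖ ^ (-(n * s.re) - 1) = ‖x‖ ^ (-(n * s.re)) * ‖x‖⁻¹ := by
      rw [Real.rpow_sub_one hx0.ne', div_eq_mul_inv]
    have h5 : E / δ = (2 * E / c) * ‖x‖⁻¹ := by
      rw [hδ]; field_simp
    have h6 : uW y * ‖Complex.exp (-(s * (Ly : ℂ))) - Complex.exp (-(s * (Lx : ℂ)))‖ ≤ 2 * T' * (n * (E / δ)) * δ ^ (-(n * s.re)) := by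
      calc _ ≤ 1 * (2 * ‖s‖ * |Lx - Ly| * δ ^ (-(n * s.re))) := by
            apply mul_le_mul (uW_le_one y) hexp (norm_nonneg _) zero_le_one
        _ ≤ _ := by rw [one_mul]; gcongr
    calc _ ≤ CW * (4 * (E / δ)) * δ ^ (-(n * s.re)) + 2 * T' * (n * (E / δ)) * δ ^ (-(n * s.re)) := by
          apply add_le_add _ h6
          apply mul_le_mul h1 h2 (Real.exp_nonneg _); positivity
      _ = (4 * CW + 2 * T' * n) * (E / δ) * δ ^ (-(n * s.re)) := by ring
      _ ≤ (4 * CW + 2 * T' * n) * (E / δ) * ((c / 2) ^ (-(n * T')) * ‖x‖ ^ (-(n * s.re))) := by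
          gcongr
      _ = _ := by rw [h4, h5, hC2]; ring

theorem norm_int_ge (α : 𝓞 K) (hα : α ≠ 0) : 1 ≤ mixedEmbedding.norm (mixedEmbedding K (α : K)) := by
  rw [norm_eq_norm]
  have h1 : (Algebra.norm ℚ (α : K)) = ((Algebra.norm ℤ α : ℤ) : ℚ) := (Algebra.coe_norm_int α).symm
  have h2 : Algebra.norm ℤ α ≠ 0 := Algebra.norm_ne_zero_iff.2 hα
  rw [h1]
  have h3 : 1 ≤ |Algebra.norm ℤ α| := Int.one_le_abs h2
  exact_mod_cast h3

theorem norm_int_or (α : 𝓞 K) : mixedEmbedding.norm (mixedEmbedding K (α : K)) = 0 ∨ 1 ≤ mixedEmbedding.norm (mixedEmbedding K (α : K)) := by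
  by_cases h : α = 0
  · left; simp [h]
  · right; exact norm_int_ge α h

theorem enorm_int_ge (α : 𝓞 K) (hα : α ≠ 0) : 1 ≤ ‖mixedEmbedding K (α : K)‖ := by
  by_contra h
  push Not at h
  have h1 := norm_int_ge α hα
  rw [mixedEmbedding.norm_apply] at h1
  have h2 : ∀ w, normAtPlace w (mixedEmbedding K (α : K)) < 1 := by
    intro w
    refine lt_of_le_of_lt ?_ h
    rw [norm_eq_sup'_normAtPlace]
    exact Finset.le_sup' (fun w => normAtPlace w (mixedEmbedding K (α : K))) (Finset.mem_univ w)
  have h3 : ∏ w, normAtPlace w (mixedEmbedding K (α : K)) ^ w.mult < 1 := by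
    obtain ⟨w0⟩ : Nonempty (InfinitePlace K) := inferInstance
    rw [← Finset.mul_prod_erase _ _ (Finset.mem_univ w0)]
    apply mul_lt_one_of_nonneg_of_lt_one_left
    · exact pow_nonneg (normAtPlace_nonneg _ _) _
    · exact pow_lt_one₀ (normAtPlace_nonneg _ _) (h2 w0) InfinitePlace.mult_ne_zero
    · exact Finset.prod_le_one (fun w _ => pow_nonneg (normAtPlace_nonneg _ _) _)
        (fun w _ => pow_le_one₀ (normAtPlace_nonneg _ _) (h2 w).le)
  linarith

theorem uH_nsmul (m : ℕ) (hm : 0 < m) (x : mixedSpace K) (s : ℂ) :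
    uH ((m : ℝ) • x) s = (m : ℂ) ^ (-((Module.finrank ℚ K : ℂ) * s)) * uH x s := by
  have hm' : (0 : ℝ) < m := by exact_mod_cast hm
  unfold uH
  rw [mixedEmbedding.norm_smul, abs_of_pos hm']
  by_cases hx : mixedEmbedding.norm x = 0
  · simp [hx]
  · have hW : uW ((m : ℝ) • x) = uW x := by
      unfold uW
      rw [logMap_real_smul hx hm'.ne']
    rw [hW]
    rw [if_neg (by positivity), if_neg hx, Real.log_mul (by positivity) hx, Real.log_pow]
    rw [Complex.cpow_def_of_ne_zero (by exact_mod_cast hm.ne'), mul_left_comm, ← Complex.exp_add]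
    congr 2
    push_cast
    rw [← Complex.natCast_log]
    ring

set_option maxHeartbeats 1600000 in
variable (K) in
theorem summable_int (r : ℝ) (hr : (Module.finrank ℚ K : ℝ) < r) :
    Summable fun α : 𝓞 K => ‖mixedEmbedding K (α : K)‖ ^ (-r) := by
  have h := ZLattice.summable_norm_rpow (mixedEmbedding.integerLattice K) (-r) (by
    rw [ZLattice.rank ℝ, mixedEmbedding.finrank]; linarith)
  let φ : 𝓞 K → mixedEmbedding.integerLattice K := fun α => ⟨mixedEmbedding K (α : K), by
    exact ⟨α, rfl⟩⟩
  have hφ : Function.Injective φ := by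
    intro a b hab
    have := congrArg Subtype.val hab
    exact RingOfIntegers.coe_injective (mixedEmbedding_injective K this)
  have h2 := h.comp_injective hφ
  refine h2.congr fun α => ?_
  rfl

theorem uH_summable {s : ℂ} (hs : 1 < s.re) : Summable fun α : 𝓞 K => uH (mixedEmbedding K (α : K)) s := by
  obtain ⟨c, hc0, hc1, hc⟩ := uH_bound K
  have hn : (0 : ℝ) < Module.finrank ℚ K := by exact_mod_cast Module.finrank_pos
  have h1 := (summable_int K (Module.finrank ℚ K * s.re) (by nlinarith)).mul_left (c ^ (-(Module.finrank ℚ K * s.re)))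
  refine Summable.of_norm_bounded_eventually h1 ?_
  have : ∀ᶠ α : 𝓞 K in cofinite, α ≠ 0 := by
    simp [Filter.eventually_cofinite]
  filter_upwards [this] with α hα
  have h2 := enorm_int_ge α hα
  refine (hc _ (by linarith) s (by linarith)).trans ?_
  rw [Real.mul_rpow hc0.le (by positivity)]

theorem J_cont (J : Ideal (𝓞 K)) (hJ : J ≠ ⊥) (s0 : ℂ) (hs0 : s0.re = 1) :
    ∃ g : ℂ → ℂ, AnalyticAt ℂ g s0 ∧ ∀ᶠ s in 𝓝[{s | 1 < s.re}] s0,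
      (s - 1) * ∑' α : J, uH (mixedEmbedding K ((α : 𝓞 K) : K)) s = g s := by
  let b := Ideal.selfBasis (RingOfIntegers.basis K) J hJ
  have hcard : Fintype.card (Module.Free.ChooseBasisIndex ℤ (𝓞 K)) = Module.finrank ℚ K := by
    rw [← RingOfIntegers.rank, Module.finrank_eq_card_chooseBasisIndex]
  have hne : Nonempty (Module.Free.ChooseBasisIndex ℤ (𝓞 K)) := by
    rw [← Fintype.card_pos_iff, hcard]; exact Module.finrank_pos
  let e : (Module.Free.ChooseBasisIndex ℤ (𝓞 K) → ℤ) ≃ₗ[ℤ] J := b.equivFun.symm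
  let φ : (Module.Free.ChooseBasisIndex ℤ (𝓞 K) → ℤ) → mixedSpace K := fun a => mixedEmbedding K ((e a : 𝓞 K) : K)
  let φ' : (Module.Free.ChooseBasisIndex ℤ (𝓞 K) → ℤ) →+ mixedSpace K :=
    (mixedEmbedding K).toAddMonoidHom.comp ((algebraMap (𝓞 K) K).toAddMonoidHom.comp
      ((Submodule.subtype J).toAddMonoidHom.comp e.toLinearMap.toAddMonoidHom))
  have hφadd : ∀ a a', φ (a + a') = φ a + φ a' := fun a a' => by simp [φ]
  have hφm : ∀ (m : ℕ) a, φ (m • a) = (m : ℝ) • φ a := fun m a => by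
    have h1 : φ (m • a) = m • φ a := (map_nsmul φ' m a)
    rw [h1, Nat.cast_smul_eq_nsmul]
  have he0 : ∀ a, a ≠ 0 → (e a : 𝓞 K) ≠ 0 := fun a ha h => ha (by
    have : e a = 0 := Subtype.ext h
    simpa using this)
  have heinj : Function.Injective fun a => (e a : 𝓞 K) := fun a a' h => e.injective (Subtype.ext h)
  have key := lat_cont (fun a s => uH (φ a) s) (fun a => ‖φ a‖) (fun a => norm_nonneg _)
    (fun a ha => enorm_int_ge _ (he0 a ha))
    (fun r hr => (summable_int K r (by rw [← hcard]; exact hr)).comp_injective heinj)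
    (fun a => uH_differentiable _)
    (fun m hm a s => by
      simp only [hφm]
      rw [uH_nsmul m hm, hcard])
    (fun a s hs => uH_le_one (norm_int_or _) hs)
    (fun s hs => (uH_summable hs).comp_injective heinj)
    (fun ε T => by
      obtain ⟨C, hC0, hC⟩ := uH_diff K ‖φ ε‖ T (norm_nonneg _)
      refine ⟨C, hC0, fun a ha s hs hsT => ?_⟩
      rw [hcard]
      refine hC _ _ ?_ (enorm_int_ge _ (he0 a ha)) (norm_int_or _) (norm_int_or _) s hs hsT
      show ‖φ a - φ (a + ε)‖ ≤ _
      rw [hφadd]; simp) s0 hs0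
  obtain ⟨g, hg, hg2⟩ := key
  refine ⟨g, hg, ?_⟩
  filter_upwards [hg2] with s hs
  rw [← hs, ← e.toEquiv.tsum_eq]
  rfl
end Z3

end PartZ3

section PartZ4
set_option linter.all false
open Filter Topology NumberField NumberField.mixedEmbedding NumberField.Units NumberField.Units.dirichletUnitTheorem
open scoped nonZeroDivisors

theorem hasSum_fiber {β γ : Type*} {f : β → ℂ} {a : ℂ} (h : HasSum f a) (g : β → γ) (F : γ → ℂ)
    (hF : ∀ c, HasSum (fun b : g ⁻¹' {c} => f b) (F c)) : HasSum F a := by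
  have h1 := (Equiv.sigmaFiberEquiv g).hasSum_iff.2 h
  exact h1.sigma hF

theorem HasSum.congr_simp' {β : Type*} {f g : β → ℂ} {a : ℂ} (h : HasSum g a) (hfg : ∀ b, f b = g b) : HasSum f a := by
  rw [funext hfg]; exact h

theorem tent_sum (x : ℝ) : ∑ k ∈ ({-⌊x⌋, -⌊x⌋ - 1} : Finset ℤ), tent (x + k) = 1 := by
  rw [Finset.sum_pair (by omega)]
  have h0 := Int.fract_nonneg x
  have h1 := (Int.fract_lt_one x).le
  have e1 : x + ((-⌊x⌋ : ℤ) : ℝ) = Int.fract x := by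
    rw [Int.fract]; push_cast; ring
  have e2 : x + ((-⌊x⌋ - 1 : ℤ) : ℝ) = Int.fract x - 1 := by
    rw [Int.fract]; push_cast; ring
  rw [e1, e2]
  unfold tent
  rw [abs_of_nonneg h0, abs_of_nonpos (by linarith), max_eq_right (by linarith), max_eq_right (by linarith)]
  ring

theorem tent_notin {x : ℝ} {k : ℤ} (hk : k ∉ ({-⌊x⌋, -⌊x⌋ - 1} : Finset ℤ)) : tent (x + k) = 0 := by
  by_contra h
  apply hk
  have h1 := abs_lt.1 (tent_supp h)
  have h2 := Int.floor_le x
  have h3 := Int.lt_floor_add_one x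
  have h4 : -2 < ⌊x⌋ + k := by
    have : (-2 : ℝ) < ⌊x⌋ + k := by linarith
    exact_mod_cast this
  have h5 : ⌊x⌋ + k < 1 := by
    have : (⌊x⌋ + k : ℝ) < 1 := by linarith
    exact_mod_cast this
  simp only [Finset.mem_insert, Finset.mem_singleton]
  omega

section Z4
open scoped Classical
variable {K : Type*} [Field K] [NumberField K]

theorem uW_unit (x : mixedSpace K) (hx : mixedEmbedding.norm x ≠ 0) (ζ : torsion K) (e : Fin (rank K) → ℤ) :
    uW (((ζ : (𝓞 K)ˣ) * ∏ i, (fundSystem K i) ^ (e i)) • x) = ∏ i, tent ((uBasis K).repr (logMap x) i + e i) := by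
  unfold uW
  rw [mul_smul, logMap_torsion_smul _ ζ.2, logMap_unit_smul _ hx]
  refine Finset.prod_congr rfl fun i _ => ?_
  congr 1
  rw [map_add, Finsupp.add_apply, add_comm]
  congr 1
  have h1 : logEmbedding K (Additive.ofMul (∏ i, (fundSystem K i) ^ (e i))) = ∑ j, (e j : ℝ) • uBasis K j := by
    rw [ofMul_prod, map_sum]
    refine Finset.sum_congr rfl fun j _ => ?_
    rw [ofMul_zpow, map_zsmul, logEmbedding_fundSystem, uBasis, Module.Basis.ofZLatticeBasis_apply, Int.cast_smul_eq_zsmul]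
  rw [h1, Module.Basis.repr_sum_self]

theorem uW_unit_sum (x : mixedSpace K) (hx : mixedEmbedding.norm x ≠ 0) :
    HasSum (fun u : (𝓞 K)ˣ => (uW (u • x) : ℂ)) (torsionOrder K) := by
  let m : torsion K × (Fin (rank K) → ℤ) → (𝓞 K)ˣ := fun p => p.1 * ∏ i, (fundSystem K i) ^ (p.2 i)
  have hm : Function.Bijective m := by
    rw [Function.bijective_iff_existsUnique]
    intro u
    obtain ⟨p, hp, hp2⟩ := exist_unique_eq_mul_prod K u
    exact ⟨p, hp.symm, fun q hq => hp2 q hq.symm⟩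
  rw [← (Equiv.ofBijective m hm).hasSum_iff]
  haveI : Fintype (torsion K) := Fintype.ofFinite _
  let r : Fin (rank K) → ℝ := fun i => (uBasis K).repr (logMap x) i
  let t : Fin (rank K) → Finset ℤ := fun i => {-⌊r i⌋, -⌊r i⌋ - 1}
  have hval : ∀ p : torsion K × (Fin (rank K) → ℤ), ((fun u : (𝓞 K)ˣ => (uW (u • x) : ℂ)) ∘ Equiv.ofBijective m hm) p
      = ((∏ i, tent (r i + p.2 i) : ℝ) : ℂ) := by
    intro p
    show ((uW (m p • x) : ℝ) : ℂ) = _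
    rw [uW_unit x hx]
  have key := hasSum_sum_of_ne_finset_zero (f := ((fun u : (𝓞 K)ˣ => (uW (u • x) : ℂ)) ∘ Equiv.ofBijective m hm))
    (s := Finset.univ ×ˢ Fintype.piFinset t) (L := SummationFilter.unconditional _) (by
      intro p hp
      rw [hval]
      simp only [Finset.mem_product, Finset.mem_univ, true_and, Fintype.mem_piFinset, not_forall] at hp
      obtain ⟨i, hi⟩ := hp
      rw [Finset.prod_eq_zero (Finset.mem_univ i) (tent_notin hi)]
      simp)
  convert key using 1
  simp_rw [hval]
  rw [Finset.sum_product]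
  simp only
  rw [Finset.sum_const, ← Complex.ofReal_sum, ← Finset.prod_univ_sum t (fun i k => tent (r i + k))]
  rw [Finset.prod_eq_one (fun i _ => tent_sum (r i))]
  simp [torsionOrder, Nat.card_eq_fintype_card]

/-- the sum over generators of a principal ideal -/
theorem gen_sum (J : Ideal (𝓞 K)) (s : ℂ) (P : Ideal (𝓞 K)) : HasSum
    (fun α : (fun α : J => Ideal.span {(α : 𝓞 K)}) ⁻¹' {P} => uH (mixedEmbedding K ((α : J) : 𝓞 K)) s)
    (if P ≠ ⊥ ∧ P.IsPrincipal ∧ P ≤ J then (torsionOrder K : ℂ) * (Ideal.absNorm P : ℂ) ^ (-s) else 0) := by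
  split_ifs with h
  · obtain ⟨h1, ⟨a, ha⟩, h3⟩ := h
    rw [Ideal.submodule_span_eq] at ha
    have ha0 : a ≠ 0 := by rintro rfl; apply h1; simp [ha]
    have haJ : a ∈ J := h3 (ha ▸ Ideal.mem_span_singleton_self a)
    let x := mixedEmbedding K (a : K)
    have hx : mixedEmbedding.norm x ≠ 0 := by have := norm_int_ge a ha0; positivity
    let m : (𝓞 K)ˣ → (fun α : J => Ideal.span {(α : 𝓞 K)}) ⁻¹' {P} := fun u => ⟨⟨u * a, J.mul_mem_left _ haJ⟩, by
      simp only [Set.mem_preimage, Set.mem_singleton_iff]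
      rw [ha, Ideal.span_singleton_mul_left_unit u.isUnit]⟩
    have hm : Function.Bijective m := by
      constructor
      · intro u v huv
        have := congrArg (fun z => ((z.1 : J) : 𝓞 K)) huv
        exact Units.ext (mul_right_cancel₀ ha0 this)
      · rintro ⟨⟨b, hb⟩, hbP⟩
        simp only [Set.mem_preimage, Set.mem_singleton_iff] at hbP
        rw [ha, Ideal.span_singleton_eq_span_singleton] at hbP
        obtain ⟨u, hu⟩ := hbP.symm
        exact ⟨u, by
          apply Subtype.ext; apply Subtype.ext
          show (u : 𝓞 K) * a = b
          rw [mul_comm, hu]⟩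
    rw [← (Equiv.ofBijective m hm).hasSum_iff]
    have h4 := (uW_unit_sum x hx).mul_right ((Ideal.absNorm P : ℂ) ^ (-s))
    refine HasSum.congr_simp' h4 fun u => ?_
    show uH (mixedEmbedding K (((u : 𝓞 K) * a : 𝓞 K) : K)) s = _
    have h5 : mixedEmbedding K (((u : 𝓞 K) * a : 𝓞 K) : K) = u • x := by
      rw [unitSMul_smul, ← map_mul]; simp
    have h6 : mixedEmbedding.norm (u • x) = (Ideal.absNorm P : ℝ) := by
      rw [norm_unit_smul, norm_eq_norm, ha, Ideal.absNorm_span_singleton, ← Algebra.coe_norm_int]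
      push_cast
      simp
    have h7 : (0 : ℝ) < Ideal.absNorm P := by
      have := Ideal.absNorm_eq_zero_iff.not.2 h1
      positivity
    rw [h5, uH, h6, if_neg h7.ne']
    rw [Complex.cpow_def_of_ne_zero (by exact_mod_cast h7.ne'), ← Complex.natCast_log]
    congr 2
    ring
  · convert hasSum_zero with α
    obtain ⟨⟨α, hα⟩, hP⟩ := α
    simp only [Set.mem_preimage, Set.mem_singleton_iff] at hP
    have : α = 0 := by
      by_contra h0
      apply h
      subst hP
      exact ⟨by simpa using h0, ⟨α, rfl⟩, by simpa [Ideal.span_le] using hα⟩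
    subst this
    simp [uH]

set_option maxHeartbeats 1600000 in
theorem class_sum (C : ClassGroup (𝓞 K)) (J : (Ideal (𝓞 K))⁰) (hJ : ClassGroup.mk0 J = C⁻¹) (s : ℂ) (hs : 1 < s.re) :
    HasSum (fun I : {I : (Ideal (𝓞 K))⁰ // ClassGroup.mk0 I = C} => (Ideal.absNorm (I.1 : Ideal (𝓞 K)) : ℂ) ^ (-s))
      ((torsionOrder K : ℂ)⁻¹ * (Ideal.absNorm (J : Ideal (𝓞 K)) : ℂ) ^ s *
        ∑' α : (J : Ideal (𝓞 K)), uH (mixedEmbedding K ((α : 𝓞 K) : K)) s) := by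
  have hsum : Summable fun α : (J : Ideal (𝓞 K)) => uH (mixedEmbedding K ((α : 𝓞 K) : K)) s :=
    (uH_summable hs).comp_injective Subtype.val_injective
  have h1 := hasSum_fiber hsum.hasSum (fun α => Ideal.span {(α : 𝓞 K)}) _ (gen_sum (J : Ideal (𝓞 K)) s)
  let m : {I : (Ideal (𝓞 K))⁰ // ClassGroup.mk0 I = C} → Ideal (𝓞 K) := fun I => I.1 * J
  have hJ0 : (J : Ideal (𝓞 K)) ≠ 0 := nonZeroDivisors.coe_ne_zero J
  have hm : Function.Injective m := by
    intro I I' h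
    exact Subtype.ext (Subtype.ext (mul_right_cancel₀ hJ0 h))
  have hmP : ∀ I, m I ≠ ⊥ ∧ (m I).IsPrincipal ∧ m I ≤ J := by
    intro I
    have h2 : m I ≠ ⊥ := mul_ne_zero (nonZeroDivisors.coe_ne_zero I.1) hJ0
    refine ⟨h2, ?_, Ideal.mul_le_right⟩
    have h3 : ClassGroup.mk0 (I.1 * J) = 1 := by rw [map_mul, I.2, hJ]; simp
    exact (ClassGroup.mk0_eq_one_iff (I.1 * J).2).1 h3
  rw [← hm.hasSum_iff (by
    intro P hP
    rw [if_neg]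
    rintro ⟨h2, h3, h4⟩
    apply hP
    obtain ⟨I, hI⟩ := Ideal.dvd_iff_le.2 h4
    have hI0 : I ≠ 0 := by rintro rfl; apply h2; rw [hI]; simp
    let I' : (Ideal (𝓞 K))⁰ := ⟨I, mem_nonZeroDivisors_iff_ne_zero.2 hI0⟩
    have h5 : ClassGroup.mk0 (I' * J) = 1 := by
      rw [ClassGroup.mk0_eq_one_iff (I' * J).2]
      show (I * J : Ideal (𝓞 K)).IsPrincipal
      rw [mul_comm, ← hI]; exact h3
    refine ⟨⟨I', ?_⟩, ?_⟩
    · rw [map_mul, hJ] at h5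
      exact mul_inv_eq_one.1 h5
    · show I * J = P
      rw [mul_comm, ← hI])] at h1
  have h2 := h1.mul_left ((torsionOrder K : ℂ)⁻¹ * (Ideal.absNorm (J : Ideal (𝓞 K)) : ℂ) ^ s)
  refine HasSum.congr_simp' h2 fun I => ?_
  simp only [Function.comp]
  rw [if_pos (hmP I)]
  have hN : Ideal.absNorm (m I) = Ideal.absNorm (I.1 : Ideal (𝓞 K)) * Ideal.absNorm (J : Ideal (𝓞 K)) := map_mul _ _ _
  have hNJ : (Ideal.absNorm (J : Ideal (𝓞 K)) : ℂ) ≠ 0 := by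
    exact_mod_cast Ideal.absNorm_eq_zero_iff.not.2 hJ0
  rw [hN, Nat.cast_mul, Complex.natCast_mul_natCast_cpow, Complex.cpow_neg ((Ideal.absNorm (J : Ideal (𝓞 K)) : ℂ))]
  have hw : (torsionOrder K : ℂ) ≠ 0 := by exact_mod_cast torsionOrder_ne_zero K
  have hp : (Ideal.absNorm (J : Ideal (𝓞 K)) : ℂ) ^ s ≠ 0 := by
    rw [Ne, Complex.cpow_eq_zero_iff]; tauto
  field_simp

variable (K) in
noncomputable def zt (s : ℂ) : ℂ := ∑' I : (Ideal (𝓞 K))⁰, (Ideal.absNorm (I : Ideal (𝓞 K)) : ℂ) ^ (-s)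

theorem zt_eq (J : ClassGroup (𝓞 K) → (Ideal (𝓞 K))⁰) (hJ : ∀ C, ClassGroup.mk0 (J C) = C⁻¹) (s : ℂ) (hs : 1 < s.re) :
    HasSum (fun I : (Ideal (𝓞 K))⁰ => (Ideal.absNorm (I : Ideal (𝓞 K)) : ℂ) ^ (-s))
      (∑ C, (torsionOrder K : ℂ)⁻¹ * (Ideal.absNorm (J C : Ideal (𝓞 K)) : ℂ) ^ s *
        ∑' α : (J C : Ideal (𝓞 K)), uH (mixedEmbedding K ((α : 𝓞 K) : K)) s) := by
  have h1 : ∀ C ∈ Finset.univ, _ := fun C (_ : C ∈ Finset.univ) =>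
    (hasSum_subtype_iff_indicator (f := fun I : (Ideal (𝓞 K))⁰ => (Ideal.absNorm (I : Ideal (𝓞 K)) : ℂ) ^ (-s))
      (s := {I | ClassGroup.mk0 I = C})).1 (class_sum C (J C) (hJ C) s hs)
  have h2 := hasSum_sum h1
  convert h2 using 1
  funext I
  rw [Finset.sum_eq_single (ClassGroup.mk0 I)]
  · simp [Set.indicator]
  · intro C _ hC
    rw [Set.indicator_of_notMem]
    exact fun h => hC h.symm
  · simp

theorem zt_summable {s : ℂ} (hs : 1 < s.re) :
    Summable (fun I : (Ideal (𝓞 K))⁰ => (Ideal.absNorm (I : Ideal (𝓞 K)) : ℂ) ^ (-s)) := by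
  choose J hJ using fun C : ClassGroup (𝓞 K) => ClassGroup.mk0_surjective C⁻¹
  exact (zt_eq J hJ s hs).summable

theorem zt_cont (s0 : ℂ) (hs0 : s0.re = 1) :
    ∃ g : ℂ → ℂ, AnalyticAt ℂ g s0 ∧ ∀ᶠ s in 𝓝[{s | 1 < s.re}] s0, (s - 1) * zt K s = g s := by
  choose J hJ using fun C : ClassGroup (𝓞 K) => ClassGroup.mk0_surjective C⁻¹
  choose g hg hg2 using fun C => J_cont (J C : Ideal (𝓞 K)) (nonZeroDivisors.coe_ne_zero (J C)) s0 hs0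
  refine ⟨fun s => ∑ C, (torsionOrder K : ℂ)⁻¹ * (Ideal.absNorm (J C : Ideal (𝓞 K)) : ℂ) ^ s * g C s, ?_, ?_⟩
  · refine Finset.analyticAt_fun_sum _ fun C _ => ?_
    refine AnalyticAt.mul (AnalyticAt.mul analyticAt_const ?_) (hg C)
    have h0 : (Ideal.absNorm (J C : Ideal (𝓞 K)) : ℂ) ≠ 0 := by
      exact_mod_cast Ideal.absNorm_eq_zero_iff.not.2 (nonZeroDivisors.coe_ne_zero (J C))
    have : Differentiable ℂ fun s : ℂ => (Ideal.absNorm (J C : Ideal (𝓞 K)) : ℂ) ^ s := fun s =>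
      DifferentiableAt.const_cpow differentiableAt_id (Or.inl h0)
    exact this.analyticAt s0
  · filter_upwards [Filter.eventually_all.2 hg2, self_mem_nhdsWithin] with s hs hs1
    rw [zt, (zt_eq J hJ s hs1).tsum_eq, Finset.mul_sum]
    refine Finset.sum_congr rfl fun C _ => ?_
    rw [← hs C]
    ring
end Z4

end PartZ4

section PartY1
set_option linter.all false
open Filter Topology NumberField IsDedekindDomain
open scoped nonZeroDivisors

theorem fiber_LSeries {β : Type*} (N : β → ℕ) (hN : ∀ b, 0 < N b) (hfin : ∀ n, (N ⁻¹' {n}).Finite) (c : β → ℂ) (s S : ℂ)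
    (h : HasSum (fun b => c b * (N b : ℂ) ^ (-s)) S) :
    HasSum (fun n => LSeries.term (fun n => ∑' b : N ⁻¹' {n}, c b) s n) S := by
  refine hasSum_fiber h N _ fun n => ?_
  rcases Nat.eq_zero_or_pos n with rfl | hn
  · simp only [LSeries.term_zero]
    haveI : IsEmpty (N ⁻¹' {0}) := ⟨fun b => (hN b).ne' b.2⟩
    exact hasSum_empty
  · haveI : Finite (N ⁻¹' {n}) := hfin n
    haveI : Fintype (N ⁻¹' {n}) := Fintype.ofFinite _
    rw [LSeries.term_of_ne_zero hn.ne', tsum_fintype, Finset.sum_div]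
    have h2 := hasSum_fintype (fun b : N ⁻¹' {n} => c b * (N b : ℂ) ^ (-s))
    convert h2 using 1
    refine Finset.sum_congr rfl fun b _ => ?_
    have : N b = n := b.2
    rw [this, Complex.cpow_neg, div_eq_mul_inv]

section Y1
variable {K : Type*} [Field K] [NumberField K]

noncomputable def NI (I : (Ideal (𝓞 K))⁰) : ℕ := Ideal.absNorm (I : Ideal (𝓞 K))

theorem NI_pos (I : (Ideal (𝓞 K))⁰) : 0 < NI I :=
  Nat.pos_of_ne_zero (Ideal.absNorm_eq_zero_iff.not.2 (nonZeroDivisors.coe_ne_zero I))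

theorem NI_mul (I J : (Ideal (𝓞 K))⁰) : NI (I * J) = NI I * NI J := map_mul _ _ _

theorem NI_fin (n : ℕ) : ((NI (K := K)) ⁻¹' {n}).Finite := by
  have h := Ideal.finite_setOf_absNorm_eq (S := 𝓞 K) n
  exact Set.Finite.preimage (f := Subtype.val) (Subtype.val_injective.injOn) h

noncomputable def qI (q : HeightOneSpectrum (𝓞 K) × ℕ) : (Ideal (𝓞 K))⁰ :=
  ⟨q.1.asIdeal ^ (q.2 + 1), mem_nonZeroDivisors_iff_ne_zero.2 (pow_ne_zero _ q.1.ne_bot)⟩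

noncomputable def Np (v : HeightOneSpectrum (𝓞 K)) : ℕ := Ideal.absNorm v.asIdeal

theorem Np_two_le (v : HeightOneSpectrum (𝓞 K)) : 2 ≤ Np v := by
  have h0 : Np v ≠ 0 := Ideal.absNorm_eq_zero_iff.not.2 v.ne_bot
  have h1 : Np v ≠ 1 := Ideal.absNorm_eq_one_iff.not.2 v.isPrime.ne_top
  omega

theorem NI_qI (q : HeightOneSpectrum (𝓞 K) × ℕ) : NI (qI q) = Np q.1 ^ (q.2 + 1) := map_pow _ _ _

theorem qI_inj : Function.Injective (qI (K := K)) := by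
  rintro ⟨v, k⟩ ⟨w, j⟩ h
  have h1 : v.asIdeal ^ (k + 1) = w.asIdeal ^ (j + 1) := congrArg Subtype.val h
  have h2 : v.asIdeal ∣ w.asIdeal ^ (j + 1) := h1 ▸ dvd_pow_self _ (Nat.succ_ne_zero k)
  have h3 : v.asIdeal ∣ w.asIdeal := v.prime.dvd_of_dvd_pow h2
  have h4 : v.asIdeal = w.asIdeal := associated_iff_eq.1 ((v.prime.dvd_prime_iff_associated w.prime).1 h3)
  have h5 : v = w := HeightOneSpectrum.ext h4
  subst h5
  have h6 : Np v ^ (k + 1) = Np v ^ (j + 1) := by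
    have := congrArg NI h
    rwa [NI_qI, NI_qI] at this
  have h7 := Nat.pow_right_injective (Np_two_le v) h6
  simp only [Prod.mk.injEq, true_and]
  omega

theorem NqI_fin (n : ℕ) : ((fun q => NI (qI (K := K) q)) ⁻¹' {n}).Finite :=
  Set.Finite.preimage (f := qI) (qI_inj.injOn) (NI_fin n)

theorem qsum {s : ℂ} (hs : 1 < s.re) :
    Summable fun q : HeightOneSpectrum (𝓞 K) × ℕ => (Real.log (Np q.1) : ℂ) * (NI (qI q) : ℂ) ^ (-s) := by
  set ε := (s.re - 1) / 2 with hε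
  have hε0 : 0 < ε := by rw [hε]; linarith
  have h1 := ((zt_summable (K := K) (s := s - ε) (by simp; linarith)).norm.comp_injective qI_inj).mul_left (ε⁻¹)
  refine Summable.of_norm_bounded h1 fun q => ?_
  have hp : (0 : ℝ) < NI (qI q) := by exact_mod_cast NI_pos _
  have hp' : 0 < NI (qI q) := NI_pos _
  simp only [Function.comp]
  change _ ≤ ε⁻¹ * ‖(NI (qI q) : ℂ) ^ (-(s - ε))‖
  rw [norm_mul, Complex.norm_natCast_cpow_of_pos hp', Complex.norm_natCast_cpow_of_pos hp', Complex.norm_real]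
  have h2 : ‖Real.log (Np q.1)‖ ≤ (NI (qI q) : ℝ) ^ ε / ε := by
    have hN2 : (2 : ℝ) ≤ Np q.1 := by exact_mod_cast Np_two_le q.1
    rw [Real.norm_of_nonneg (Real.log_nonneg (by linarith))]
    refine le_trans ?_ (Real.log_le_rpow_div hp.le hε0)
    apply Real.log_le_log (by linarith)
    rw [NI_qI]
    exact_mod_cast Nat.le_self_pow (Nat.succ_ne_zero _) _
  calc _ ≤ (NI (qI q) : ℝ) ^ ε / ε * (NI (qI q) : ℝ) ^ (-s).re := by gcongr
    _ = ε⁻¹ * ((NI (qI q) : ℝ) ^ ε * (NI (qI q) : ℝ) ^ (-s).re) := by ring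
    _ = _ := by
      rw [← Real.rpow_add hp]; congr 2; simp; ring

/-- log N(P) = Σ_{𝔭^{k+1} ∣ P} log N𝔭 -/
theorem fiber_P (P : (Ideal (𝓞 K))⁰) :
    HasSum (fun t : (fun t : (Ideal (𝓞 K))⁰ × (HeightOneSpectrum (𝓞 K) × ℕ) => t.1 * qI t.2) ⁻¹' {P} =>
      (Real.log (Np t.1.2.1) : ℂ)) (Real.log (NI P)) := by
  classical
  let f : HeightOneSpectrum (𝓞 K) × ℕ → ℂ := fun q =>
    if q.1.asIdeal ^ (q.2 + 1) ∣ (P : Ideal (𝓞 K)) then (Real.log (Np q.1) : ℂ) else 0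
  let g : (fun t : (Ideal (𝓞 K))⁰ × (HeightOneSpectrum (𝓞 K) × ℕ) => t.1 * qI t.2) ⁻¹' {P} → HeightOneSpectrum (𝓞 K) × ℕ :=
    fun t => t.1.2
  have hP0 : (P : Ideal (𝓞 K)) ≠ 0 := nonZeroDivisors.coe_ne_zero P
  have hg : Function.Injective g := by
    rintro ⟨⟨I, q⟩, h1⟩ ⟨⟨I', q'⟩, h2⟩ h
    have h3 : q = q' := h
    subst h3
    have h1' : I * qI q = P := h1
    have h2' : I' * qI q = P := h2
    have h4 : (I : Ideal (𝓞 K)) * (qI q : Ideal (𝓞 K)) = I' * (qI q : Ideal (𝓞 K)) := by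
      have := h1'.trans h2'.symm
      exact congrArg Subtype.val this
    have h5 : I = I' := Subtype.ext (mul_right_cancel₀ (nonZeroDivisors.coe_ne_zero (qI q)) h4)
    subst h5
    rfl
  have hfg : ∀ t, f (g t) = (Real.log (Np t.1.2.1) : ℂ) := by
    rintro ⟨⟨I, q⟩, h1⟩
    have h1' : I * qI q = P := h1
    simp only [f, g]
    rw [if_pos]
    refine ⟨I, ?_⟩
    rw [mul_comm]
    exact (congrArg Subtype.val h1').symm
  have hf0 : ∀ q, q ∉ Set.range g → f q = 0 := by
    intro q hq
    simp only [f]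
    rw [if_neg]
    rintro ⟨I, hI⟩
    apply hq
    have hI0 : I ≠ 0 := by rintro rfl; apply hP0; rw [hI]; simp
    refine ⟨⟨⟨⟨I, mem_nonZeroDivisors_iff_ne_zero.2 hI0⟩, q⟩, ?_⟩, rfl⟩
    apply Subtype.ext
    show I * _ = _
    rw [hI, mul_comm]; rfl
  have e1 := (hg.hasSum_iff hf0 (a := (Real.log (NI P) : ℂ)))
  refine HasSum.congr_simp' (e1.2 ?_) (fun t => (hfg t).symm)
  let f' : Ideal (𝓞 K) × ℕ → ℂ := fun q =>
    if Prime q.1 ∧ q.1 ^ (q.2 + 1) ∣ (P : Ideal (𝓞 K)) then (Real.log (Ideal.absNorm q.1) : ℂ) else 0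
  let g' : HeightOneSpectrum (𝓞 K) × ℕ → Ideal (𝓞 K) × ℕ := fun q => (q.1.asIdeal, q.2)
  have hg' : Function.Injective g' := by
    rintro ⟨v, k⟩ ⟨w, j⟩ h
    simp only [g', Prod.mk.injEq] at h
    exact Prod.ext (HeightOneSpectrum.ext h.1) h.2
  have hf0' : ∀ q, q ∉ Set.range g' → f' q = 0 := by
    rintro ⟨I, k⟩ hq
    simp only [f']
    rw [if_neg]
    rintro ⟨h1, h2⟩
    exact hq ⟨(⟨I, Ideal.isPrime_of_prime h1, h1.ne_zero⟩, k), rfl⟩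
  have e2 := (hg'.hasSum_iff hf0' (a := (Real.log (NI P) : ℂ)))
  refine HasSum.congr_simp' (e2.2 ?_) (fun q => ?_)
  swap
  · simp only [f, f', g', Function.comp]
    simp only [q.1.prime, true_and]
    rfl
  set nf := UniqueFactorizationMonoid.normalizedFactors (P : Ideal (𝓞 K)) with hnf
  have hdvd : ∀ (I : Ideal (𝓞 K)) (k : ℕ), Prime I → (I ^ (k + 1) ∣ (P : Ideal (𝓞 K)) ↔ k + 1 ≤ nf.count I) := by
    intro I k hI
    rw [pow_dvd_iff_le_emultiplicity, UniqueFactorizationMonoid.emultiplicity_eq_count_normalizedFactors hI.irreducible hP0,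
      normalize_eq]
    exact_mod_cast Iff.rfl
  have key := hasSum_sum_of_ne_finset_zero (f := f') (s := nf.toFinset ×ˢ Finset.range nf.card)
    (L := SummationFilter.unconditional _) (by
      rintro ⟨I, k⟩ hI
      simp only [f']
      rw [if_neg]
      rintro ⟨h1, h2⟩
      apply hI
      rw [hdvd I k h1] at h2
      have h3 := Multiset.count_le_card I nf
      simp only [Finset.mem_product, Multiset.mem_toFinset, Finset.mem_range]
      exact ⟨Multiset.count_pos.1 (by omega), by omega⟩)
  convert key using 1
  rw [Finset.sum_product]
  have hprime : ∀ I ∈ nf, Prime I := fun I hI => UniqueFactorizationMonoid.prime_of_normalized_factor I hI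
  have h1 : ∀ I ∈ nf.toFinset, ∑ k ∈ Finset.range nf.card, f' (I, k) = ((nf.count I : ℝ) * Real.log (Ideal.absNorm I) : ℝ) := by
    intro I hI
    have hp := hprime I (Multiset.mem_toFinset.1 hI)
    simp only [f', hp, true_and, hdvd I _ hp]
    rw [← Finset.sum_filter, Finset.sum_const]
    have : (Finset.range nf.card).filter (fun k => k + 1 ≤ nf.count I) = Finset.range (nf.count I) := by
      ext k
      have h3 := Multiset.count_le_card I nf
      simp only [Finset.mem_filter, Finset.mem_range]
      omega
    rw [this]; simp
  rw [Finset.sum_congr rfl h1, ← Complex.ofReal_sum]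
  congr 1
  have h2 : NI P = (nf.map Ideal.absNorm).prod := by
    rw [← map_multiset_prod, hnf, Ideal.prod_normalizedFactors_eq_self hP0]; rfl
  rw [h2]
  have h3 : ∀ m : Multiset (Ideal (𝓞 K)), (∀ I ∈ m, Prime I) →
      Real.log ((m.map Ideal.absNorm).prod : ℕ) = (m.map (fun I => Real.log (Ideal.absNorm I))).sum := by
    intro m hm
    induction m using Multiset.induction_on with
    | empty => simp
    | cons a m ih =>
      have ih' := ih (fun I hI => hm I (Multiset.mem_cons_of_mem hI))
      rw [Multiset.map_cons, Multiset.prod_cons, Multiset.map_cons, Multiset.sum_cons, ← ih', Nat.cast_mul, Real.log_mul]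
      · have := (hm a (Multiset.mem_cons_self a m)).ne_zero
        exact_mod_cast Ideal.absNorm_eq_zero_iff.not.2 this
      · have : (m.map Ideal.absNorm).prod ≠ 0 := by
          apply Multiset.prod_ne_zero
          intro h
          obtain ⟨I, hI, hI2⟩ := Multiset.mem_map.1 h
          exact (hm I (Multiset.mem_cons_of_mem hI)).ne_zero (Ideal.absNorm_eq_zero_iff.1 hI2)
        exact_mod_cast this
  rw [h3 nf hprime, Finset.sum_multiset_map_count]
  simp

theorem zt_mul {s : ℂ} (hs : 1 < s.re) :
    HasSum (fun P : (Ideal (𝓞 K))⁰ => (Real.log (NI P) : ℂ) * (NI P : ℂ) ^ (-s))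
      (zt K s * ∑' q : HeightOneSpectrum (𝓞 K) × ℕ, (Real.log (Np q.1) : ℂ) * (NI (qI q) : ℂ) ^ (-s)) := by
  have h1 := (zt_summable (K := K) hs).norm
  have h2 := (qsum (K := K) hs).norm
  have h3 := summable_mul_of_summable_norm h1 h2
  have h4 := HasSum.mul (zt_summable (K := K) hs).hasSum (qsum (K := K) hs).hasSum h3
  refine hasSum_fiber h4 (fun t => t.1 * qI t.2) _ fun P => ?_
  have h5 := (fiber_P P).mul_right ((NI P : ℂ) ^ (-s))
  refine HasSum.congr_simp' h5 fun t => ?_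
  have h6 : t.1.1 * qI t.1.2 = P := t.2
  have h7 : NI P = NI t.1.1 * NI (qI t.1.2) := (congrArg NI h6).symm.trans (NI_mul _ _)
  rw [h7, Nat.cast_mul, Complex.natCast_mul_natCast_cpow]
  show (NI t.1.1 : ℂ) ^ (-s) * _ = _
  ring

variable (K) in
noncomputable def lam (n : ℕ) : ℝ := ∑' q : (fun q => NI (qI (K := K) q)) ⁻¹' {n}, Real.log (Np q.1.1)

theorem lam_LSeries {s : ℂ} (hs : 1 < s.re) :
    HasSum (fun n => LSeries.term (fun n => (lam K n : ℂ)) s n)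
      (∑' q : HeightOneSpectrum (𝓞 K) × ℕ, (Real.log (Np q.1) : ℂ) * (NI (qI q) : ℂ) ^ (-s)) := by
  have h := fiber_LSeries (fun q => NI (qI (K := K) q)) (fun q => NI_pos _) NqI_fin (fun q => (Real.log (Np q.1) : ℂ)) s _
    (qsum hs).hasSum
  refine HasSum.congr_simp' h fun n => ?_
  congr 1
  funext n
  rw [lam, Complex.ofReal_tsum]

variable (K) in
noncomputable def acoef (n : ℕ) : ℂ := ∑' I : (NI (K := K)) ⁻¹' {n}, 1

theorem zt_LSeries {s : ℂ} (hs : 1 < s.re) :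
    HasSum (fun n => LSeries.term (acoef K) s n) (zt K s) := by
  refine fiber_LSeries (NI (K := K)) NI_pos NI_fin (fun _ => 1) s _ ?_
  simp only [one_mul]
  exact (zt_summable hs).hasSum

theorem zt_logMul {s : ℂ} (hs : 1 < s.re) :
    LSeries (LSeries.logMul (acoef K)) s = zt K s * LSeries (fun n => (lam K n : ℂ)) s := by
  rw [LSeries, LSeries, (lam_LSeries hs).tsum_eq]
  have h := fiber_LSeries (NI (K := K)) NI_pos NI_fin (fun I => (Real.log (NI I) : ℂ)) s _ (zt_mul hs)
  refine HasSum.tsum_eq ?_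
  refine HasSum.congr_simp' h fun n => ?_
  congr 1
  funext n
  rw [LSeries.logMul, acoef, ← tsum_mul_left]
  refine tsum_congr fun I => ?_
  have : NI I.1 = n := I.2
  rw [this, mul_one, ← Complex.natCast_log]

theorem acoef_absc : LSeries.abscissaOfAbsConv (acoef K) ≤ 1 := by
  apply LSeries.abscissaOfAbsConv_le_of_forall_lt_LSeriesSummable
  intro y hy
  exact (zt_LSeries (K := K) (s := y) (by simpa using hy)).summable

theorem zt_eq_L {s : ℂ} (hs : 1 < s.re) : zt K s = LSeries (acoef K) s := (zt_LSeries hs).tsum_eq.symm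

theorem zt_hasDeriv {s : ℂ} (hs : 1 < s.re) :
    HasDerivAt (zt K) (-(zt K s * LSeries (fun n => (lam K n : ℂ)) s)) s := by
  have hs' : LSeries.abscissaOfAbsConv (acoef K) < s.re := lt_of_le_of_lt acoef_absc (by exact_mod_cast hs)
  have h := LSeries_hasDerivAt hs'
  rw [zt_logMul hs] at h
  refine h.congr_of_eventuallyEq ?_
  have : {s : ℂ | 1 < s.re} ∈ 𝓝 s := (isOpen_lt continuous_const Complex.continuous_re).mem_nhds hs
  filter_upwards [this] with z hz
  exact zt_eq_L hz

theorem zt_dedekind {s : ℂ} (hs : 1 < s.re) : dedekindZeta K s = zt K s := by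
  rw [zt_eq_L hs, dedekindZeta]
  refine LSeries_congr (fun {n} hn => ?_) s
  haveI : Finite ((NI (K := K)) ⁻¹' {n}) := NI_fin n
  haveI : Fintype ((NI (K := K)) ⁻¹' {n}) := Fintype.ofFinite _
  rw [acoef, tsum_fintype]
  simp only [Finset.sum_const, nsmul_eq_mul, mul_one, Finset.card_univ, ← Nat.card_eq_fintype_card]
  congr 1
  refine Nat.card_congr ?_
  refine ⟨fun I => ⟨⟨I.1, mem_nonZeroDivisors_iff_ne_zero.2 ?_⟩, I.2⟩, fun I => ⟨I.1.1, I.2⟩, fun I => rfl, fun I => rfl⟩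
  rintro h
  have := I.2
  rw [h] at this
  simp at this
  exact hn this.symm
end Y1

end PartY1

section PartY2
set_option linter.all false
open Filter Topology NumberField IsDedekindDomain
open scoped nonZeroDivisors

theorem logderiv_lim {g : ℂ → ℂ} {z : ℂ} (hg : AnalyticAt ℂ g z) (h0 : ¬ ∀ᶠ w in 𝓝 z, g w = 0) :
    ∃ m : ℕ, (m = 0 → g z ≠ 0) ∧ (∀ᶠ w in 𝓝[≠] z, g w ≠ 0) ∧
      Tendsto (fun w => (w - z) * (deriv g w / g w)) (𝓝[≠] z) (𝓝 (m : ℂ)) := by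
  have hne : analyticOrderAt g z ≠ ⊤ := fun h => h0 (analyticOrderAt_eq_top.1 h)
  obtain ⟨m, hm⟩ := ENat.ne_top_iff_exists.1 hne
  obtain ⟨k, hk, hk0, hgk⟩ := (hg.analyticOrderAt_eq_natCast).1 hm.symm
  have hkne : ∀ᶠ w in 𝓝 z, k w ≠ 0 := hk.continuousAt.eventually_ne hk0
  refine ⟨m, ?_, ?_, ?_⟩
  · rintro rfl
    have := hgk.self_of_nhds
    simp at this
    rwa [this]
  · filter_upwards [nhdsWithin_le_nhds hgk, nhdsWithin_le_nhds hkne, self_mem_nhdsWithin] with w h1 h2 h3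
    rw [h1]
    exact smul_ne_zero (pow_ne_zero _ (sub_ne_zero.2 h3)) h2
  · have hlim : Tendsto (fun w => (m : ℂ) + (w - z) * (deriv k w / k w)) (𝓝[≠] z) (𝓝 (m : ℂ)) := by
      have hc : ContinuousAt (fun w => (m : ℂ) + (w - z) * (deriv k w / k w)) z := by
        have := hk.deriv.continuousAt
        have := hk.continuousAt
        fun_prop (disch := assumption)
      have := hc.tendsto.mono_left (nhdsWithin_le_nhds (s := {z}ᶜ))
      simpa using this
    refine hlim.congr' ?_
    filter_upwards [nhdsWithin_le_nhds (eventually_eventually_nhds.2 hgk), nhdsWithin_le_nhds hkne,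
      self_mem_nhdsWithin, nhdsWithin_le_nhds hk.eventually_analyticAt] with w h1 h2 h3 h4
    have h3' : w - z ≠ 0 := sub_ne_zero.2 h3
    have e1 : g =ᶠ[𝓝 w] fun w => (w - z) ^ m * k w := h1
    have hd : HasDerivAt (fun w => (w - z) ^ m * k w) ((m * (w - z) ^ (m - 1) * 1) * k w + (w - z) ^ m * deriv k w) w :=
      (((hasDerivAt_id w).sub_const z).pow m).mul h4.differentiableAt.hasDerivAt
    rw [e1.deriv_eq, hd.deriv, e1.self_of_nhds]
    rcases m with _ | m
    · field_simp; simp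
    · simp only [Nat.add_sub_cancel, pow_succ]
      field_simp
      try push_cast
      try ring

section Y2
variable {K : Type*} [Field K] [NumberField K]

theorem isOpen_half : IsOpen {s : ℂ | 1 < s.re} := isOpen_lt continuous_const Complex.continuous_re

theorem lam_absc : LSeries.abscissaOfAbsConv (fun n => (lam K n : ℂ)) ≤ 1 := by
  apply LSeries.abscissaOfAbsConv_le_of_forall_lt_LSeriesSummable
  intro y hy
  exact (lam_LSeries (K := K) (s := y) (by simpa using hy)).summable

theorem zt_analytic {s : ℂ} (hs : 1 < s.re) : AnalyticAt ℂ (zt K) s := by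
  have : DifferentiableOn ℂ (zt K) {s : ℂ | 1 < s.re} := fun z hz => (zt_hasDeriv hz).differentiableAt.differentiableWithinAt
  exact this.analyticAt (isOpen_half.mem_nhds hs)

theorem lamL_cont {s : ℂ} (hs : 1 < s.re) : ContinuousAt (LSeries (fun n => (lam K n : ℂ))) s := by
  refine (LSeries_hasDerivAt (lt_of_le_of_lt lam_absc ?_)).continuousAt
  exact_mod_cast hs

theorem residue_lim : Tendsto (fun s : ℝ => ((s : ℂ) - 1) * zt K s) (𝓝[>] 1) (𝓝 (dedekindZeta_residue K)) := by
  have h := tendsto_sub_one_mul_dedekindZeta_nhdsGT K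
  refine Tendsto.congr' ?_ h
  filter_upwards [self_mem_nhdsWithin] with s hs
  rw [zt_dedekind (by simpa using hs)]

theorem zt_not_ev {s : ℂ} (hs : 1 < s.re) : ¬ ∀ᶠ w in 𝓝 s, zt K w = 0 := by
  intro h
  have hU : IsPreconnected {s : ℂ | 1 < s.re} := (convex_halfSpace_re_gt 1).isPreconnected
  have ha : AnalyticOnNhd ℂ (zt K) {s : ℂ | 1 < s.re} := fun z hz => zt_analytic hz
  have h2 := ha.eqOn_zero_of_preconnected_of_eventuallyEq_zero hU hs h
  have h3 := residue_lim (K := K)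
  have h4 : Tendsto (fun s : ℝ => ((s : ℂ) - 1) * zt K s) (𝓝[>] 1) (𝓝 0) := by
    refine Tendsto.congr' ?_ tendsto_const_nhds
    filter_upwards [self_mem_nhdsWithin] with s hs
    have := h2 (show (s : ℂ) ∈ {s : ℂ | 1 < s.re} by simpa using hs)
    rw [this]; simp
  have := tendsto_nhds_unique h3 h4
  exact dedekindZeta_residue_ne_zero K (by exact_mod_cast this)

theorem zt_ne_zero {s : ℂ} (hs : 1 < s.re) : zt K s ≠ 0 := by
  obtain ⟨m, hm, hne, hlim⟩ := logderiv_lim (zt_analytic (K := K) hs) (zt_not_ev hs)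
  apply hm
  have h0 : Tendsto (fun w => (w - s) * (deriv (zt K) w / zt K w)) (𝓝[≠] s) (𝓝 0) := by
    have hc : Tendsto (fun w => (w - s) * (-LSeries (fun n => (lam K n : ℂ)) w)) (𝓝[≠] s) (𝓝 0) := by
      have hc : ContinuousAt (fun w => (w - s) * (-LSeries (fun n => (lam K n : ℂ)) w)) s := by
        have := lamL_cont (K := K) hs
        fun_prop
      have := hc.tendsto.mono_left (nhdsWithin_le_nhds (s := {s}ᶜ))
      simpa using this
    refine hc.congr' ?_
    filter_upwards [hne, nhdsWithin_le_nhds (isOpen_half.mem_nhds hs)] with w h1 h2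
    rw [(zt_hasDeriv h2).deriv]
    field_simp
  exact_mod_cast tendsto_nhds_unique hlim h0

theorem half_neBot (s0 : ℂ) (hs0 : s0.re = 1) : (𝓝[{s : ℂ | 1 < s.re}] s0).NeBot := by
  rw [← mem_closure_iff_nhdsWithin_neBot, Complex.closure_setOf_lt_re]
  simp [hs0]

theorem lamL_form (s0 : ℂ) (hs0 : s0.re = 1) : ∃ g : ℂ → ℂ, AnalyticAt ℂ g s0 ∧ (¬ ∀ᶠ w in 𝓝 s0, g w = 0) ∧
    ∀ᶠ s in 𝓝[{s : ℂ | 1 < s.re}] s0, LSeries (fun n => (lam K n : ℂ)) s = 1 / (s - 1) - deriv g s / g s ∧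
      g s = (s - 1) * zt K s := by
  obtain ⟨g, hg, he⟩ := zt_cont (K := K) s0 hs0
  refine ⟨g, hg, ?_, ?_⟩
  · intro h
    haveI := half_neBot s0 hs0
    obtain ⟨s, h1, h2, h3⟩ := ((he.and (nhdsWithin_le_nhds h)).and self_mem_nhdsWithin).exists.imp
      fun s h => (⟨h.1.1, h.1.2, h.2⟩ : _ ∧ _ ∧ _)
    rw [h2] at h1
    rcases mul_eq_zero.1 h1 with h | h
    · have h4 : s = 1 := sub_eq_zero.1 h
      rw [h4] at h3; simp at h3
    · exact zt_ne_zero h3 h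
  · filter_upwards [eventually_eventually_nhdsWithin.2 he, self_mem_nhdsWithin] with s h1 h2
    rw [isOpen_half.nhdsWithin_eq h2] at h1
    have h3 := h1.self_of_nhds
    have hd : HasDerivAt (fun s => (s - 1) * zt K s) (1 * zt K s + (s - 1) * (-(zt K s * LSeries (fun n => (lam K n : ℂ)) s))) s :=
      ((hasDerivAt_id s).sub_const 1).mul (zt_hasDeriv h2)
    have e1 : g =ᶠ[𝓝 s] fun s => (s - 1) * zt K s := h1.mono fun w hw => hw.symm
    have hz := zt_ne_zero (K := K) h2
    have hs1 : s - 1 ≠ 0 := by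
      intro h
      have h4 : s = 1 := sub_eq_zero.1 h
      rw [h4] at h2; simp at h2
    refine ⟨?_, h3.symm⟩
    rw [e1.deriv_eq, hd.deriv, ← h3]
    field_simp
    ring

theorem toHalf (t : ℝ) : Tendsto (fun σ : ℝ => (σ : ℂ) + Complex.I * t) (𝓝[>] 1) (𝓝[{s : ℂ | 1 < s.re}] (1 + Complex.I * t)) := by
  rw [tendsto_nhdsWithin_iff]
  constructor
  · have hc : Continuous (fun σ : ℝ => (σ : ℂ) + Complex.I * t) := by fun_prop
    have := (hc.tendsto 1).mono_left (nhdsWithin_le_nhds (s := Set.Ioi 1))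
    simpa using this
  · filter_upwards [self_mem_nhdsWithin] with σ hσ
    simpa using hσ

theorem lamL_ord (t : ℝ) : ∃ m : ℕ, Tendsto (fun σ : ℝ => (σ - 1) * (LSeries (fun n => (lam K n : ℂ)) (σ + Complex.I * t)).re)
      (𝓝[>] 1) (𝓝 ((if t = 0 then 1 else 0) - m)) ∧
    (m = 0 → ∃ l : ℂ, Tendsto (fun s : ℂ => LSeries (fun n => (lam K n : ℂ)) s - 1 / (s - 1))
      (𝓝[{s | 1 < s.re}] (1 + Complex.I * t)) (𝓝 l)) ∧ (t = 0 → m = 0) := by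
  have hs0 : (1 + Complex.I * t : ℂ).re = 1 := by simp
  obtain ⟨g, hg, hg0, he⟩ := lamL_form (K := K) (1 + Complex.I * t) hs0
  obtain ⟨m, hm, hne, hlim⟩ := logderiv_lim hg hg0
  have hle : 𝓝[{s : ℂ | 1 < s.re}] (1 + Complex.I * t) ≤ 𝓝[≠] (1 + Complex.I * t) := by
    apply nhdsWithin_mono
    intro s hs h
    simp only [Set.mem_singleton_iff] at h
    rw [h] at hs
    simp at hs
  refine ⟨m, ?_, ?_, ?_⟩
  · have h1 := (hlim.mono_left hle).comp (toHalf t)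
    have h2 : Tendsto (fun σ : ℝ => ((σ : ℂ) - 1) / (σ + Complex.I * t - 1)) (𝓝[>] 1) (𝓝 ((if t = 0 then 1 else 0 : ℝ) : ℂ)) := by
      by_cases ht : t = 0
      · rw [if_pos ht]
        refine Tendsto.congr' ?_ tendsto_const_nhds
        filter_upwards [self_mem_nhdsWithin] with σ hσ
        have : (σ : ℂ) - 1 ≠ 0 := by
          have : σ - 1 ≠ 0 := (sub_pos.2 hσ).ne'
          exact_mod_cast this
        rw [ht]; simp [this]
      · rw [if_neg ht]
        have hc : ContinuousAt (fun σ : ℝ => ((σ : ℂ) - 1) / (σ + Complex.I * t - 1)) 1 := by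
          have : ((1 : ℝ) + Complex.I * t - 1 : ℂ) ≠ 0 := by simp [ht]
          fun_prop (disch := assumption)
        have := hc.tendsto.mono_left (nhdsWithin_le_nhds (s := Set.Ioi 1))
        simpa using this
    have h3 := (h2.sub h1)
    have h4 := (Complex.continuous_re.tendsto _).comp h3
    simp only [Complex.sub_re, Complex.ofReal_re, Complex.natCast_re] at h4
    refine h4.congr' ?_
    filter_upwards [(toHalf t).eventually he] with σ hσ
    simp only [Function.comp]
    rw [hσ.1, ← Complex.re_ofReal_mul]
    congr 1
    push_cast
    ring
  · intro h0
    have := hm h0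
    refine ⟨_, Tendsto.congr' (f₁ := fun s => - (deriv g s / g s)) ?_ ((hg.deriv.continuousAt.div hg.continuousAt this).neg.tendsto.mono_left nhdsWithin_le_nhds)⟩
    filter_upwards [he] with s hs
    rw [hs.1]; ring
  · rintro rfl
    by_contra hm0
    have hgz : g (1 + Complex.I * (0:ℝ)) = 0 := by
      by_contra hgne
      have hc : Tendsto (fun w => (w - (1 + Complex.I * (0:ℝ))) * (deriv g w / g w)) (𝓝[≠] (1 + Complex.I * (0:ℝ))) (𝓝 0) := by
        have hc : ContinuousAt (fun w => (w - (1 + Complex.I * (0:ℝ))) * (deriv g w / g w)) (1 + Complex.I * (0:ℝ)) := by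
          have := hg.deriv.continuousAt
          have := hg.continuousAt
          fun_prop (disch := assumption)
        have := hc.tendsto.mono_left (nhdsWithin_le_nhds (s := {(1 + Complex.I * (0:ℝ))}ᶜ))
        simpa using this
      exact hm0 (by exact_mod_cast tendsto_nhds_unique hlim hc)
    have h1 := (hg.continuousAt.tendsto.mono_left nhdsWithin_le_nhds).comp (toHalf 0)
    rw [hgz] at h1
    have h2 : Tendsto (fun s : ℝ => ((s : ℂ) - 1) * zt K s) (𝓝[>] 1) (𝓝 0) := by
      refine h1.congr' ?_
      filter_upwards [(toHalf 0).eventually he] with σ hσ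
      simp only [Function.comp]
      rw [hσ.2]; simp
    have := tendsto_nhds_unique (residue_lim (K := K)) h2
    exact dedekindZeta_residue_ne_zero K (by exact_mod_cast this)

theorem lam_nonneg (n : ℕ) : 0 ≤ lam K n := tsum_nonneg fun q => Real.log_natCast_nonneg _

theorem three_four_one {σ : ℝ} (hσ : 1 < σ) (t : ℝ) :
    0 ≤ 3 * (LSeries (fun n => (lam K n : ℂ)) (σ + Complex.I * (0:ℝ))).re
      + 4 * (LSeries (fun n => (lam K n : ℂ)) (σ + Complex.I * t)).re
      + (LSeries (fun n => (lam K n : ℂ)) (σ + Complex.I * (2 * t : ℝ))).re := by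
  have hs : ∀ u : ℝ, HasSum (fun n => (LSeries.term (fun n => (lam K n : ℂ)) (σ + Complex.I * u) n).re)
      (LSeries (fun n => (lam K n : ℂ)) (σ + Complex.I * u)).re := fun u => by
    have h := (lam_LSeries (K := K) (s := σ + Complex.I * u) (by simpa using hσ)).summable.hasSum
    exact Complex.hasSum_re h
  refine ((((hs 0).mul_left 3).add ((hs t).mul_left 4)).add (hs (2 * t))).nonneg fun n => ?_
  rcases Nat.eq_zero_or_pos n with rfl | hn
  · simp
  have hn' : (n : ℂ) ≠ 0 := by exact_mod_cast hn.ne'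
  have ht : ∀ u : ℝ, (LSeries.term (fun n => (lam K n : ℂ)) (σ + Complex.I * u) n).re
      = lam K n * (n : ℝ) ^ (-σ) * Real.cos (u * Real.log n) := by
    intro u
    rw [LSeries.term_of_ne_zero hn.ne', div_eq_mul_inv, ← Complex.cpow_neg, neg_add, Complex.cpow_add _ _ hn']
    have e1 : (n : ℂ) ^ (-(σ : ℂ)) = ((n : ℝ) ^ (-σ) : ℝ) := by
      rw [Complex.ofReal_cpow (Nat.cast_nonneg n)]; simp
    have e2 : ((n : ℂ) ^ (-(Complex.I * u))).re = Real.cos (u * Real.log n) := by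
      have e3 : Complex.log (n : ℂ) * (-(Complex.I * u)) = ((-(u * Real.log n) : ℝ) : ℂ) * Complex.I := by
        rw [← Complex.natCast_log]; push_cast; ring
      rw [Complex.cpow_def_of_ne_zero hn', e3, Complex.exp_ofReal_mul_I_re, Real.cos_neg]
    rw [e1, ← mul_assoc, ← Complex.ofReal_mul, Complex.re_ofReal_mul, e2]
  rw [ht, ht, ht]
  have : 2 * t * Real.log n = 2 * (t * Real.log n) := by ring
  rw [this, Real.cos_two_mul]
  have h1 : 0 ≤ lam K n * (n : ℝ) ^ (-σ) := mul_nonneg (lam_nonneg n) (by positivity)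
  have h2 := mul_nonneg h1 (sq_nonneg (1 + Real.cos (t * Real.log n)))
  simp only [zero_mul, Real.cos_zero]
  nlinarith

theorem lamL_lim (t : ℝ) : ∃ l : ℂ, Tendsto (fun s : ℂ => LSeries (fun n => (lam K n : ℂ)) s - (1 : ℝ) / (s - 1))
      (𝓝[{s | 1 < s.re}] (1 + Complex.I * t)) (𝓝 l) := by
  simp only [Complex.ofReal_one]
  obtain ⟨m, h1, h2, h3⟩ := lamL_ord (K := K) t
  apply h2
  by_cases ht : t = 0
  · exact h3 ht
  obtain ⟨m0, h1', _, _⟩ := lamL_ord (K := K) 0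
  obtain ⟨m2, h1'', _, _⟩ := lamL_ord (K := K) (2 * t)
  rw [if_neg ht] at h1
  rw [if_pos rfl] at h1'
  rw [if_neg (by simpa using ht)] at h1''
  have h := ((h1'.const_mul 3).add (h1.const_mul 4)).add h1''
  have h5 := ge_of_tendsto (b := 0) h (by
    filter_upwards [self_mem_nhdsWithin] with σ hσ
    have := mul_nonneg (sub_pos.2 hσ).le (three_four_one (K := K) hσ t)
    linarith)
  have a1 : (0:ℝ) ≤ m0 := Nat.cast_nonneg _
  have a2 : (0:ℝ) ≤ m2 := Nat.cast_nonneg _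
  have : (m : ℝ) < 1 := by linarith
  exact_mod_cast Nat.lt_one_iff.1 (by exact_mod_cast this)

end Y2

end PartY2

section PartY3
set_option linter.all false
open Filter Topology NumberField IsDedekindDomain
open scoped nonZeroDivisors

section Y3
variable {K : Type*} [Field K] [NumberField K]

theorem prod_Np_dvd (p : ℕ) (V : Finset (HeightOneSpectrum (𝓞 K))) (hV : ∀ v ∈ V, (p : 𝓞 K) ∈ v.asIdeal) :
    ∏ v ∈ V, Np v ∣ p ^ Module.finrank ℤ (𝓞 K) := by
  classical
  rw [← Ideal.absNorm_span_natCast (S := 𝓞 K) p]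
  have h1 : ∏ v ∈ V, Np v = Ideal.absNorm (∏ v ∈ V, v.asIdeal) := (map_prod _ _ _).symm
  rw [h1]
  have hinj : Set.InjOn (fun v : HeightOneSpectrum (𝓞 K) => v.asIdeal) V := fun v _ w _ h => HeightOneSpectrum.ext h
  have h2 : ∏ v ∈ V, v.asIdeal = ∏ I ∈ V.image (fun v => v.asIdeal), I := by
    rw [Finset.prod_image hinj]
  rw [h2]
  apply map_dvd
  apply Finset.prod_primes_dvd
  · intro I hI
    obtain ⟨v, hv, rfl⟩ := Finset.mem_image.1 hI
    exact v.prime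
  · intro I hI
    obtain ⟨v, hv, rfl⟩ := Finset.mem_image.1 hI
    rw [Ideal.dvd_span_singleton]
    exact hV v hv

theorem Np_form (v : HeightOneSpectrum (𝓞 K)) : ∃ p f : ℕ, p.Prime ∧ 1 ≤ f ∧ Np v = p ^ f ∧ (p : 𝓞 K) ∈ v.asIdeal := by
  have h1 : ((Np v : ℕ) : 𝓞 K) ∈ v.asIdeal := Ideal.absNorm_mem v.asIdeal
  have h2 : ∀ n : ℕ, n ≠ 0 → (n : 𝓞 K) ∈ v.asIdeal → ∃ p : ℕ, p.Prime ∧ (p : 𝓞 K) ∈ v.asIdeal := by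
    intro n
    induction n using Nat.recOnMul with
    | zero => intro h; exact absurd rfl h
    | one =>
      intro _ h
      exact absurd ((Ideal.eq_top_iff_one _).2 (by simpa using h)) v.isPrime.ne_top
    | prime p hp => intro _ h; exact ⟨p, hp, h⟩
    | mul a b ha hb =>
      intro h0 h
      rw [Nat.cast_mul] at h
      rcases v.isPrime.mem_or_mem h with h | h
      · exact ha (left_ne_zero_of_mul h0) h
      · exact hb (right_ne_zero_of_mul h0) h
  have h2l := Np_two_le v
  obtain ⟨p, hp, hpv⟩ := h2 _ (by omega) h1
  have h3 := prod_Np_dvd p {v} (by simpa using hpv)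
  rw [Finset.prod_singleton] at h3
  obtain ⟨f, _, hf⟩ := (Nat.dvd_prime_pow hp).1 h3
  refine ⟨p, f, hp, ?_, hf, hpv⟩
  by_contra hf0
  have : f = 0 := by omega
  rw [this, pow_zero] at hf
  omega

theorem lam_le (n : ℕ) : lam K n ≤ Module.finrank ℤ (𝓞 K) * ArithmeticFunction.vonMangoldt n := by
  classical
  haveI : Finite ((fun q => NI (qI (K := K) q)) ⁻¹' {n}) := NqI_fin n
  haveI : Fintype ((fun q => NI (qI (K := K) q)) ⁻¹' {n}) := Fintype.ofFinite _
  rw [lam, tsum_fintype]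
  rcases isEmpty_or_nonempty ((fun q => NI (qI (K := K) q)) ⁻¹' {n}) with he | ⟨⟨q0, hq0⟩⟩
  · simp only [Finset.univ_eq_empty, Finset.sum_empty]
    have := ArithmeticFunction.vonMangoldt_nonneg (n := n)
    positivity
  obtain ⟨p, f, hp, hf, hNp, hpv⟩ := Np_form q0.1
  have hn : n = p ^ (f * (q0.2 + 1)) := by
    have : NI (qI q0) = n := hq0
    rw [← this, NI_qI, hNp, pow_mul]
  have hall : ∀ q : (fun q => NI (qI (K := K) q)) ⁻¹' {n}, ∃ f, 1 ≤ f ∧ Np q.1.1 = p ^ f ∧ (p : 𝓞 K) ∈ q.1.1.asIdeal := by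
    rintro ⟨q, hq⟩
    obtain ⟨p', f', hp', hf', hNp', hpv'⟩ := Np_form q.1
    have hn' : n = p' ^ (f' * (q.2 + 1)) := by
      have : NI (qI q) = n := hq
      rw [← this, NI_qI, hNp', pow_mul]
    have : p' = p := by
      have h1 : p' ∣ p ^ (f * (q0.2 + 1)) := by
        rw [← hn, hn']
        exact dvd_pow_self _ (by positivity)
      exact (Nat.prime_dvd_prime_iff_eq hp' hp).1 (hp'.dvd_of_dvd_pow h1)
    subst this
    exact ⟨f', hf', hNp', hpv'⟩
  have hinj : Function.Injective (fun q : (fun q => NI (qI (K := K) q)) ⁻¹' {n} => q.1.1) := by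
    rintro ⟨⟨v, k⟩, hq⟩ ⟨⟨w, j⟩, hq'⟩ h
    have h' : v = w := h
    subst h'
    have h6 : Np v ^ (k + 1) = Np v ^ (j + 1) := by
      have h1 : NI (qI (v, k)) = n := hq
      have h2 : NI (qI (v, j)) = n := hq'
      rw [NI_qI] at h1 h2
      exact h1.trans h2.symm
    have h7 := Nat.pow_right_injective (Np_two_le v) h6
    have : k = j := by simpa using h7
    subst this
    rfl
  have h1 := prod_Np_dvd p (Finset.univ.image (fun q : (fun q => NI (qI (K := K) q)) ⁻¹' {n} => q.1.1)) (by
    intro v hv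
    obtain ⟨q, _, rfl⟩ := Finset.mem_image.1 hv
    obtain ⟨_, _, _, h⟩ := hall q
    exact h)
  rw [Finset.prod_image hinj.injOn] at h1
  have h2 := Nat.le_of_dvd (pow_pos hp.pos _) h1
  have hpos : ∀ q : (fun q => NI (qI (K := K) q)) ⁻¹' {n}, (Np q.1.1 : ℝ) ≠ 0 := fun q => by
    have := Np_two_le q.1.1
    have : Np q.1.1 ≠ 0 := by omega
    exact_mod_cast this
  rw [← Real.log_prod (fun q _ => hpos q)]
  have hL : ArithmeticFunction.vonMangoldt n = Real.log p := by
    rw [hn, ArithmeticFunction.vonMangoldt_apply_pow (by positivity), ArithmeticFunction.vonMangoldt_apply_prime hp]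
  rw [hL, ← Real.log_pow]
  apply Real.log_le_log
  · apply Finset.prod_pos
    intro q _
    exact lt_of_le_of_ne (Nat.cast_nonneg _) (hpos q).symm
  · exact_mod_cast h2

variable (K) in
noncomputable def nu (p : ℕ) : ℕ := Nat.card {v : HeightOneSpectrum (𝓞 K) // Np v = p}

theorem lam_prime {p : ℕ} (hp : p.Prime) : lam K p = nu K p * Real.log p := by
  haveI : Finite ((fun q => NI (qI (K := K) q)) ⁻¹' {p}) := NqI_fin p
  haveI : Fintype ((fun q => NI (qI (K := K) q)) ⁻¹' {p}) := Fintype.ofFinite _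
  have key : ∀ q : (fun q => NI (qI (K := K) q)) ⁻¹' {p}, Np q.1.1 = p ∧ q.1.2 = 0 := by
    rintro ⟨q, hq⟩
    have : NI (qI q) = p := hq
    rw [NI_qI, Nat.Prime.pow_eq_iff hp] at this
    exact ⟨this.1, by simpa using this.2⟩
  rw [lam, tsum_fintype, Finset.sum_congr rfl (fun q _ => by rw [(key q).1]), Finset.sum_const, nsmul_eq_mul,
    Finset.card_univ, ← Nat.card_eq_fintype_card, nu]
  congr 2
  refine Nat.card_congr ⟨fun q => ⟨q.1.1, (key q).1⟩, fun v => ⟨(v.1, 0), ?_⟩, fun q => ?_, fun v => rfl⟩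
  · show NI (qI (v.1, 0)) = p
    rw [NI_qI]; simpa using v.2
  · apply Subtype.ext
    exact Prod.ext rfl (key q).2.symm

theorem nu_fin {p : ℕ} : Finite {v : HeightOneSpectrum (𝓞 K) // Np v = p} := by
  haveI : Finite ((fun q => NI (qI (K := K) q)) ⁻¹' {p}) := NqI_fin p
  refine Finite.of_injective (β := (fun q => NI (qI (K := K) q)) ⁻¹' {p}) (fun v => ⟨(v.1, 0), ?_⟩) ?_
  · show NI (qI (v.1, 0)) = p
    rw [NI_qI]; simpa using v.2
  · intro v w h
    simpa [Subtype.ext_iff] using h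

theorem nu_le {p : ℕ} (hp : p.Prime) : nu K p ≤ Module.finrank ℤ (𝓞 K) := by
  have h := lam_le (K := K) p
  rw [lam_prime hp, ArithmeticFunction.vonMangoldt_apply_prime hp] at h
  have := Real.log_pos (show (1:ℝ) < p by exact_mod_cast hp.one_lt)
  exact_mod_cast le_of_mul_le_mul_right h this

variable (K) in
theorem pit : Tendsto (fun x : ℝ => (∑ p ∈ (Finset.Icc 1 ⌊x⌋₊).filter Nat.Prime, (nu K p : ℝ) * Real.log p) / x) atTop (𝓝 1) := by
  set D : ℝ := ((Module.finrank ℤ (𝓞 K) : ℕ) : ℝ) with hD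
  have hD0 : 0 ≤ D := Nat.cast_nonneg _
  have hIcc : ∀ m, Finset.Icc 1 m = Finset.Ioc 0 m := fun m => rfl
  have h1 := wiener_ikehara (lam K) lam_nonneg 1 (D * (Real.log 4 + 4)) (fun n => ?_) (fun t => lamL_lim t)
  swap
  · have := Chebyshev.psi_le_const_mul_self (x := n) (Nat.cast_nonneg n)
    rw [Chebyshev.psi, Nat.floor_natCast] at this
    rw [mul_assoc]
    refine le_trans ?_ (mul_le_mul_of_nonneg_left this hD0)
    rw [Finset.mul_sum]
    exact Finset.sum_le_sum fun k _ => lam_le k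
  have h2 : Tendsto (fun x : ℝ => (∑ p ∈ (Finset.Icc 1 ⌊x⌋₊).filter (fun n => ¬ n.Prime), lam K p) / x) atTop (𝓝 0) := by
    have hb : Tendsto (fun x : ℝ => D * ((Chebyshev.psi x - Chebyshev.theta x) / x)) atTop (𝓝 0) := by
      have : Tendsto (fun x : ℝ => ((Chebyshev.psi x - Chebyshev.theta x) / x)) atTop (𝓝 0) := by
        have h3 : Real.sqrt =o[atTop] (fun x : ℝ => x) := by
          rw [Asymptotics.isLittleO_iff_tendsto' (by filter_upwards [eventually_gt_atTop 0] with x hx h using absurd h hx.ne')]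
          simp only [Real.sqrt_div_self]
          exact Real.tendsto_sqrt_atTop.inv_tendsto_atTop
        exact (Chebyshev.isBigO_psi_sub_theta_sqrt.trans_isLittleO h3).tendsto_div_nhds_zero
      simpa using this.const_mul D
    refine squeeze_zero' ?_ ?_ hb
    · filter_upwards [eventually_ge_atTop 0] with x hx
      exact div_nonneg (Finset.sum_nonneg fun n _ => lam_nonneg n) hx
    · filter_upwards [eventually_ge_atTop 0] with x hx
      rw [← mul_div_assoc]
      apply div_le_div_of_nonneg_right _ hx
      rw [Chebyshev.psi_sub_theta_eq_sum_not_prime, Finset.mul_sum, hIcc]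
      exact Finset.sum_le_sum fun n _ => lam_le n
  have h3 := h1.sub h2
  rw [sub_zero] at h3
  refine h3.congr fun x => ?_
  rw [← sub_div]
  congr 1
  rw [← Finset.sum_filter_add_sum_filter_not (Finset.Icc 1 ⌊x⌋₊) Nat.Prime (lam K), add_sub_cancel_right]
  refine Finset.sum_congr rfl fun p hp => ?_
  exact lam_prime (Finset.mem_filter.1 hp).2

end Y3

end PartY3

section PartY4
set_option linter.all false
open Filter Topology NumberField IsDedekindDomain
open scoped nonZeroDivisors

section Y4
variable (K : Type*) [Field K] [NumberField K]

theorem pit_interval : Tendsto (fun x : ℝ => (∑ p ∈ (Finset.Ioc ⌊x / 3⌋₊ ⌊x / 2⌋₊).filter Nat.Prime, (nu K p : ℝ) * Real.log p) / x)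
    atTop (𝓝 (1 / 6)) := by
  have h2 := ((pit K).comp (tendsto_id.atTop_div_const (show (0:ℝ) < 2 by norm_num))).mul_const (1 / 2 : ℝ)
  have h3 := ((pit K).comp (tendsto_id.atTop_div_const (show (0:ℝ) < 3 by norm_num))).mul_const (1 / 3 : ℝ)
  have h := h2.sub h3
  have e : (1 * (1 / 2) - 1 * (1 / 3) : ℝ) = 1 / 6 := by norm_num
  rw [e] at h
  refine h.congr' ?_
  filter_upwards [eventually_gt_atTop 0] with x hx
  simp only [Function.comp, id]
  have hle : ⌊x / 3⌋₊ ≤ ⌊x / 2⌋₊ := Nat.floor_mono (by linarith)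
  have hIcc : ∀ m, Finset.Icc 1 m = Finset.Ioc 0 m := fun m => rfl
  have h4 := Finset.sum_Ioc_consecutive (fun p => if p.Prime then (nu K p : ℝ) * Real.log p else 0) (Nat.zero_le ⌊x / 3⌋₊) hle
  rw [← Finset.sum_filter, ← Finset.sum_filter, ← Finset.sum_filter] at h4
  rw [hIcc, hIcc, ← h4]
  field_simp
  ring

theorem exists_inert (L : Type*) [Field L] [NumberField L] (P0 : ℕ)
    (hKL : ∀ p, p.Prime → P0 ≤ p → 1 ≤ nu L p → 2 ≤ nu K p) :
    ∃ N0 : ℕ, ∀ N : ℕ, N0 ≤ N → ∃ p, p.Prime ∧ N < 3 * p ∧ 2 * p ≤ N ∧ nu K p = 0 := by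
  set D : ℕ := Module.finrank ℤ (𝓞 L) with hD
  have hD0 : 0 < D := by
    rw [hD, RingOfIntegers.rank]; exact Module.finrank_pos
  have hDR : (0:ℝ) < D := by exact_mod_cast hD0
  have h := ((pit_interval K).sub (pit_interval ℚ)).sub ((pit_interval L).mul_const ((D:ℝ)⁻¹))
  have hneg : (1 / 6 - 1 / 6 - 1 / 6 * (D:ℝ)⁻¹ : ℝ) < 0 := by
    have : 0 < (D:ℝ)⁻¹ := by positivity
    linarith
  have h2 := ((h.eventually_lt_const hneg).and (eventually_gt_atTop 0)).natCast_atTop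
  obtain ⟨N0, hN0⟩ := eventually_atTop.1 h2
  refine ⟨max N0 (3 * P0), fun N hN => ?_⟩
  obtain ⟨h3, h4⟩ := hN0 N (le_trans (le_max_left _ _) hN)
  by_contra! hcon
  have hmem : ∀ p ∈ (Finset.Ioc ⌊(N:ℝ) / 3⌋₊ ⌊(N:ℝ) / 2⌋₊).filter Nat.Prime, p.Prime ∧ N < 3 * p ∧ 2 * p ≤ N := by
    intro p hp
    obtain ⟨h5, h6⟩ := Finset.mem_filter.1 hp
    obtain ⟨h7, h8⟩ := Finset.mem_Ioc.1 h5
    rw [Nat.floor_lt (by positivity)] at h7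
    rw [Nat.le_floor_iff (by positivity)] at h8
    refine ⟨h6, ?_, ?_⟩
    · have : (N : ℝ) < 3 * p := by linarith
      exact_mod_cast this
    · have : (2 * p : ℝ) ≤ N := by linarith
      exact_mod_cast this
  have h5 : 0 ≤ ∑ p ∈ (Finset.Ioc ⌊(N:ℝ) / 3⌋₊ ⌊(N:ℝ) / 2⌋₊).filter Nat.Prime,
      ((nu K p : ℝ) * Real.log p - (nu ℚ p : ℝ) * Real.log p - (nu L p : ℝ) * Real.log p * (D:ℝ)⁻¹) := by
    apply Finset.sum_nonneg
    intro p hp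
    obtain ⟨h6, h7, h8⟩ := hmem p hp
    have hK := Nat.pos_of_ne_zero (hcon p h6 h7 h8)
    have hQ : nu ℚ p ≤ 1 := by
      have := nu_le (K := ℚ) h6
      rwa [RingOfIntegers.rank, Module.finrank_self] at this
    have hL : nu L p ≤ D := nu_le h6
    have hP : P0 ≤ p := by
      have := le_trans (le_max_right _ _) hN
      omega
    have key : (nu ℚ p : ℝ) + (nu L p : ℝ) * (D:ℝ)⁻¹ ≤ nu K p := by
      have hQ' : (nu ℚ p : ℝ) ≤ 1 := by exact_mod_cast hQ
      rcases Nat.eq_zero_or_pos (nu L p) with h0 | h0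
      · rw [h0]
        have : (1:ℝ) ≤ nu K p := by exact_mod_cast hK
        simp; linarith
      · have h2 : (2:ℝ) ≤ nu K p := by exact_mod_cast hKL p h6 hP h0
        have : (nu L p : ℝ) * (D:ℝ)⁻¹ ≤ 1 := by
          rw [← div_eq_mul_inv, div_le_one hDR]; exact_mod_cast hL
        linarith
    have hlog := Real.log_natCast_nonneg p
    have := mul_le_mul_of_nonneg_right key hlog
    linarith
  rw [Finset.sum_sub_distrib, Finset.sum_sub_distrib, ← Finset.sum_mul] at h5
  have h6 := div_nonneg h5 h4.le
  rw [sub_div, sub_div, mul_div_right_comm] at h6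
  linarith

variable {K}

theorem nu_pos_hom {p : ℕ} (hp : p.Prime) (h : 1 ≤ nu K p) : Nonempty (𝓞 K →+* ZMod p) := by
  haveI := nu_fin (K := K) (p := p)
  obtain ⟨v, hv⟩ := (Nat.card_pos_iff.1 (show 0 < Nat.card {v : HeightOneSpectrum (𝓞 K) // Np v = p} from h)).1
  have hc : Nat.card (𝓞 K ⧸ v.asIdeal) = p := by
    rw [← hv]; rfl
  haveI : Finite (𝓞 K ⧸ v.asIdeal) := Nat.finite_of_card_ne_zero (by rw [hc]; exact hp.ne_zero)
  haveI : Fintype (𝓞 K ⧸ v.asIdeal) := Fintype.ofFinite _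
  have e := ZMod.ringEquivOfPrime (𝓞 K ⧸ v.asIdeal) hp (by rw [← Nat.card_eq_fintype_card, hc])
  exact ⟨(e.symm.toRingHom).comp (Ideal.Quotient.mk v.asIdeal)⟩

theorem hom_ker {p : ℕ} (hp : p.Prime) (φ : 𝓞 K →+* ZMod p) : ∃ v : HeightOneSpectrum (𝓞 K), Np v = p ∧ v.asIdeal = RingHom.ker φ := by
  haveI : Fact p.Prime := ⟨hp⟩
  have hprime : (RingHom.ker φ).IsPrime := RingHom.ker_isPrime φ
  have hmem : (p : 𝓞 K) ∈ RingHom.ker φ := by simp [RingHom.mem_ker]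
  refine ⟨⟨RingHom.ker φ, hprime, ?_⟩, ?_, rfl⟩
  · intro h
    rw [h] at hmem
    have : (p : 𝓞 K) = 0 := by simpa using hmem
    exact hp.ne_zero (by exact_mod_cast this)
  · have e := RingHom.quotientKerEquivOfSurjective (ZMod.ringHom_surjective φ)
    show Nat.card (𝓞 K ⧸ RingHom.ker φ) = p
    rw [Nat.card_congr e.toEquiv, Nat.card_zmod]

theorem nu_pos_of_hom {p : ℕ} (hp : p.Prime) (φ : 𝓞 K →+* ZMod p) : 1 ≤ nu K p := by
  haveI := nu_fin (K := K) (p := p)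
  obtain ⟨v, hv, _⟩ := hom_ker hp φ
  exact Nat.card_pos_iff.2 ⟨⟨⟨v, hv⟩⟩, inferInstance⟩

theorem nu_two_of_hom {p : ℕ} (hp : p.Prime) (φ ψ : 𝓞 K →+* ZMod p) (h : φ ≠ ψ) : 2 ≤ nu K p := by
  haveI := nu_fin (K := K) (p := p)
  obtain ⟨v, hv, hv'⟩ := hom_ker hp φ
  obtain ⟨w, hw, hw'⟩ := hom_ker hp ψ
  have hne : v ≠ w := by
    rintro rfl
    apply h
    haveI : Fact p.Prime := ⟨hp⟩
    have hk : RingHom.ker φ = RingHom.ker ψ := hv'.symm.trans hw'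
    ext x
    -- x - lift of φ x lies in ker
    have h1 : x - ((φ x).val : 𝓞 K) ∈ RingHom.ker φ := by
      simp [RingHom.mem_ker]
    rw [hk, RingHom.mem_ker] at h1
    simp at h1
    exact (sub_eq_zero.1 h1).symm
  haveI : Nontrivial {v : HeightOneSpectrum (𝓞 K) // Np v = p} := ⟨⟨⟨v, hv⟩, ⟨w, hw⟩, by simpa [Subtype.ext_iff] using hne⟩⟩
  exact Finite.one_lt_card

theorem nu_two (L : Type*) [Field L] [NumberField L] (σ τ : K →+* L) (h : σ ≠ τ) :
    ∃ P0, ∀ p, p.Prime → P0 ≤ p → 1 ≤ nu L p → 2 ≤ nu K p := by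
  set σ' := RingOfIntegers.mapRingHom σ
  set τ' := RingOfIntegers.mapRingHom τ
  have hne : ∃ a, σ' a ≠ τ' a := by
    by_contra! hcon
    apply h
    apply IsLocalization.ringHom_ext (𝓞 K)⁰
    ext a
    have := hcon a
    exact congrArg (algebraMap (𝓞 L) L) this
  obtain ⟨a, ha⟩ := hne
  set δ := σ' a - τ' a
  have hδ : δ ≠ 0 := sub_ne_zero.2 ha
  set n0 := Ideal.absNorm (Ideal.span {δ})
  have hn0 : n0 ≠ 0 := Ideal.absNorm_eq_zero_iff.not.2 (by simpa [Ideal.span_singleton_eq_bot] using hδ)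
  refine ⟨n0 + 1, fun p hp hP hL => ?_⟩
  obtain ⟨φ⟩ := nu_pos_hom hp hL
  apply nu_two_of_hom hp (φ.comp σ') (φ.comp τ')
  intro heq
  have h1 : φ δ = 0 := by
    have := RingHom.congr_fun heq a
    simp only [RingHom.comp_apply] at this
    rw [map_sub, this, sub_self]
  obtain ⟨c, hc⟩ := Ideal.mem_span_singleton.1 (Ideal.absNorm_mem (Ideal.span {δ}))
  have h2 : φ (n0 : 𝓞 L) = 0 := by
    rw [hc, map_mul, h1, zero_mul]
  rw [map_natCast, ZMod.natCast_eq_zero_iff] at h2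
  have := Nat.le_of_dvd (Nat.pos_of_ne_zero hn0) h2
  omega

end Y4

end PartY4

section PartY5
set_option linter.all false
open Filter Topology NumberField IsDedekindDomain Polynomial
open scoped nonZeroDivisors

section Y5

/-- a root mod `p` of the primitive integral polynomial gives a degree-one prime -/
theorem hom_of_root {K : Type*} [Field K] [NumberField K] (G : ℤ[X]) (hG : G.IsPrimitive) (θ : K)
    (i : ℚ →+* K) (hker : ∀ P : ℚ[X], eval₂ i θ P = 0 → G.map (Int.castRingHom ℚ) ∣ P)
    (hgen : ∀ x : K, ∃ P : ℚ[X], eval₂ i θ P = x) :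
    ∃ M : ℕ, ∀ p, p.Prime → M < p → ∀ u : ZMod p, eval₂ (Int.castRingHom (ZMod p)) u G = 0 → 1 ≤ nu K p := by
  have hmap : ∀ P : ℤ[X], aeval θ P = eval₂ i θ (P.map (Int.castRingHom ℚ)) := by
    intro P
    rw [eval₂_map, aeval_def]
    congr 1
    exact Subsingleton.elim _ _
  have hIntg : ∀ x : K, ∃ (m : ℤ) (P : ℤ[X]), m ≠ 0 ∧ aeval θ P = m * x := by
    intro x
    obtain ⟨P, hP⟩ := hgen x
    obtain ⟨m, hmm, hmP⟩ := IsLocalization.integerNormalization_spec ℤ⁰ P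
    refine ⟨m, IsLocalization.integerNormalization ℤ⁰ P, nonZeroDivisors.ne_zero hmm, ?_⟩
    rw [hmap, show Int.castRingHom ℚ = algebraMap ℤ ℚ from rfl, hmP, ← hP, ← coe_eval₂RingHom, zsmul_eq_mul, map_mul, map_intCast]
  have hall : ∃ m : ℤ, m ≠ 0 ∧ ∀ x : 𝓞 K, ∃ P : ℤ[X], aeval θ P = m * (x : K) := by
    obtain ⟨S, hS⟩ := (Module.Finite.fg_top : (⊤ : Submodule ℤ (𝓞 K)).FG)
    choose m P hm hP using hIntg
    refine ⟨∏ s ∈ S, m (s : K), Finset.prod_ne_zero_iff.2 fun s _ => hm _, fun x => ?_⟩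
    have hx : x ∈ Submodule.span ℤ (S : Set (𝓞 K)) := hS ▸ Submodule.mem_top
    induction hx using Submodule.span_induction with
    | mem s hs =>
      obtain ⟨c, hc⟩ := Finset.dvd_prod_of_mem (fun s : 𝓞 K => m (s : K)) hs
      refine ⟨C c * P s, ?_⟩
      rw [hc]
      simp [hP]
      ring
    | zero => exact ⟨0, by simp⟩
    | add a b _ _ ha hb =>
      obtain ⟨A, hA⟩ := ha
      obtain ⟨B, hB⟩ := hb
      exact ⟨A + B, by rw [map_add, hA, hB]; push_cast; ring⟩
    | smul c a _ ha =>
      obtain ⟨A, hA⟩ := ha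
      exact ⟨C c * A, by rw [map_mul, hA]; simp; ring⟩
  obtain ⟨m, hm, hall⟩ := hall
  choose Q hQ using hall
  refine ⟨m.natAbs, fun p hp hMp u hu => ?_⟩
  haveI : Fact p.Prime := ⟨hp⟩
  have hmp : ((m : ℤ) : ZMod p) ≠ 0 := by
    rw [Ne, ZMod.intCast_zmod_eq_zero_iff_dvd]
    intro h
    have := Nat.le_of_dvd (Int.natAbs_pos.2 hm) (Int.natCast_dvd.1 h)
    omega
  set ψ : ℤ[X] →+* ZMod p := eval₂RingHom (Int.castRingHom (ZMod p)) u with hψ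
  have hψ0 : ∀ P : ℤ[X], aeval θ P = 0 → ψ P = 0 := by
    intro P hP
    have h1 := hmap P
    rw [hP] at h1
    have h2 : G ∣ P := (IsPrimitive.Int.dvd_iff_map_cast_dvd_map_cast _ _ hG).2 (hker _ h1.symm)
    obtain ⟨R, rfl⟩ := h2
    rw [map_mul, show ψ G = 0 from hu, zero_mul]
  have hψe : ∀ P R : ℤ[X], aeval θ P = aeval θ R → ψ P = ψ R := by
    intro P R h
    have := hψ0 (P - R) (by rw [map_sub, h, sub_self])
    rwa [map_sub, sub_eq_zero] at this
  have hψC : ∀ c : ℤ, ψ (C c) = c := fun c => by simp [hψ]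
  refine nu_pos_of_hom hp (RingHom.mk' ⟨⟨fun x => ψ (Q x) / m, ?_⟩, ?_⟩ ?_)
  · rw [hψe (Q 1) (C m) (by rw [hQ]; simp), hψC, div_self hmp]
  · intro x y
    have := hψe (C m * Q (x * y)) (Q x * Q y) (by rw [map_mul, map_mul, hQ, hQ, hQ]; simp; ring)
    rw [map_mul, map_mul, hψC] at this
    simp only
    field_simp
    rw [← this, mul_comm]
  · intro x y
    have := hψe (Q (x + y)) (Q x + Q y) (by rw [map_add, hQ, hQ, hQ]; push_cast; ring)
    simp only [MonoidHom.coe_mk, OneHom.coe_mk]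
    rw [this, map_add, add_div]

theorem field_for (F : ℚ[X]) (hirr : Irreducible F) (hd : 2 ≤ F.natDegree) (G : ℤ[X]) (hG : G.IsPrimitive)
    (c : ℚ) (hc : c ≠ 0) (hFG : F = C c * G.map (Int.castRingHom ℚ)) (B : ℕ) :
    ∃ N0 : ℕ, ∀ N : ℕ, N0 ≤ N → ∃ p, p.Prime ∧ B < p ∧ N < 3 * p ∧ 2 * p ≤ N ∧
      ∀ u : ZMod p, eval₂ (Int.castRingHom (ZMod p)) u G ≠ 0 := by
  haveI : Fact (Irreducible F) := ⟨hirr⟩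
  have hfin : Module.Finite ℚ (AdjoinRoot F) := (AdjoinRoot.powerBasis hirr.ne_zero).finite
  have hch : CharZero (AdjoinRoot F) := charZero_of_injective_algebraMap (AdjoinRoot.of F).injective
  haveI : NumberField (AdjoinRoot F) := { to_charZero := hch, to_finiteDimensional := by convert hfin }
  have hfin2 : Module.Finite ℚ F.SplittingField := inferInstance
  have hch2 : CharZero F.SplittingField := charZero_of_injective_algebraMap (algebraMap ℚ F.SplittingField).injective
  haveI : NumberField F.SplittingField := { to_charZero := hch2, to_finiteDimensional := by convert hfin2 }
  have hcard := card_rootSet_eq_natDegree hirr.separable (SplittingField.splits F)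
  obtain ⟨⟨a, ha⟩, ⟨b, hb⟩, hab⟩ := Fintype.one_lt_card_iff.1 (lt_of_lt_of_eq (show 1 < F.natDegree by omega) hcard.symm)
  have ha' := (mem_rootSet.1 ha).2
  have hb' := (mem_rootSet.1 hb).2
  rw [aeval_def] at ha' hb'
  obtain ⟨P0, hP0⟩ := nu_two (K := AdjoinRoot F) F.SplittingField (AdjoinRoot.lift _ a ha') (AdjoinRoot.lift _ b hb') (by
    intro h
    apply hab
    have := RingHom.congr_fun h (AdjoinRoot.root F)
    rw [AdjoinRoot.lift_root, AdjoinRoot.lift_root] at this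
    exact Subtype.ext this)
  obtain ⟨N0, hN0⟩ := exists_inert (AdjoinRoot F) F.SplittingField P0 hP0
  have he : ∀ P : ℚ[X], eval₂ (AdjoinRoot.of F) (AdjoinRoot.root F) P = AdjoinRoot.mk F P := fun P => AdjoinRoot.aeval_eq P
  obtain ⟨M, hM⟩ := hom_of_root G hG (AdjoinRoot.root F) (AdjoinRoot.of F) (by
    intro P hP
    rw [he, AdjoinRoot.mk_eq_zero] at hP
    exact (Dvd.intro_left _ hFG.symm).trans hP) (by
    intro x
    obtain ⟨P, rfl⟩ := AdjoinRoot.mk_surjective x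
    exact ⟨P, he P⟩)
  refine ⟨max N0 (3 * (B + M) + 3), fun N hN => ?_⟩
  have h1 := le_trans (le_max_left _ _) hN
  have h2 := le_trans (le_max_right _ _) hN
  obtain ⟨p, hp, h3, h4, h5⟩ := hN0 N h1
  refine ⟨p, hp, by omega, h3, h4, fun u hu => ?_⟩
  have := hM p hp (by omega) u hu
  omega

end Y5

end PartY5

section PartY6
set_option linter.all false
open Polynomial

theorem dvd_dfact : ∀ n m : ℕ, 0 < m → m ≤ n → m % 2 = n % 2 → m ∣ n.doubleFactorial
  | 0, m, h, h1, _ => by omega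
  | 1, m, h, h1, _ => by
    have : m = 1 := by omega
    subst this; simp
  | n + 2, m, h, h1, h2 => by
    rw [Nat.doubleFactorial_add_two]
    rcases Nat.lt_or_ge n m with h3 | h3
    · have : m = n + 2 := by omega
      rw [this]; exact dvd_mul_right _ _
    · exact (dvd_dfact n m h h3 (by omega)).mul_left _

theorem not_dvd_dfact {p : ℕ} (hp : p.Prime) (hp2 : 2 < p) : ∀ n, n < p ∨ (n < 2 * p ∧ n % 2 = 0) → ¬ p ∣ n.doubleFactorial
  | 0, _ => by simpa using hp.one_lt.ne'
  | 1, _ => by simpa using hp.one_lt.ne'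
  | n + 2, h => by
    rw [Nat.doubleFactorial_add_two, hp.dvd_mul]
    rintro (h1 | h1)
    · have hodd : p % 2 = 1 := (hp.eq_two_or_odd).resolve_left (by omega)
      obtain ⟨k, hk⟩ := h1
      rcases k with _ | _ | k
      · omega
      · omega
      · have : p * (k + 1 + 1) = p * k + 2 * p := by ring
        have : 0 ≤ p * k := Nat.zero_le _
        omega
    · exact not_dvd_dfact hp hp2 n (by omega) h1

theorem not_sq_dvd_dfact {p : ℕ} (hp : p.Prime) (hp2 : 2 < p) : ∀ n, n < 3 * p → ¬ p ^ 2 ∣ n.doubleFactorial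
  | 0, _ => by
    have := hp.one_lt
    simp; omega
  | 1, _ => by
    have := hp.one_lt
    simp; omega
  | n + 2, h => by
    rw [Nat.doubleFactorial_add_two]
    intro h1
    have hodd : p % 2 = 1 := (hp.eq_two_or_odd).resolve_left (by omega)
    by_cases h2 : p ∣ n + 2
    · obtain ⟨k, hk⟩ := h2
      have hk3 : k < 3 := by
        by_contra hk3
        have : p * 3 ≤ p * k := Nat.mul_le_mul_left _ (by omega)
        omega
      have hnk : ¬ p ∣ k := by
        intro h
        rcases Nat.eq_zero_or_pos k with h0 | h0
        · subst h0; omega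
        · have := Nat.le_of_dvd h0 h; omega
      have h3 : p ∣ n.doubleFactorial := by
        rw [hk, pow_two, mul_assoc] at h1
        exact (hp.dvd_mul.1 (Nat.dvd_of_mul_dvd_mul_left hp.pos h1)).resolve_left hnk
      refine not_dvd_dfact hp hp2 n ?_ h3
      interval_cases k
      · omega
      · omega
      · omega
    · have : Nat.Coprime (p ^ 2) (n + 2) := Nat.Coprime.pow_left _ ((Nat.Prime.coprime_iff_not_dvd hp).2 h2)
      exact not_sq_dvd_dfact hp hp2 n (by omega) (this.dvd_of_dvd_mul_left h1)

theorem not_pow_dvd_prod {p : ℕ} (hp : p.Prime) (hp2 : 2 < p) {r : ℕ} (n : Fin r → ℕ) (hn : ∀ i, n i < 3 * p) :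
    ¬ p ^ (r + 1) ∣ ∏ i, (n i).doubleFactorial := by
  intro h
  have h0 : ∀ i, (n i).doubleFactorial ≠ 0 := fun i => (Nat.doubleFactorial_pos _).ne'
  have hne : ∏ i, (n i).doubleFactorial ≠ 0 := Finset.prod_ne_zero_iff.2 fun i _ => h0 i
  rw [hp.pow_dvd_iff_le_factorization hne, Nat.factorization_prod (fun i _ => h0 i), Finset.sum_apply'] at h
  have : ∑ i, (n i).doubleFactorial.factorization p ≤ ∑ i : Fin r, 1 := by
    apply Finset.sum_le_sum
    intro i _
    by_contra hc
    exact not_sq_dvd_dfact hp hp2 (n i) (hn i) ((hp.pow_dvd_iff_le_factorization (h0 i)).2 (by omega))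
  simp at this
  omega

theorem eval_hom (F : ℚ[X]) (d : ℕ) (x y : ℚ) :
    MvPolynomial.eval ![x, y] (F.homogenize d) = ∑ i ∈ Finset.range (d + 1), F.coeff i * x ^ i * y ^ (d - i) := by
  rw [Polynomial.homogenize, map_sum, Finset.Nat.sum_antidiagonal_eq_sum_range_succ_mk]
  refine Finset.sum_congr rfl fun i _ => ?_
  rw [MvPolynomial.eval_monomial, Finsupp.prod_fintype _ _ (by simp)]
  simp [Fin.prod_univ_two, mul_assoc]

theorem exists_prim (F : ℚ[X]) (hF : F ≠ 0) : ∃ (G : ℤ[X]) (c : ℚ), G.IsPrimitive ∧ c ≠ 0 ∧ F = C c * G.map (Int.castRingHom ℚ) := by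
  obtain ⟨m, hm, hmP⟩ := IsLocalization.integerNormalization_spec (nonZeroDivisors ℤ) F
  set P := IsLocalization.integerNormalization (nonZeroDivisors ℤ) F
  have hm0 : (m : ℚ) ≠ 0 := by exact_mod_cast nonZeroDivisors.ne_zero hm
  have e : F = C ((P.content : ℚ) / m) * P.primPart.map (Int.castRingHom ℚ) := by
    have h1 : P.map (Int.castRingHom ℚ) = C (P.content : ℚ) * P.primPart.map (Int.castRingHom ℚ) := by
      conv_lhs => rw [P.eq_C_content_mul_primPart]
      simp
    have h2 : P.map (Int.castRingHom ℚ) = C (m : ℚ) * F := by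
      rw [show Int.castRingHom ℚ = algebraMap ℤ ℚ from rfl, hmP, zsmul_eq_mul]; simp
    have h3 : F = C ((m : ℚ)⁻¹) * (C (m : ℚ) * F) := by
      rw [← mul_assoc, ← C_mul, inv_mul_cancel₀ hm0, C_1, one_mul]
    conv_lhs => rw [h3, ← h2, h1, ← mul_assoc, ← C_mul]
    congr 2
    ring
  refine ⟨P.primPart, P.content / m, P.isPrimitive_primPart, ?_, e⟩
  intro h
  rw [h] at e
  simp at e
  exact hF e

theorem no_large (r : ℕ) (F : ℚ[X]) (d : ℕ) (hdr : r < d) (hd : 3 ≤ d) (hirr : Irreducible F) (hF : F.natDegree = d)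
    (b : ℤ) (hb : b ≠ 0) : ∃ N0 : ℕ, ∀ (n : Fin r → ℕ) (x y : ℤ),
      MvPolynomial.eval ![(x : ℚ), (y : ℚ)] (F.homogenize d) = (b : ℚ) * ∏ i, (Nat.doubleFactorial (n i) : ℚ) →
      ∀ i, n i < N0 := by
  obtain ⟨G, c, hG, hc, hFG⟩ := exists_prim F hirr.ne_zero
  have hGd : G.natDegree = d := by
    rw [← hF, hFG, natDegree_C_mul hc, natDegree_map_eq_of_injective (Int.castRingHom ℚ).injective_int]
  have hA : G.coeff d ≠ 0 := by
    rw [← hGd]; exact leadingCoeff_ne_zero.2 hG.ne_zero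
  obtain ⟨N0, hN0⟩ := field_for F hirr (by omega) G hG c hc hFG
    (2 + (c.num * c.den * b * G.coeff d).natAbs)
  refine ⟨N0, fun n x y heq => ?_⟩
  by_contra! hcon
  obtain ⟨i0, hi0⟩ := hcon
  obtain ⟨j, -, hj⟩ := Finset.exists_max_image Finset.univ n ⟨i0, Finset.mem_univ _⟩
  obtain ⟨p, hp, hBp, h3p, h2p, hnr⟩ := hN0 (n j) (le_trans hi0 (hj i0 (Finset.mem_univ _)))
  haveI : Fact p.Prime := ⟨hp⟩
  have hpn : ¬ (p : ℤ) ∣ c.num * c.den * b * G.coeff d := by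
    intro h
    have h1 : c.num * c.den * b * G.coeff d ≠ 0 := by
      refine mul_ne_zero (mul_ne_zero (mul_ne_zero (Rat.num_ne_zero.2 hc) ?_) hb) hA
      exact_mod_cast c.den_ne_zero
    have := Nat.le_of_dvd (Int.natAbs_pos.2 h1) (Int.natCast_dvd.1 h)
    omega
  have hpZ : Prime (p : ℤ) := Nat.prime_iff_prime_int.1 hp
  have hpA : ¬ (p : ℤ) ∣ G.coeff d := fun h => hpn (h.mul_left _)
  have hpnum : ¬ (p : ℤ) ∣ c.num := fun h => hpn (((h.mul_right _).mul_right _).mul_right _)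
  have hpdb : ¬ (p : ℤ) ∣ c.den * b := fun h => hpn (by
    rw [mul_assoc c.num]; exact (h.mul_left _).mul_right _)
  set Φ : ℤ := ∑ i ∈ Finset.range (d + 1), G.coeff i * x ^ i * y ^ (d - i) with hΦ
  have hZ : c.num * Φ = c.den * b * (∏ i, (n i).doubleFactorial : ℕ) := by
    rw [eval_hom] at heq
    have h1 : ∑ i ∈ Finset.range (d + 1), F.coeff i * (x : ℚ) ^ i * (y : ℚ) ^ (d - i) = c * Φ := by
      rw [hΦ, Int.cast_sum, Finset.mul_sum]
      refine Finset.sum_congr rfl fun i _ => ?_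
      rw [hFG, coeff_C_mul, coeff_map]
      simp
      ring
    rw [h1] at heq
    have hden : (c.den : ℚ) ≠ 0 := by exact_mod_cast c.den_ne_zero
    have h2 : (c.num : ℚ) = c * c.den := (Rat.mul_den_eq_num c).symm
    have : ((c.num * Φ : ℤ) : ℚ) = ((c.den * b * (∏ i, (n i).doubleFactorial : ℕ) : ℤ) : ℚ) := by
      push_cast
      rw [h2]
      linear_combination (c.den : ℚ) * heq
    exact_mod_cast this
  have hpΦ : (p : ℤ) ∣ Φ := by
    have h1 : p ∣ ∏ i, (n i).doubleFactorial := by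
      refine Dvd.dvd.trans ?_ (Finset.dvd_prod_of_mem (fun i => (n i).doubleFactorial) (Finset.mem_univ j))
      by_cases hpar : p % 2 = n j % 2
      · exact dvd_dfact _ _ hp.pos (by omega) hpar
      · have hodd : p % 2 = 1 := (hp.eq_two_or_odd).resolve_left (by omega)
        exact (dvd_mul_left p 2).trans (dvd_dfact _ (2 * p) (by omega) h2p (by omega))
    have h2 : (p : ℤ) ∣ c.num * Φ := by
      rw [hZ]
      exact (Int.natCast_dvd_natCast.2 h1).mul_left _
    exact (hpZ.dvd_or_dvd h2).resolve_left hpnum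
  have hnot : ¬ ((p : ℤ) ∣ x ∧ (p : ℤ) ∣ y) := by
    rintro ⟨⟨x', rfl⟩, ⟨y', rfl⟩⟩
    have h1 : (p : ℤ) ^ d ∣ Φ := by
      rw [hΦ]
      apply Finset.dvd_sum
      intro i hi
      have hi' : i ≤ d := by have := Finset.mem_range.1 hi; omega
      have : (p : ℤ) ^ d = (p : ℤ) ^ i * (p : ℤ) ^ (d - i) := by rw [← pow_add]; congr 1; omega
      refine ⟨G.coeff i * x' ^ i * y' ^ (d - i), ?_⟩
      rw [this, mul_pow, mul_pow]; ring
    have h2 : (p : ℤ) ^ d ∣ c.den * b * (∏ i, (n i).doubleFactorial : ℕ) := by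
      rw [← hZ]; exact h1.mul_left _
    have h3 : (p : ℤ) ^ d ∣ ((∏ i, (n i).doubleFactorial : ℕ) : ℤ) := hpZ.pow_dvd_of_dvd_mul_left _ hpdb h2
    have h4 : p ^ d ∣ ∏ i, (n i).doubleFactorial := by exact_mod_cast h3
    refine not_pow_dvd_prod hp (by omega) n (fun i => ?_) ((pow_dvd_pow p (by omega : r + 1 ≤ d)).trans h4)
    have := hj i (Finset.mem_univ _)
    omega
  have hyp : ¬ (p : ℤ) ∣ y := by
    intro hy
    have h1 : (p : ℤ) ∣ ∑ i ∈ Finset.range d, G.coeff i * x ^ i * y ^ (d - i) := by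
      apply Finset.dvd_sum
      intro i hi
      have := Finset.mem_range.1 hi
      exact (dvd_pow hy (by omega)).mul_left _
    rw [hΦ, Finset.sum_range_succ] at hpΦ
    have h2 := (Int.dvd_add_right h1).1 hpΦ
    rw [Nat.sub_self, pow_zero, mul_one] at h2
    exact hnot ⟨hpZ.dvd_of_dvd_pow ((hpZ.dvd_or_dvd h2).resolve_left hpA), hy⟩
  have hy0 : ((y : ℤ) : ZMod p) ≠ 0 := by
    rw [Ne, ZMod.intCast_zmod_eq_zero_iff_dvd]; exact hyp
  apply hnr ((x : ZMod p) / y)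
  have h1 : ((Φ : ℤ) : ZMod p) = 0 := (ZMod.intCast_zmod_eq_zero_iff_dvd _ _).2 hpΦ
  rw [eval₂_eq_sum_range' _ (show G.natDegree < d + 1 by omega)]
  have h2 : (∑ i ∈ Finset.range (d + 1), (Int.castRingHom (ZMod p)) (G.coeff i) * ((x : ZMod p) / y) ^ i) * (y : ZMod p) ^ d
      = ((Φ : ℤ) : ZMod p) := by
    rw [hΦ, Int.cast_sum, Finset.sum_mul]
    refine Finset.sum_congr rfl fun i hi => ?_
    have hi' : i ≤ d := by have := Finset.mem_range.1 hi; omega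
    have : (y : ZMod p) ^ d = (y : ZMod p) ^ i * (y : ZMod p) ^ (d - i) := by rw [← pow_add]; congr 1; omega
    rw [this, div_pow]
    push_cast
    field_simp
    simp
    ring
  rw [h1] at h2
  exact (mul_eq_zero.1 h2).resolve_right (pow_ne_zero _ hy0)

end PartY6

/-- Let `r ≥ 1` and let `f(x,y) ∈ ℚ[x,y]` be an irreducible
homogeneous polynomial of degree `d` with `d > r` and `d ≥ 3`, and let `b` be a
nonzero integer. Then the equation `b·n₁‼ ⋯ n_r‼ = f(x,y)` has only finitely many
solutions `(n₁, …, n_r, x, y)`. -/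
theorem stmt_9 (r : ℕ) (hr : 1 ≤ r) (f : MvPolynomial (Fin 2) ℚ) (d : ℕ)
    (hdr : r < d) (hd : 3 ≤ d) (hirr : Irreducible f) (hhom : f.IsHomogeneous d)
    (b : ℤ) (hb : b ≠ 0) :
    {q : (Fin r → ℕ) × ℤ × ℤ |
      MvPolynomial.eval ![(q.2.1 : ℚ), (q.2.2 : ℚ)] f
        = (b : ℚ) * ∏ i, (Nat.doubleFactorial (q.1 i) : ℚ)}.Finite := by
  obtain ⟨F, hFirr, hFd, rfl⟩ := form_dehom f d hd hirr hhom
  obtain ⟨N0, hN0⟩ := no_large r F d hdr hd hFirr hFd b hb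
  have hfin : (⋃ n ∈ Set.pi Set.univ (fun _ : Fin r => Set.Iio N0), ({n} : Set (Fin r → ℕ)) ×ˢ
      {p : ℤ × ℤ | MvPolynomial.eval ![(p.1 : ℚ), (p.2 : ℚ)] (F.homogenize d)
        = (b : ℚ) * ∏ i, (Nat.doubleFactorial (n i) : ℚ)}).Finite := by
    refine Set.Finite.biUnion (Set.Finite.pi fun _ => Set.finite_Iio N0) fun n _ => ?_
    refine (Set.finite_singleton n).prod (thue_form F d hd hFirr hFd _ ?_)
    refine mul_ne_zero (by exact_mod_cast hb) (Finset.prod_ne_zero_iff.2 fun i _ => ?_)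
    exact_mod_cast (Nat.doubleFactorial_pos _).ne'
  refine hfin.subset ?_
  rintro ⟨n, x, y⟩ hq
  simp only [Set.mem_iUnion]
  refine ⟨n, fun i _ => hN0 n x y hq i, ?_⟩
  exact ⟨rfl, hq⟩
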